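/- arXiv:2403.15201 — 4 statements merged into one kernel-verified Lean document; each statement's English description precedes it below -/
import Mathlib

section
/- Let C be a hereditary class of finite graphs of almost bounded twin-width, i.e., for every real ε > 0 there is a constant c (depending on ε and C) such that every n-vertex graph in C has twin-width at most c·n^ε. Then C is monadically dependent. -/
set_option autoImplicit false

/-- A class of finite graphs, given as a predicate singling out, for each `n`,
the graphs on vertex set `Fin n` that belong to the class. -/
abbrev GraphClass : Type := ∀ n : ℕ, SimpleGraph (Fin n) → Prop

open FirstOrder

/-- The first-order language of graphs expanded by `k` unary color predicates:
one binary relation symbol (adjacency) and `k` unary relation symbols (the colors). -/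
def colLang (k : ℕ) : FirstOrder.Language where
  Functions := fun _ => Empty
  Relations := fun n =>
    match n with
    | 1 => Fin k
    | 2 => Unit
    | _ => Empty

/-- Interpretation of the relation symbols of `colLang k` in a graph `G`
whose vertices are colored by `c`. -/
def colRelMap {k : ℕ} {V : Type} (G : SimpleGraph V) (c : V → Fin k) :
    ∀ n : ℕ, (colLang k).Relations n → (Fin n → V) → Prop
  | 0, r, _ => Empty.elim r
  | 1, i, x => c (x 0) = i
  | 2, _, x => G.Adj (x 0) (x 1)
  | _ + 3, r, _ => Empty.elim r

/-- The `colLang k`-structure determined by a graph `G` with coloring `c`. -/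
def colStruct {k : ℕ} {V : Type} (G : SimpleGraph V) (c : V → Fin k) :
    (colLang k).Structure V where
  funMap := fun f _ => Empty.elim f
  RelMap := fun {n} => colRelMap G c n

/-- Satisfaction of a formula `φ(x, y)` at a pair of vertices of the colored graph `(G, c)`. -/
def colSat {k : ℕ} {V : Type} (G : SimpleGraph V) (c : V → Fin k)
    (φ : (colLang k).Formula (Fin 2)) (u v : V) : Prop :=
  letI := colStruct G c
  φ.Realize ![u, v]

/-- The class `C` transduces the class of all graphs: for some number `k` of colors and
some first-order formula `φ(x,y)` over the language of graphs with `k` unary predicates,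
every finite graph `H` is obtained by coloring some `G ∈ C`, taking the graph with edges
`{uv : u ≠ v and φ(u,v) ∨ φ(v,u)}`, and passing to an induced subgraph isomorphic to `H`. -/
def TransducesAllGraphs (C : GraphClass) : Prop :=
  ∃ (k : ℕ) (φ : (colLang k).Formula (Fin 2)),
    ∀ (n : ℕ) (H : SimpleGraph (Fin n)),
      ∃ (N : ℕ) (G : SimpleGraph (Fin N)), C N G ∧
        ∃ (c : Fin N → Fin k) (e : Fin n → Fin N), Function.Injective e ∧
          ∀ u v : Fin n, H.Adj u v ↔
            (e u ≠ e v ∧ (colSat G c φ (e u) (e v) ∨ colSat G c φ (e v) (e u)))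

/-- A graph class is monadically dependent if it does not transduce the class of all graphs. -/
def MonadicallyDependent (C : GraphClass) : Prop := ¬ TransducesAllGraphs C

/-- `C` is a hereditary graph class: it is closed under induced subgraphs. -/
def Hereditary (C : GraphClass) : Prop :=
  ∀ (n : ℕ) (G : SimpleGraph (Fin n)) (m : ℕ) (f : Fin m → Fin n),
    Function.Injective f → C n G → C m (G.comap f)

/-- Two vertex sets are homogeneously connected in `G`:
either complete or anticomplete to each other. -/
def Homog {V : Type} (G : SimpleGraph V) (A B : Finset V) : Prop :=
  (∀ u ∈ A, ∀ v ∈ B, G.Adj u v) ∨ (∀ u ∈ A, ∀ v ∈ B, ¬ G.Adj u v)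

/-- The partition `P` has red degree at most `d` with respect to `G`: every part is
inhomogeneously connected to at most `d` other parts. -/
def RedDegLE {V : Type} [Fintype V] [DecidableEq V] (G : SimpleGraph V)
    (P : Finpartition (Finset.univ : Finset V)) (d : ℕ) : Prop :=
  ∀ A ∈ P.parts,
    Set.ncard {B : Finset V | B ∈ P.parts ∧ B ≠ A ∧ ¬ Homog G A B} ≤ d

/-- `G` has twin-width at most `d`: there is a contraction sequence `P 0, …, P (|V| - 1)`
(starting with singletons, ending with one part, each step merging two parts) all of whose
partitions have red degree at most `d`. -/
def TwwLE {V : Type} [Fintype V] [DecidableEq V] (G : SimpleGraph V) (d : ℕ) : Prop :=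
  ∃ P : ℕ → Finpartition (Finset.univ : Finset V),
    (∀ A ∈ (P 0).parts, A.card = 1) ∧
    (1 ≤ Fintype.card V → (P (Fintype.card V - 1)).parts = {Finset.univ}) ∧
    (∀ i : ℕ, i + 1 < Fintype.card V →
      ∃ A ∈ (P i).parts, ∃ B ∈ (P i).parts, A ≠ B ∧
        (P (i + 1)).parts = insert (A ∪ B) ((((P i).parts).erase A).erase B)) ∧
    (∀ i : ℕ, i < Fintype.card V → RedDegLE G (P i) d)

/-! ## A relativized first-order logic -/

/-- First-order formulas over graphs with unary predicates, with named variables. -/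
inductive Fm : Type
  | fls : Fm
  | eq (x y : ℕ) : Fm
  | col (c x : ℕ) : Fm
  | adj (x y : ℕ) : Fm
  | imp (φ ψ : Fm) : Fm
  | ex (x : ℕ) (φ : Fm) : Fm

/-- Satisfaction, where every quantifier occurrence (addressed by a path) has its own domain. -/
def Sat {V : Type} (G : SimpleGraph V) (col : ℕ → V → Prop) :
    Fm → (List Bool → Set V) → (ℕ → V) → Prop
  | .fls, _, _ => False
  | .eq x y, _, a => a x = a y
  | .col c x, _, a => col c (a x)
  | .adj x y, _, a => G.Adj (a x) (a y)
  | .imp φ ψ, D, a =>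
      Sat G col φ (fun l => D (false :: l)) a → Sat G col ψ (fun l => D (true :: l)) a
  | .ex x φ, D, a => ∃ z ∈ D [], Sat G col φ (fun l => D (true :: l)) (Function.update a x z)

/-- Replace the domain of the outermost quantifier. -/
def modD {V : Type} (D : List Bool → Set V) (Z : Set V) : List Bool → Set V
  | [] => Z
  | b :: l => D (b :: l)

/-- The assignment that follows `w` on `S`, `r` on `F` and `p` elsewhere. -/
def mix {V : Type} (S F : Finset ℕ) (w r p : ℕ → V) : ℕ → V :=
  fun x => if x ∈ S then w x else if x ∈ F then r x else p x

/-- No `k` many `V`-tuples are shattered by `U`-tuples. -/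
def NoShatter (C : GraphClass) (φ : Fm) (U V : Finset ℕ) (k : ℕ) : Prop :=
  ∀ (N : ℕ) (G : SimpleGraph (Fin N)), C N G → ∀ (col : ℕ → Fin N → Prop)
    (D : List Bool → Set (Fin N)) (p : ℕ → Fin N) (v : Fin k → ℕ → Fin N)
    (u : (Fin k → Bool) → ℕ → Fin N),
    ¬ ∀ S j, Sat G col φ D (mix U V (u S) (v j) p) ↔ S j = true

/-- Bounded VC-dimension for all splittings of the variables. -/
def Tame (C : GraphClass) (φ : Fm) : Prop :=
  ∀ R : Finset ℕ, ∃ k, ∀ U V : Finset ℕ, U ⊆ R → V ⊆ R → Disjoint U V → NoShatter C φ U V k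

/-- Growing zones: vertices in `B i` with the same label look alike from outside `B (i+1)`. -/
structure Zone {V : Type} (G : SimpleGraph V) (m L : ℕ) (B : ℕ → Set V) (cl : V → ℕ) : Prop where
  mono : Monotone B
  lt : ∀ v ∈ B L, cl v < m
  hom : ∀ i, i ≤ L → ∀ w ∈ B i, ∀ w' ∈ B i, cl w = cl w' → ∀ v, v ∉ B (i + 1) →
    (G.Adj w v ↔ G.Adj w' v)

/-- The gap between near and far needed for a formula. -/
def gp : Fm → ℕ
  | .fls => 1
  | .eq _ _ => 1
  | .col _ _ => 1
  | .adj _ _ => 1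
  | .imp φ ψ => max (gp φ) (gp ψ)
  | .ex _ φ => gp φ + gp φ

/-- Few classes of near tuples with respect to far tuples. -/
def Cnt (C : GraphClass) (φ : Fm) : Prop :=
  ∀ R : Finset ℕ, ∃ c : ℕ, ∀ S F : Finset ℕ, S ⊆ R → F ⊆ R → Disjoint S F →
    ∀ (N : ℕ) (G : SimpleGraph (Fin N)), C N G → ∀ (col : ℕ → Fin N → Prop)
    (D : List Bool → Set (Fin N)) (m L : ℕ) (B : ℕ → Set (Fin N)) (cl : Fin N → ℕ),
    Zone G m L B cl → 2 ≤ m → ∀ i j, i + gp φ ≤ j → j ≤ L → ∀ p : ℕ → Fin N,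
    ∃ f : (ℕ → Fin N) → ℕ, (∀ w, f w < m ^ c) ∧
      ∀ w w', (∀ x ∈ S, w x ∈ B i) → (∀ x ∈ S, w' x ∈ B i) → f w = f w' →
        ∀ r, (∀ x ∈ F, r x ∉ B j) →
          (Sat G col φ D (mix S F w r p) ↔ Sat G col φ D (mix S F w' r p))

/-- Local representation of `φ` on near families by far instances of `φ` and few instances
of a tame formula. -/
def Loc (C : GraphClass) (φ : Fm) : Prop :=
  ∃ (σ : Fm) (y : ℕ), Tame C σ ∧ ∀ R : Finset ℕ, ∃ c : ℕ, ∀ S F : Finset ℕ, S ⊆ R → F ⊆ R →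
    Disjoint S F →
    ∀ (N : ℕ) (G : SimpleGraph (Fin N)), C N G → ∀ (col : ℕ → Fin N → Prop)
    (D : List Bool → Set (Fin N)) (m L : ℕ) (B : ℕ → Set (Fin N)) (cl : Fin N → ℕ),
    Zone G m L B cl → 2 ≤ m → ∀ i j, i + gp φ ≤ j → j ≤ L → ∀ p : ℕ → Fin N,
    ∃ (f : (ℕ → Fin N) → ℕ) (D₁ D₂ : List Bool → Set (Fin N)) (A : (ℕ → Fin N) → ℕ → Prop)
      (W : ℕ → ℕ → Fin N), (∀ w, f w < m ^ c) ∧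
      ∀ w w', (∀ x ∈ S, w x ∈ B i) → (∀ x ∈ S, w' x ∈ B i) → f w = f w' →
        ∀ r, (∀ x ∈ F, r x ∉ B j) →
          (Sat G col φ D (mix S F w r p) ↔ (Sat G col φ D₁ (mix S F w' r p) ∨
            ∃ κ < m ^ c, A w κ ∧ Sat G col σ D₂ (mix (insert y S) (F.erase y) (W κ) r p)))

/-! ## Sauer–Shelah -/

lemma card_small_sets (M k : ℕ) :
    (Finset.univ.filter (fun s : Finset (Fin M) => s.card ≤ k)).card ≤ (M + 1) ^ k := by
  classical
  have : (M + 1) ^ k = Fintype.card (Fin k → Option (Fin M)) := by simp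
  rw [this, ← Finset.card_univ]
  refine Finset.card_le_card_of_surjOn
    (fun g => Finset.univ.filter (fun b => ∃ i, g i = some b)) ?_
  intro s hs
  simp only [Finset.coe_filter, Finset.mem_univ, true_and, Set.mem_setOf_eq] at hs
  refine ⟨fun i => if h : i.val < s.card then some (s.equivFin.symm ⟨i, h⟩ : Fin M) else none,
    by simp, ?_⟩
  ext b
  simp only [Finset.mem_filter, Finset.mem_univ, true_and]
  constructor
  · rintro ⟨i, hi⟩
    split_ifs at hi with h
    simp only [Option.some.injEq] at hi
    rw [← hi]
    exact (s.equivFin.symm ⟨i, h⟩).2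
  · intro hb
    refine ⟨⟨(s.equivFin ⟨b, hb⟩).val, lt_of_lt_of_le (s.equivFin ⟨b, hb⟩).2 hs⟩, ?_⟩
    simp

lemma sauer {α : Type*} (M k : ℕ) (Q : α → Fin M → Prop)
    (h : ¬ ∃ (v : Fin k → Fin M) (u : (Fin k → Bool) → α), ∀ S j, Q (u S) (v j) ↔ S j = true) :
    ∃ f : α → ℕ, (∀ a, f a < (M + 1) ^ k) ∧ ∀ a a', f a = f a' → ∀ b, Q a b ↔ Q a' b := by
  classical
  let tr : α → Finset (Fin M) := fun a => Finset.univ.filter (fun b => Q a b)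
  let 𝒜 : Finset (Finset (Fin M)) := Finset.univ.filter (fun s => ∃ a, s = tr a)
  have hcard : 𝒜.card ≤ (M + 1) ^ k := by
    refine le_trans (Finset.card_le_card_shatterer 𝒜) (le_trans (Finset.card_le_card ?_)
      (card_small_sets M k))
    intro s hs
    rw [Finset.mem_shatterer] at hs
    simp only [Finset.mem_filter, Finset.mem_univ, true_and]
    by_contra hlt
    push Not at hlt
    apply h
    obtain ⟨s', hs', hk⟩ := Finset.exists_subset_card_eq hlt.le
    let v : Fin k → Fin M := fun j => (s'.equivFinOfCardEq hk).symm j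
    have hv : Function.Injective v := fun a b hab =>
      (s'.equivFinOfCardEq hk).symm.injective (Subtype.ext hab)
    have hvs : ∀ j, v j ∈ s := fun j => hs' ((s'.equivFinOfCardEq hk).symm j).2
    have key : ∀ S : Fin k → Bool, ∃ a, ∀ j, Q a (v j) ↔ S j = true := by
      intro S
      have hsub : (Finset.univ.filter (fun j => S j = true)).image v ⊆ s := by
        intro x hx
        simp only [Finset.mem_image] at hx
        obtain ⟨j, -, rfl⟩ := hx
        exact hvs j
      obtain ⟨t, ht, hst⟩ := hs hsub
      simp only [𝒜, Finset.mem_filter, Finset.mem_univ, true_and] at ht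
      obtain ⟨a, rfl⟩ := ht
      refine ⟨a, fun j => ?_⟩
      have : v j ∈ s ∩ tr a ↔ v j ∈ (Finset.univ.filter (fun j => S j = true)).image v := by
        rw [hst]
      simp only [Finset.mem_inter, hvs j, true_and, tr, Finset.mem_filter, Finset.mem_univ,
        Finset.mem_image] at this
      rw [this]
      constructor
      · rintro ⟨j', h1, h2⟩
        rw [← hv h2]; exact h1
      · intro hj; exact ⟨j, hj, rfl⟩
    choose u hu using key
    exact ⟨v, u, hu⟩
  have hmem : ∀ a, tr a ∈ 𝒜 := fun a => by simp [𝒜]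
  refine ⟨fun a => (𝒜.equivFin ⟨tr a, hmem a⟩).val, fun a => lt_of_lt_of_le (Fin.isLt _) hcard, ?_⟩
  intro a a' haa b
  have h1 := 𝒜.equivFin.injective (Fin.ext haa)
  have h2 : tr a = tr a' := congrArg Subtype.val h1
  have : b ∈ tr a ↔ b ∈ tr a' := by rw [h2]
  simpa [tr] using this

/-! ## Counting near classes -/

lemma comb_inj {a₁ a₂ b₁ b₂ b : ℕ} (h1 : a₂ < b) (h2 : b₂ < b)
    (h : a₁ * b + a₂ = b₁ * b + b₂) : a₁ = b₁ ∧ a₂ = b₂ := by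
  have hm := congrArg (· % b) h
  simp only [Nat.mul_add_mod_self_right, Nat.mod_eq_of_lt h1, Nat.mod_eq_of_lt h2] at hm
  subst hm
  have hb : 0 < b := by omega
  exact ⟨Nat.eq_of_mul_eq_mul_right hb (by omega), rfl⟩

lemma comb_lt {a b x y : ℕ} (ha : a < x) (hb : b < y) : a * y + b < x * y := by
  have : (a + 1) * y ≤ x * y := Nat.mul_le_mul_right y ha
  nlinarith

lemma cnt_fls (C : GraphClass) : Cnt C .fls := by
  intro R
  refine ⟨0, fun S F _ _ _ N G _ col D m L B cl _ _ i j _ _ p => ⟨fun _ => 0, by simp, ?_⟩⟩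
  intros; simp [Sat]

lemma bit_lt {m : ℕ} (hm : 2 ≤ m) (P : Prop) [Decidable P] : (if P then 1 else 0) < m ^ 1 := by
  split_ifs <;> simp <;> omega

lemma bit_eq {P Q : Prop} [Decidable P] [Decidable Q]
    (h : (if P then 1 else 0 : ℕ) = if Q then 1 else 0) : P ↔ Q := by
  by_cases hp : P <;> by_cases hq : Q <;> simp_all

lemma cnt_col (C : GraphClass) (c x : ℕ) : Cnt C (.col c x) := by
  classical
  intro R
  refine ⟨1, fun S F _ _ hd N G _ col D m L B cl _ hm i j _ _ p =>
    ⟨fun w => if col c (mix S F w p p x) then 1 else 0, fun w => bit_lt hm _, ?_⟩⟩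
  intro w w' _ _ hf r _
  have := bit_eq hf
  by_cases hx : x ∈ F
  · have hS : x ∉ S := fun h => Finset.disjoint_left.1 hd h hx
    simp [Sat, mix, hx, hS]
  · simpa [Sat, mix, hx] using this

lemma cnt_eq (C : GraphClass) (x y : ℕ) : Cnt C (.eq x y) := by
  classical
  intro R
  refine ⟨1, fun S F _ _ hd N G _ col D m L B cl hz hm i j hij _ p =>
    ⟨fun w => if mix S F w p p x = mix S F w p p y then 1 else 0, fun w => bit_lt hm _, ?_⟩⟩
  intro w w' hw hw' hf r hr
  have := bit_eq hf
  have hB : B i ⊆ B j := hz.mono (by omega)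
  have hne : ∀ a ∈ B i, ∀ b, b ∉ B j → a ≠ b := fun a ha b hb h => hb (h ▸ hB ha)
  by_cases hx : x ∈ F
  · have hS : x ∉ S := fun h => Finset.disjoint_left.1 hd h hx
    by_cases hy : y ∈ S
    · have h1 := hne _ (hw y hy) _ (hr x hx)
      have h2 := hne _ (hw' y hy) _ (hr x hx)
      simp [Sat, mix, hx, hS, hy, h1.symm, h2.symm]
    · simp [Sat, mix, hx, hS, hy]
  · by_cases hy : y ∈ F
    · have hS : y ∉ S := fun h => Finset.disjoint_left.1 hd h hy
      by_cases hx' : x ∈ S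
      · have h1 := hne _ (hw x hx') _ (hr y hy)
        have h2 := hne _ (hw' x hx') _ (hr y hy)
        simp [Sat, mix, hy, hS, hx', h1, h2]
      · simp [Sat, mix, hx, hx', hy, hS]
    · simpa [Sat, mix, hx, hy] using this

lemma cnt_adj (C : GraphClass) (x y : ℕ) : Cnt C (.adj x y) := by
  classical
  intro R
  refine ⟨1, fun S F _ _ hd N G _ col D m L B cl hz hm i j hij hjL p =>
    ⟨fun w => if x ∈ F ∧ y ∈ S then (if cl (w y) < m then cl (w y) else 0) else
      if y ∈ F ∧ x ∈ S then (if cl (w x) < m then cl (w x) else 0) else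
      if G.Adj (mix S F w p p x) (mix S F w p p y) then 1 else 0, ?_, ?_⟩⟩
  · intro w
    simp only [pow_one]
    split_ifs <;> omega
  intro w w' hw hw' hf r hr
  simp only [gp] at hij
  have hBL : B i ⊆ B L := hz.mono (by omega)
  have hB1 : B (i + 1) ⊆ B j := hz.mono (by omega)
  have key : ∀ x ∈ S, (if cl (w x) < m then cl (w x) else 0) =
      (if cl (w' x) < m then cl (w' x) else 0) → ∀ v, v ∉ B j →
      (G.Adj (w x) v ↔ G.Adj (w' x) v) := by
    intro x hx h v hv
    have h1 := hz.lt _ (hBL (hw x hx))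
    have h2 := hz.lt _ (hBL (hw' x hx))
    simp only [h1, h2, if_true] at h
    exact hz.hom i (by omega) _ (hw x hx) _ (hw' x hx) h v (fun h => hv (hB1 h))
  by_cases hx : x ∈ F
  · have hS : x ∉ S := fun h => Finset.disjoint_left.1 hd h hx
    by_cases hy : y ∈ S
    · simp only [hx, hy, and_self, if_true] at hf
      have := key y hy hf _ (hr x hx)
      simp only [Sat, mix, hx, hS, hy, if_true, if_false]
      rw [G.adj_comm, this, G.adj_comm]
    · simp [Sat, mix, hx, hS, hy]
  · by_cases hy : y ∈ F
    · have hS : y ∉ S := fun h => Finset.disjoint_left.1 hd h hy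
      by_cases hx' : x ∈ S
      · simp only [hx, hx', hy, hS, and_self, and_false, if_true, if_false] at hf
        have := key x hx' hf _ (hr y hy)
        simpa [Sat, mix, hy, hS, hx'] using this
      · simp [Sat, mix, hx, hx', hy, hS]
    · simp only [hx, hy, false_and, if_false] at hf
      have := bit_eq hf
      simpa [Sat, mix, hx, hy] using this

lemma cnt_imp {C : GraphClass} {φ ψ : Fm} (h1 : Cnt C φ) (h2 : Cnt C ψ) : Cnt C (.imp φ ψ) := by
  intro R
  obtain ⟨c1, h1⟩ := h1 R
  obtain ⟨c2, h2⟩ := h2 R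
  refine ⟨c1 + c2, fun S F hS hF hd N G hG col D m L B cl hz hm i j hij hjL p => ?_⟩
  simp only [gp] at hij
  obtain ⟨f1, hf1, H1⟩ := h1 S F hS hF hd N G hG col (fun l => D (false :: l)) m L B cl hz hm i j
    (by have := le_max_left (gp φ) (gp ψ); omega) hjL p
  obtain ⟨f2, hf2, H2⟩ := h2 S F hS hF hd N G hG col (fun l => D (true :: l)) m L B cl hz hm i j
    (by have := le_max_right (gp φ) (gp ψ); omega) hjL p
  refine ⟨fun w => f1 w * m ^ c2 + f2 w, fun w => ?_, ?_⟩
  · rw [pow_add]; exact comb_lt (hf1 w) (hf2 w)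
  · intro w w' hw hw' hf r hr
    obtain ⟨e1, e2⟩ := comb_inj (hf2 w) (hf2 w') hf
    simp only [Sat]
    rw [H1 w w' hw hw' e1 r hr, H2 w w' hw hw' e2 r hr]

lemma sat_ex_split {V : Type} (G : SimpleGraph V) (col : ℕ → V → Prop) (y : ℕ) (σ : Fm)
    (D : List Bool → Set V) (B : Set V) (a : ℕ → V) :
    Sat G col (.ex y σ) D a ↔ Sat G col (.ex y σ) (modD D (D [] \ B)) a ∨
      Sat G col (.ex y σ) (modD D (D [] ∩ B)) a := by
  simp only [Sat, modD]
  constructor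
  · rintro ⟨z, hz, h⟩
    by_cases hb : z ∈ B
    · exact Or.inr ⟨z, ⟨hz, hb⟩, h⟩
    · exact Or.inl ⟨z, ⟨hz, hb⟩, h⟩
  · rintro (⟨z, hz, h⟩ | ⟨z, hz, h⟩)
    · exact ⟨z, hz.1, h⟩
    · exact ⟨z, hz.1, h⟩

lemma mix_update_far {V : Type} (S F : Finset ℕ) (w r p : ℕ → V) (y : ℕ) (z : V) :
    Function.update (mix S F w r p) y z =
      mix (S.erase y) (insert y F) w (Function.update r y z) p := by
  funext x
  by_cases hx : x = y
  · subst hx; simp [mix]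
  · simp [mix, hx]

lemma mix_update_near {V : Type} (S F : Finset ℕ) (w r p : ℕ → V) (y : ℕ) (z : V) :
    Function.update (mix S F w r p) y z =
      mix (insert y S) (F.erase y) (Function.update w y z) r p := by
  funext x
  by_cases hx : x = y
  · subst hx; simp [mix]
  · simp [mix, hx]

lemma mix_swap {V : Type} {S F : Finset ℕ} (hd : Disjoint S F) (w r p : ℕ → V) :
    mix S F w r p = mix F S r w p := by
  funext x
  by_cases hx : x ∈ S
  · have : x ∉ F := fun h => Finset.disjoint_left.1 hd hx h
    simp [mix, hx, this]
  · simp [mix, hx]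

lemma ex_local {C : GraphClass} {σ : Fm} (y : ℕ) (h : Cnt C σ) :
    ∀ R : Finset ℕ, ∃ c : ℕ, ∀ S F : Finset ℕ, S ⊆ R → F ⊆ R → Disjoint S F →
    ∀ (N : ℕ) (G : SimpleGraph (Fin N)), C N G → ∀ (col : ℕ → Fin N → Prop)
    (D : List Bool → Set (Fin N)) (m L : ℕ) (B : ℕ → Set (Fin N)) (cl : Fin N → ℕ),
    Zone G m L B cl → 2 ≤ m → ∀ i j, i + (gp σ + gp σ) ≤ j → j ≤ L → ∀ p : ℕ → Fin N,
    ∃ (f : (ℕ → Fin N) → ℕ) (A : (ℕ → Fin N) → ℕ → Prop) (W : ℕ → ℕ → Fin N),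
      (∀ w, f w < m ^ c) ∧
      (∀ w w', (∀ x ∈ S, w x ∈ B i) → (∀ x ∈ S, w' x ∈ B i) → f w = f w' →
        ∀ r, (∀ x ∈ F, r x ∉ B j) →
          (Sat G col (.ex y σ) (modD D (D [] \ B (i + gp σ))) (mix S F w r p) ↔
           Sat G col (.ex y σ) (modD D (D [] \ B (i + gp σ))) (mix S F w' r p))) ∧
      (∀ w, (∀ x ∈ S, w x ∈ B i) → ∀ r, (∀ x ∈ F, r x ∉ B j) →
        (Sat G col (.ex y σ) (modD D (D [] ∩ B (i + gp σ))) (mix S F w r p) ↔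
          ∃ κ < m ^ c, A w κ ∧ Sat G col σ (fun l => D (true :: l))
            (mix (insert y S) (F.erase y) (W κ) r p))) := by
  classical
  intro R
  obtain ⟨c, h⟩ := h (insert y R)
  refine ⟨c, fun S F hS hF hd N G hG col D m L B cl hz hm i j hij hjL p => ?_⟩
  have hd1 : Disjoint (S.erase y) (insert y F) := by
    rw [Finset.disjoint_left] at hd ⊢
    intro a ha hb
    simp only [Finset.mem_erase, Finset.mem_insert] at ha hb
    rcases hb with hb | hb
    · exact ha.1 hb
    · exact hd ha.2 hb
  have hd2 : Disjoint (insert y S) (F.erase y) := by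
    rw [Finset.disjoint_left] at hd ⊢
    intro a ha hb
    simp only [Finset.mem_erase, Finset.mem_insert] at ha hb
    rcases ha with ha | ha
    · exact hb.1 ha
    · exact hd ha hb.2
  obtain ⟨f1, hf1, H1⟩ := h (S.erase y) (insert y F)
    ((Finset.erase_subset _ _).trans (hS.trans (Finset.subset_insert _ _)))
    (Finset.insert_subset_insert _ hF) hd1 N G hG col
    (fun l => D (true :: l)) m L B cl hz hm i (i + gp σ) le_rfl (by omega) p
  obtain ⟨f2, hf2, H2⟩ := h (insert y S) (F.erase y) (Finset.insert_subset_insert _ hS)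
    ((Finset.erase_subset _ _).trans (hF.trans (Finset.subset_insert _ _))) hd2 N G hG col
    (fun l => D (true :: l)) m L B cl hz hm (i + gp σ) j (by omega) hjL p
  have hBj : B (i + gp σ) ⊆ B j := hz.mono (by omega)
  have hBi : B i ⊆ B (i + gp σ) := hz.mono (by omega)
  let P : ℕ → (ℕ → Fin N) → Prop := fun κ w => (∀ x ∈ insert y S, w x ∈ B (i + gp σ)) ∧ f2 w = κ
  refine ⟨f1, fun w κ => ∃ z ∈ D [] ∩ B (i + gp σ), f2 (Function.update w y z) = κ,
    fun κ => if hκ : ∃ w, P κ w then hκ.choose else p, hf1, ?_, ?_⟩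
  · intro w w' hw hw' hf r hr
    have : ∀ z ∉ B (i + gp σ), (Sat G col σ (fun l => D (true :: l))
        (Function.update (mix S F w r p) y z) ↔ Sat G col σ (fun l => D (true :: l))
        (Function.update (mix S F w' r p) y z)) := by
      intro z hz'
      rw [mix_update_far, mix_update_far]
      refine H1 w w' (fun x hx => hw x (Finset.mem_of_mem_erase hx))
        (fun x hx => hw' x (Finset.mem_of_mem_erase hx)) hf _ ?_
      intro x hx
      by_cases hxy : x = y
      · subst hxy; simpa using hz'
      · simp only [Function.update_of_ne hxy]
        have : x ∈ F := by simpa [hxy] using hx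
        exact fun hb => hr x this (hBj hb)
    simp only [Sat, modD]
    constructor
    · rintro ⟨z, hz1, h2⟩; exact ⟨z, hz1, (this z hz1.2).1 h2⟩
    · rintro ⟨z, hz1, h2⟩; exact ⟨z, hz1, (this z hz1.2).2 h2⟩
  · intro w hw r hr
    have hr' : ∀ x ∈ F.erase y, r x ∉ B j := fun x hx => hr x (Finset.mem_of_mem_erase hx)
    have hnear : ∀ z ∈ B (i + gp σ), ∀ x ∈ insert y S, Function.update w y z x ∈ B (i + gp σ) := by
      intro z hz' x hx
      by_cases hxy : x = y
      · subst hxy; simpa using hz'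
      · simp only [Function.update_of_ne hxy]
        have : x ∈ S := by simpa [hxy] using hx
        exact hBi (hw x this)
    have key : ∀ z ∈ B (i + gp σ), (Sat G col σ (fun l => D (true :: l))
        (Function.update (mix S F w r p) y z) ↔ Sat G col σ (fun l => D (true :: l))
        (mix (insert y S) (F.erase y) (if hκ : ∃ w', P (f2 (Function.update w y z)) w' then
          hκ.choose else p) r p)) := by
      intro z hz'
      have hex : ∃ w', P (f2 (Function.update w y z)) w' := ⟨_, hnear z hz', rfl⟩
      rw [mix_update_near, dif_pos hex]
      exact H2 _ _ (hnear z hz') hex.choose_spec.1 hex.choose_spec.2.symm r hr'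
    simp only [Sat, modD]
    constructor
    · rintro ⟨z, hz1, h2⟩
      exact ⟨f2 (Function.update w y z), hf2 _, ⟨z, hz1, rfl⟩, (key z hz1.2).1 h2⟩
    · rintro ⟨κ, -, ⟨z, hz1, rfl⟩, h2⟩
      exact ⟨z, hz1, (key z hz1.2).2 h2⟩

lemma loc_ex {C : GraphClass} {σ : Fm} (y : ℕ) (h : Cnt C σ) (ht : Tame C σ) :
    Loc C (.ex y σ) := by
  refine ⟨σ, y, ht, fun R => ?_⟩
  obtain ⟨c, h⟩ := ex_local y h R
  refine ⟨c, fun S F hS hF hd N G hG col D m L B cl hz hm i j hij hjL p => ?_⟩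
  obtain ⟨f, A, W, hf, H1, H2⟩ := h S F hS hF hd N G hG col D m L B cl hz hm i j hij hjL p
  refine ⟨f, modD D (D [] \ B (i + gp σ)), fun l => D (true :: l), A, W, hf, ?_⟩
  intro w w' hw hw' hff r hr
  rw [sat_ex_split (B := B (i + gp σ)), H1 w w' hw hw' hff r hr, H2 w hw r hr]

lemma tame_fls (C : GraphClass) : Tame C .fls := by
  intro R
  refine ⟨1, fun U V _ _ _ N G _ col D p v u h => ?_⟩
  have := (h (fun _ => true) 0).2 rfl
  exact this

lemma loc_of_cnt {C : GraphClass} {φ : Fm} (h : Cnt C φ) : Loc C φ := by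
  refine ⟨.fls, 0, tame_fls C, fun R => ?_⟩
  obtain ⟨c, h⟩ := h R
  refine ⟨c, fun S F hS hF hd N G hG col D m L B cl hz hm i j hij hjL p => ?_⟩
  obtain ⟨f, hf, H⟩ := h S F hS hF hd N G hG col D m L B cl hz hm i j hij hjL p
  refine ⟨f, D, D, fun _ _ => False, fun _ => p, hf, ?_⟩
  intro w w' hw hw' hff r hr
  rw [H w w' hw hw' hff r hr]
  simp

lemma cnt_ex {C : GraphClass} {σ : Fm} (y : ℕ) (h : Cnt C σ) (ht : Tame C σ)
    (ht' : Tame C (.ex y σ)) : Cnt C (.ex y σ) := by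
  classical
  intro R
  obtain ⟨c, h⟩ := ex_local y h R
  obtain ⟨k1, hk1⟩ := ht (insert y R)
  obtain ⟨k2, hk2⟩ := ht' R
  refine ⟨c + ((c + 1) * k1 + 1) * k2,
    fun S F hS hF hd N G hG col D m L B cl hz hm i j hij hjL p => ?_⟩
  obtain ⟨f, A, W, hf, H1, H2⟩ := h S F hS hF hd N G hG col D m L B cl hz hm i j hij hjL p
  have hd2 : Disjoint (F.erase y) (insert y S) := by
    rw [Finset.disjoint_left] at hd ⊢
    intro a hb ha
    simp only [Finset.mem_erase, Finset.mem_insert] at ha hb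
    rcases ha with ha | ha
    · exact hb.1 ha
    · exact hd ha hb.2
  obtain ⟨g, hg, Hg⟩ := sauer (α := {r : ℕ → Fin N // ∀ x ∈ F, r x ∉ B j}) (m ^ c) k1
    (fun r κ => Sat G col σ (fun l => D (true :: l))
      (mix (insert y S) (F.erase y) (W κ.val) r.1 p)) (by
    rintro ⟨v, u, huv⟩
    refine hk1 (F.erase y) (insert y S)
      ((Finset.erase_subset _ _).trans (hF.trans (Finset.subset_insert _ _)))
      (Finset.insert_subset_insert _ hS) hd2 N G hG col (fun l => D (true :: l)) p
      (fun j => W (v j).val) (fun T => (u T).1) ?_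
    intro T j
    rw [mix_swap hd2]
    exact huv T j)
  let rep : ℕ → ℕ → Fin N := fun β => if hβ : ∃ r, g r = β then hβ.choose.1 else p
  obtain ⟨f3, hf3, H3⟩ := sauer (α := ℕ → Fin N) ((m ^ c + 1) ^ k1) k2
    (fun w β => Sat G col (.ex y σ) (modD D (D [] ∩ B (i + gp σ))) (mix S F w (rep β.val) p)) (by
    rintro ⟨v, u, huv⟩
    exact hk2 S F hS hF hd N G hG col _ p (fun j => rep (v j).val) u huv)
  have hb : ((m ^ c + 1) ^ k1 + 1) ^ k2 ≤ m ^ (((c + 1) * k1 + 1) * k2) := by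
    rw [pow_mul]
    refine Nat.pow_le_pow_left ?_ k2
    have h1 : m ^ c + 1 ≤ m ^ (c + 1) := by
      have : 1 ≤ m ^ c := Nat.one_le_pow _ _ (by omega)
      rw [pow_succ]; nlinarith
    have h2 : (m ^ c + 1) ^ k1 ≤ m ^ ((c + 1) * k1) := by
      rw [pow_mul]; exact Nat.pow_le_pow_left h1 k1
    have : 1 ≤ m ^ ((c + 1) * k1) := Nat.one_le_pow _ _ (by omega)
    rw [pow_succ]; nlinarith
  refine ⟨fun w => f w * m ^ (((c + 1) * k1 + 1) * k2) + f3 w, fun w => ?_, ?_⟩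
  · rw [pow_add]; exact comb_lt (hf w) (lt_of_lt_of_le (hf3 w) hb)
  intro w w' hw hw' hff r hr
  obtain ⟨e1, e2⟩ := comb_inj (lt_of_lt_of_le (hf3 w) hb) (lt_of_lt_of_le (hf3 w') hb) hff
  have near : ∀ w, (∀ x ∈ S, w x ∈ B i) →
      (Sat G col (.ex y σ) (modD D (D [] ∩ B (i + gp σ))) (mix S F w r p) ↔
       Sat G col (.ex y σ) (modD D (D [] ∩ B (i + gp σ))) (mix S F w (rep (g ⟨r, hr⟩)) p)) := by
    intro w hw
    have hex : ∃ r', g r' = g ⟨r, hr⟩ := ⟨_, rfl⟩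
    have hrep : rep (g ⟨r, hr⟩) = hex.choose.1 := by simp only [rep]; rw [dif_pos hex]
    rw [hrep, H2 w hw r hr, H2 w hw _ hex.choose.2]
    refine exists_congr fun κ => and_congr_right fun hκ => and_congr_right fun _ => ?_
    exact (Hg _ _ hex.choose_spec ⟨κ, hκ⟩).symm
  rw [sat_ex_split (B := B (i + gp σ)), sat_ex_split (B := B (i + gp σ)) (a := mix S F w' r p),
    H1 w w' hw hw' e1 r hr, near w hw, near w' hw']
  have := H3 w w' e2 ⟨g ⟨r, hr⟩, hg _⟩
  simp only at this
  rw [this]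

/-! ## Boolean combinations, relativization and transport -/

lemma exists_pow_lt_two_pow (e : ℕ) : ∃ k : ℕ, (k + 1) ^ e < 2 ^ k := by
  have h := tendsto_pow_const_div_const_pow_of_one_lt e (r := (2 : ℝ)) (by norm_num)
  have h2 := (h.eventually (gt_mem_nhds (show (0 : ℝ) < 1 / 2 by norm_num))).and
    (Filter.eventually_ge_atTop 1)
  obtain ⟨n, hn, hn1⟩ := h2.exists
  obtain ⟨k, rfl⟩ : ∃ k, n = k + 1 := ⟨n - 1, by omega⟩
  refine ⟨k, ?_⟩
  rw [div_lt_iff₀ (by positivity), pow_succ] at hn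
  have : ((k + 1 : ℕ) : ℝ) ^ e < (2 : ℝ) ^ k := by linarith
  exact_mod_cast this

lemma tame_imp {C : GraphClass} {φ ψ : Fm} (h1 : Tame C φ) (h2 : Tame C ψ) :
    Tame C (.imp φ ψ) := by
  intro R
  obtain ⟨k1, h1⟩ := h1 R
  obtain ⟨k2, h2⟩ := h2 R
  obtain ⟨k, hk⟩ := exists_pow_lt_two_pow (k1 + k2)
  refine ⟨k, fun U V hU hV hd N G hG col D p v u h => ?_⟩
  obtain ⟨f1, hf1, e1⟩ := sauer k k1
    (fun (S : Fin k → Bool) j => Sat G col φ (fun l => D (false :: l)) (mix U V (u S) (v j) p))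
    (by
      rintro ⟨v', u', h'⟩
      exact h1 U V hU hV hd N G hG col _ p (fun j => v (v' j)) (fun S => u (u' S)) h')
  obtain ⟨f2, hf2, e2⟩ := sauer k k2
    (fun (S : Fin k → Bool) j => Sat G col ψ (fun l => D (true :: l)) (mix U V (u S) (v j) p))
    (by
      rintro ⟨v', u', h'⟩
      exact h2 U V hU hV hd N G hG col _ p (fun j => v (v' j)) (fun S => u (u' S)) h')
  have hinj : Function.Injective (fun S : Fin k → Bool =>
      ((⟨f1 S, hf1 S⟩, ⟨f2 S, hf2 S⟩) : Fin ((k + 1) ^ k1) × Fin ((k + 1) ^ k2))) := by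
    intro S S' hSS
    simp only [Prod.mk.injEq, Fin.mk.injEq] at hSS
    funext j
    have a1 := e1 S S' hSS.1 j
    have a2 := e2 S S' hSS.2 j
    have b1 := h S j
    have b2 := h S' j
    simp only [Sat] at b1 b2
    rw [a1, a2, b2] at b1
    cases hs : S j <;> cases hs' : S' j <;> simp_all
  have := Fintype.card_le_of_injective _ hinj
  simp only [Fintype.card_fun, Fintype.card_bool, Fintype.card_fin, Fintype.card_prod] at this
  rw [← pow_add] at this
  omega

/-- Quantifier domains can be shrunk to polynomial size. -/
lemma relativize (φ : Fm) : ∃ E : ℕ, ∀ (V : Type) [DecidableEq V] (G : SimpleGraph V)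
    (col : ℕ → V → Prop) (D : List Bool → Set V) (T : Finset (ℕ → V)),
    ∃ (D' : List Bool → Set V) (Z : Finset V), Z.card ≤ (T.card + 2) ^ E ∧ (∀ l, D' l ⊆ Z) ∧
      ∀ a ∈ T, (Sat G col φ D' a ↔ Sat G col φ D a) := by
  classical
  have atom : ∀ φ : Fm, (∀ (V : Type) (G : SimpleGraph V) (col : ℕ → V → Prop)
      (D D' : List Bool → Set V) (a : ℕ → V), Sat G col φ D' a ↔ Sat G col φ D a) →
      ∃ E : ℕ, ∀ (V : Type) [DecidableEq V] (G : SimpleGraph V)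
    (col : ℕ → V → Prop) (D : List Bool → Set V) (T : Finset (ℕ → V)),
    ∃ (D' : List Bool → Set V) (Z : Finset V), Z.card ≤ (T.card + 2) ^ E ∧ (∀ l, D' l ⊆ Z) ∧
      ∀ a ∈ T, (Sat G col φ D' a ↔ Sat G col φ D a) := fun φ h =>
    ⟨0, fun V _ G col D T => ⟨fun _ => ∅, ∅, by simp, by simp, fun a _ => h V G col _ _ a⟩⟩
  induction φ with
  | fls => exact atom _ (fun _ _ _ _ _ _ => Iff.rfl)
  | eq x y => exact atom _ (fun _ _ _ _ _ _ => Iff.rfl)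
  | col c x => exact atom _ (fun _ _ _ _ _ _ => Iff.rfl)
  | adj x y => exact atom _ (fun _ _ _ _ _ _ => Iff.rfl)
  | imp φ ψ ih1 ih2 =>
    obtain ⟨E1, h1⟩ := ih1
    obtain ⟨E2, h2⟩ := ih2
    refine ⟨E1 + E2 + 1, fun V _ G col D T => ?_⟩
    obtain ⟨D1, Z1, c1, s1, t1⟩ := h1 V G col (fun l => D (false :: l)) T
    obtain ⟨D2, Z2, c2, s2, t2⟩ := h2 V G col (fun l => D (true :: l)) T
    refine ⟨fun l => match l with
      | [] => ∅
      | false :: l => D1 l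
      | true :: l => D2 l, Z1 ∪ Z2, ?_, ?_, ?_⟩
    · have := Finset.card_union_le Z1 Z2
      have a1 : (T.card + 2) ^ E1 ≤ (T.card + 2) ^ (E1 + E2) :=
        Nat.pow_le_pow_right (by omega) (by omega)
      have a2 : (T.card + 2) ^ E2 ≤ (T.card + 2) ^ (E1 + E2) :=
        Nat.pow_le_pow_right (by omega) (by omega)
      rw [pow_succ]
      nlinarith
    · intro l
      rcases l with _ | ⟨_ | _, l⟩
      · simp
      · exact (s1 l).trans (by simp)
      · exact (s2 l).trans (by simp)
    · intro a ha
      simp only [Sat]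
      rw [t1 a ha, t2 a ha]
  | ex x φ ih =>
    obtain ⟨E, h⟩ := ih
    refine ⟨2 * E + 2, fun V _ G col D T => ?_⟩
    let wit : (ℕ → V) → Finset V := fun a =>
      if h : Sat G col (.ex x φ) D a then {h.choose} else ∅
    let Z0 := T.biUnion wit
    have hZ0 : Z0.card ≤ T.card := by
      refine (Finset.card_biUnion_le_card_mul T wit 1 (fun a _ => ?_)).trans (by simp)
      simp only [wit]; split_ifs <;> simp
    let T' := (T ×ˢ Z0).image (fun q => Function.update q.1 x q.2)
    have hT' : T'.card ≤ T.card * T.card := by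
      refine Finset.card_image_le.trans ?_
      rw [Finset.card_product]
      exact Nat.mul_le_mul_left _ hZ0
    obtain ⟨D1, Z1, c1, s1, t1⟩ := h V G col (fun l => D (true :: l)) T'
    refine ⟨fun l => match l with
      | [] => (Z0 : Set V) ∩ D []
      | _ :: l => D1 l, Z0 ∪ Z1, ?_, ?_, ?_⟩
    · have := Finset.card_union_le Z0 Z1
      have a1 : (T'.card + 2) ^ E ≤ ((T.card + 2) ^ 2) ^ E :=
        Nat.pow_le_pow_left (by nlinarith) _
      rw [← pow_mul] at a1
      have a2 : 1 ≤ (T.card + 2) ^ (2 * E) := Nat.one_le_pow _ _ (by omega)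
      rw [pow_add]
      nlinarith
    · intro l
      rcases l with _ | ⟨_, l⟩
      · intro z hz
        simp only [Set.mem_inter_iff] at hz
        simp only [Finset.coe_union]
        exact Or.inl hz.1
      · exact (s1 l).trans (by simp)
    · intro a ha
      constructor
      · rintro ⟨z, hz, hs⟩
        refine ⟨z, hz.2, ?_⟩
        exact (t1 _ (Finset.mem_image.2 ⟨(a, z), Finset.mem_product.2 ⟨ha, hz.1⟩, rfl⟩)).1 hs
      · intro hs
        have hz : hs.choose ∈ Z0 := Finset.mem_biUnion.2 ⟨a, ha, by simp [wit, hs]⟩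
        refine ⟨hs.choose, ⟨hz, hs.choose_spec.1⟩, ?_⟩
        exact (t1 _ (Finset.mem_image.2 ⟨(a, hs.choose), Finset.mem_product.2 ⟨ha, hz⟩, rfl⟩)).2
          hs.choose_spec.2

lemma sat_bd (φ : Fm) : ∃ Bd : ℕ, ∀ (V : Type) (G : SimpleGraph V)
    (col : ℕ → V → Prop) (D : List Bool → Set V) (a a' : ℕ → V), (∀ x < Bd, a x = a' x) →
    (Sat G col φ D a ↔ Sat G col φ D a') := by
  induction φ with
  | fls => exact ⟨0, fun _ _ _ _ _ _ _ => Iff.rfl⟩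
  | eq x y =>
    refine ⟨x + y + 1, fun V G col D a a' h => ?_⟩
    simp only [Sat]; rw [h x (by omega), h y (by omega)]
  | col c x =>
    refine ⟨x + 1, fun V G col D a a' h => ?_⟩
    simp only [Sat]; rw [h x (by omega)]
  | adj x y =>
    refine ⟨x + y + 1, fun V G col D a a' h => ?_⟩
    simp only [Sat]; rw [h x (by omega), h y (by omega)]
  | imp φ ψ ih1 ih2 =>
    obtain ⟨b1, h1⟩ := ih1
    obtain ⟨b2, h2⟩ := ih2
    refine ⟨b1 + b2, fun V G col D a a' h => ?_⟩
    simp only [Sat]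
    rw [h1 V G col _ a a' (fun x hx => h x (by omega)), h2 V G col _ a a' (fun x hx => h x (by omega))]
  | ex x φ ih =>
    obtain ⟨b, h⟩ := ih
    refine ⟨b, fun V G col D a a' hh => ?_⟩
    simp only [Sat]
    refine exists_congr fun z => and_congr_right fun _ => h V G col _ _ _ fun y hy => ?_
    by_cases hyx : y = x
    · subst hyx; simp
    · simp [hyx, hh y hy]

lemma sat_comap {V' V : Type} (e : V' → V) (he : Function.Injective e) (G : SimpleGraph V)
    (col : ℕ → V → Prop) (φ : Fm) : ∀ (D : List Bool → Set V) (a : ℕ → V'),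
    (∀ l, D l ⊆ Set.range e) →
    (Sat (G.comap e) (fun c v => col c (e v)) φ (fun l => e ⁻¹' D l) a ↔
      Sat G col φ D (fun x => e (a x))) := by
  induction φ with
  | fls => intro D a _; simp [Sat]
  | eq x y => intro D a _; simp [Sat, he.eq_iff]
  | col c x => intro D a _; simp [Sat]
  | adj x y => intro D a _; simp [Sat]
  | imp φ ψ ih1 ih2 =>
    intro D a h
    simp only [Sat]
    rw [← ih1 _ a (fun l => h (false :: l)), ← ih2 _ a (fun l => h (true :: l))]
  | ex x φ ih =>
    intro D a h
    simp only [Sat]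
    have hup : ∀ z, (fun y => e (Function.update a x z y)) =
        Function.update (fun y => e (a y)) x (e z) := by
      intro z; funext y
      by_cases hyx : y = x
      · subst hyx; simp
      · simp [hyx]
    constructor
    · rintro ⟨z, hz, hs⟩
      refine ⟨e z, hz, ?_⟩
      rw [ih _ _ (fun l => h (true :: l)), hup] at hs
      exact hs
    · rintro ⟨z, hz, hs⟩
      obtain ⟨z', rfl⟩ := h [] hz
      refine ⟨z', hz, ?_⟩
      rw [ih _ _ (fun l => h (true :: l)), hup]
      exact hs

/-- Every pattern realized in the class is realized in a small graph of the class. -/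
lemma small_realization {C : GraphClass} (hH : Hereditary C) (φ : Fm) (U V : Finset ℕ) :
    ∃ E : ℕ, ∀ n : ℕ, 2 ≤ n → ∀ (N : ℕ) (G : SimpleGraph (Fin N)), C N G →
    ∀ (col : ℕ → Fin N → Prop) (D : List Bool → Set (Fin N)) (p : ℕ → Fin N)
      (u v : Fin n → ℕ → Fin N),
    ∃ (N' : ℕ) (G' : SimpleGraph (Fin N')), C N' G' ∧ N' ≤ n ^ E ∧
      ∃ (col' : ℕ → Fin N' → Prop) (D' : List Bool → Set (Fin N')) (p' : ℕ → Fin N')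
      (u' v' : Fin n → ℕ → Fin N'), ∀ i j,
        (Sat G' col' φ D' (mix U V (u' i) (v' j) p') ↔ Sat G col φ D (mix U V (u i) (v j) p)) := by
  classical
  obtain ⟨E, hE⟩ := relativize φ
  obtain ⟨b, hb⟩ := sat_bd φ
  refine ⟨4 * E + U.card + V.card + b + 4, fun n hn N G hG col D p u v => ?_⟩
  let T : Finset (ℕ → Fin N) := Finset.univ.image (fun q : Fin n × Fin n => mix U V (u q.1) (v q.2) p)
  have hT : T.card ≤ n * n := by
    refine Finset.card_image_le.trans ?_
    simp
  obtain ⟨D', Z, hZ, hDZ, hS⟩ := hE (Fin N) G col D T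
  let A1 : Finset (Fin N) := (Finset.univ ×ˢ U).image (fun q : Fin n × ℕ => u q.1 q.2)
  let A2 : Finset (Fin N) := (Finset.univ ×ˢ V).image (fun q : Fin n × ℕ => v q.1 q.2)
  let A3 : Finset (Fin N) := (Finset.range (b + 1)).image p
  let S := Z ∪ (A1 ∪ (A2 ∪ A3))
  have hA1 : A1.card ≤ n * U.card := Finset.card_image_le.trans (by simp)
  have hA2 : A2.card ≤ n * V.card := Finset.card_image_le.trans (by simp)
  have hA3 : A3.card ≤ b + 1 := Finset.card_image_le.trans (by simp)
  have hScard : S.card ≤ n ^ (4 * E + U.card + V.card + b + 4) := by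
    have h1 := Finset.card_union_le Z (A1 ∪ (A2 ∪ A3))
    have h2 := Finset.card_union_le A1 (A2 ∪ A3)
    have h3 := Finset.card_union_le A2 A3
    have hz2 : (T.card + 2) ^ E ≤ (n ^ 4) ^ E := by
      refine Nat.pow_le_pow_left ?_ _
      have : 2 * (n * n) ≤ n ^ 4 := by nlinarith [Nat.mul_le_mul hn hn, Nat.mul_le_mul (Nat.mul_le_mul hn hn) (le_refl (n*n))]
      nlinarith
    rw [← pow_mul] at hz2
    have hx : ∀ x, x ≤ n ^ x := fun x => (Nat.lt_pow_self (by omega)).le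
    have hq1 := hx U.card
    have hq2 := hx V.card
    have hq3 := hx b
    set P := n ^ (4 * E + U.card + V.card + b) with hP
    have hle : ∀ x, x ≤ 4 * E + U.card + V.card + b → n ^ x ≤ P := fun x h =>
      Nat.pow_le_pow_right (by omega) h
    have q0 := hle (4 * E) (by omega)
    have q1 := hle U.card (by omega)
    have q2 := hle V.card (by omega)
    have q3 := hle b (by omega)
    have q4 : 1 ≤ P := Nat.one_le_pow _ _ (by omega)
    have : n ^ (4 * E + U.card + V.card + b + 4) = P * n ^ 4 := by rw [pow_add]
    rw [this]
    have r1 : n * U.card ≤ n * P := Nat.mul_le_mul_left _ (by omega)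
    have r2 : n * V.card ≤ n * P := Nat.mul_le_mul_left _ (by omega)
    have r3 : S.card ≤ P + n * P + n * P + P + P := by
      have : S.card = (Z ∪ (A1 ∪ (A2 ∪ A3))).card := rfl
      omega
    have r4 : 3 + 2 * n ≤ n ^ 4 := by
      have : n * n * (n * n) = n ^ 4 := by ring
      nlinarith [Nat.mul_le_mul hn hn]
    nlinarith
  let e : Fin S.card → Fin N := fun i => (S.equivFin.symm i : Fin N)
  have he : Function.Injective e := fun a c hac => S.equivFin.symm.injective (Subtype.ext hac)
  have hpS : p 0 ∈ S := by
    simp only [S, A3, Finset.mem_union]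
    right; right; right
    exact Finset.mem_image.2 ⟨0, by simp, rfl⟩
  let g : Fin N → Fin S.card := fun z => if h : z ∈ S then S.equivFin ⟨z, h⟩ else
    S.equivFin ⟨p 0, hpS⟩
  have heg : ∀ z ∈ S, e (g z) = z := fun z hz => by simp [e, g, hz]
  have hr : ∀ z ∈ S, z ∈ Set.range e := fun z hz => ⟨g z, heg z hz⟩
  refine ⟨S.card, G.comap e, hH N G _ e he hG, hScard, fun c z => col c (e z),
    fun l => e ⁻¹' D' l, fun x => g (p x), fun i x => g (u i x), fun i x => g (v i x), ?_⟩
  intro i j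
  rw [sat_comap e he G col φ D' _ (fun l z hz => hr z (by
    have := hDZ l hz
    simp only [S, Finset.mem_union]; exact Or.inl this))]
  rw [← hS (mix U V (u i) (v j) p) (Finset.mem_image.2 ⟨(i, j), by simp, rfl⟩)]
  apply hb
  intro x hx
  simp only [mix]
  by_cases h1 : x ∈ U
  · simp only [h1, if_true]
    apply heg
    simp only [S, A1, Finset.mem_union]
    right; left
    exact Finset.mem_image.2 ⟨(i, x), by simp [h1], rfl⟩
  · by_cases h2 : x ∈ V
    · simp only [h1, h2, if_true, if_false]
      apply heg
      simp only [S, A2, Finset.mem_union]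
      right; right; left
      exact Finset.mem_image.2 ⟨(j, x), by simp [h2], rfl⟩
    · simp only [h1, h2, if_false]
      apply heg
      simp only [S, A3, Finset.mem_union]
      right; right; right
      exact Finset.mem_image.2 ⟨x, by simp; omega, rfl⟩

/-! ## Zones from contraction sequences -/

open Classical in
lemma exists_index {α : Type*} (S : Finset α) : ∃ idx : α → ℕ, (∀ a ∈ S, idx a < S.card) ∧
    ∀ a ∈ S, ∀ b ∈ S, idx a = idx b → a = b := by
  refine ⟨fun a => if h : a ∈ S then (S.equivFin ⟨a, h⟩).val else 0, ?_, ?_⟩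
  · intro a ha
    simp [ha]
  · intro a ha b hb hab
    simp only [ha, hb, dif_pos] at hab
    exact congrArg Subtype.val (S.equivFin.injective (Fin.ext hab))

open Classical in
lemma zone_of_part {V : Type} [Fintype V] [DecidableEq V] (G : SimpleGraph V)
    (P : Finpartition (Finset.univ : Finset V)) (d : ℕ) (hP : RedDegLE G P d)
    (X : Finset V) (hX : X ∈ P.parts) (m L : ℕ) (hm : (d + 1) ^ L ≤ m) :
    ∃ (B : ℕ → Set V) (cl : V → ℕ) (Q : Finset (Finset V)), Zone G m L B cl ∧
      (∀ v ∈ X, v ∈ B 0) ∧ Q ⊆ P.parts ∧ Q.card ≤ m ∧ ∀ v ∈ B L, ∃ A ∈ Q, v ∈ A := by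
  let nb : Finset V → Finset (Finset V) := fun A => P.parts.filter (fun B => B = A ∨ ¬ Homog G A B)
  have hnb : ∀ A ∈ P.parts, (nb A).card ≤ d + 1 := by
    intro A hA
    have h1 : nb A ⊆ insert A (P.parts.filter (fun B => B ≠ A ∧ ¬ Homog G A B)) := by
      intro B hB
      simp only [nb, Finset.mem_filter] at hB
      by_cases hBA : B = A
      · simp [hBA]
      · simp only [Finset.mem_insert, Finset.mem_filter]
        exact Or.inr ⟨hB.1, hBA, by tauto⟩
    have h2 := hP A hA
    have h3 : {B : Finset V | B ∈ P.parts ∧ B ≠ A ∧ ¬ Homog G A B} =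
        ((P.parts.filter (fun B => B ≠ A ∧ ¬ Homog G A B) : Finset (Finset V)) :
          Set (Finset V)) := by
      ext B; simp
    rw [h3, Set.ncard_coe_finset] at h2
    exact (Finset.card_le_card h1).trans ((Finset.card_insert_le _ _).trans (by omega))
  let Bp : ℕ → Finset (Finset V) := fun i => Nat.rec {X} (fun _ S => S.biUnion nb) i
  have hB0 : Bp 0 = {X} := rfl
  have hBs : ∀ i, Bp (i + 1) = (Bp i).biUnion nb := fun i => rfl
  have hsub : ∀ i, Bp i ⊆ P.parts := by
    intro i
    cases i with
    | zero => rw [hB0]; simpa using hX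
    | succ i =>
      rw [hBs]
      intro B hB
      obtain ⟨A, _, hA⟩ := Finset.mem_biUnion.1 hB
      exact (Finset.mem_filter.1 hA).1
  have hcard : ∀ i, (Bp i).card ≤ (d + 1) ^ i := by
    intro i
    induction i with
    | zero => rw [hB0]; simp
    | succ i ih =>
      rw [hBs, pow_succ]
      exact (Finset.card_biUnion_le_card_mul _ _ (d + 1) (fun A hA => hnb A (hsub i hA))).trans
        (Nat.mul_le_mul_right _ ih)
  have hmono : Monotone Bp := by
    apply monotone_nat_of_le_succ
    intro i A hA
    rw [hBs]
    exact Finset.mem_biUnion.2 ⟨A, hA, Finset.mem_filter.2 ⟨hsub i hA, Or.inl rfl⟩⟩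
  have hpart : ∀ v, v ∈ P.part v := fun v => P.mem_part (Finset.mem_univ v)
  obtain ⟨idx, hidx, hinj⟩ := exists_index (Bp L)
  refine ⟨fun i => {v | P.part v ∈ Bp i},
    fun v => idx (P.part v), Bp L,
    ⟨?_, ?_, ?_⟩, ?_, hsub L, (hcard L).trans hm, ?_⟩
  · intro i j hij v hv
    exact hmono hij hv
  · intro v hv
    have hv' : P.part v ∈ Bp L := hv
    exact lt_of_lt_of_le (hidx _ hv') ((hcard L).trans hm)
  · intro i hi w hw w' hw' hcl v hv
    have h1 : P.part w ∈ Bp L := hmono hi hw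
    have h2 : P.part w' ∈ Bp L := hmono hi hw'
    have h3 : P.part w = P.part w' := hinj _ h1 _ h2 hcl
    have hv' : P.part v ∉ Bp (i + 1) := hv
    have hhom : Homog G (P.part w) (P.part v) := by
      by_contra hc
      apply hv'
      rw [hBs]
      exact Finset.mem_biUnion.2 ⟨_, hw, Finset.mem_filter.2
        ⟨P.part_mem.2 (Finset.mem_univ v), Or.inr hc⟩⟩
    have hw1 : w' ∈ P.part w := by rw [h3]; exact hpart w'
    rcases hhom with h | h
    · exact iff_of_true (h w (hpart w) v (hpart v)) (h w' hw1 v (hpart v))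
    · exact iff_of_false (h w (hpart w) v (hpart v)) (h w' hw1 v (hpart v))
  · intro v hv
    have : P.part v = X := P.part_eq_of_mem hX hv
    simp [hB0, this]
  · intro v hv
    exact ⟨P.part v, hv, hpart v⟩

open Classical in
lemma zone_lemma {V : Type} [Fintype V] [DecidableEq V] (G : SimpleGraph V) (d m L : ℕ)
    (hG : TwwLE G d) (hm : (d + 1) ^ L ≤ m) (ω : V → ℕ) (s : ℕ) (hs : 0 < s)
    (h1 : ∀ v, ω v < s) (h2 : s ≤ ∑ v, ω v) :
    ∃ (X : Finset V) (B : ℕ → Set V) (cl : V → ℕ), Zone G m L B cl ∧ (∀ v ∈ X, v ∈ B 0) ∧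
      s ≤ ∑ v ∈ X, ω v ∧ ∑ v ∈ Finset.univ.filter (fun v => v ∈ B L), ω v ≤ m * (2 * s) := by
  obtain ⟨P, p0, p1, p2, p3⟩ := hG
  have hN : 1 ≤ Fintype.card V := by
    rw [Nat.one_le_iff_ne_zero]
    intro h0
    have := Fintype.card_eq_zero_iff.1 h0
    simp at h2
    omega
  have hex : ∃ τ, ∃ X ∈ (P τ).parts, s ≤ ∑ v ∈ X, ω v :=
    ⟨Fintype.card V - 1, Finset.univ, by rw [p1 hN]; simp, h2⟩
  have hτ := Nat.find_spec hex
  have hmin := fun t => @Nat.find_min _ _ hex t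
  have hle : Nat.find hex ≤ Fintype.card V - 1 :=
    Nat.find_le ⟨Finset.univ, by rw [p1 hN]; simp, h2⟩
  set τ := Nat.find hex
  obtain ⟨X, hX, hXs⟩ := hτ
  have hall : ∀ A ∈ (P τ).parts, ∑ v ∈ A, ω v ≤ 2 * s := by
    rcases hτ0 : τ with _ | t
    · exfalso
      rw [hτ0] at hX
      obtain ⟨v, rfl⟩ := Finset.card_eq_one.1 (p0 X hX)
      have := h1 v
      simp at hXs
      omega
    · have hlt : ∀ A ∈ (P t).parts, ∑ v ∈ A, ω v < s := by
        intro A hA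
        by_contra hc
        exact hmin t (by omega) ⟨A, hA, by omega⟩
      obtain ⟨A, hA, A', hA', _, hPt⟩ := p2 t (by omega)
      intro Y hY
      rw [hPt] at hY
      rcases Finset.mem_insert.1 hY with rfl | hY
      · have e1 := hlt A hA
        have e2 := hlt A' hA'
        have := Finset.sum_union_inter (s₁ := A) (s₂ := A') (f := ω)
        omega
      · have := hlt Y (Finset.mem_of_mem_erase (Finset.mem_of_mem_erase hY))
        omega
  obtain ⟨B, cl, Q, hz, hXB, hQ, hQm, hcov⟩ := zone_of_part G (P τ) d (p3 τ (by omega)) X hX m L hm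
  refine ⟨X, B, cl, hz, hXB, hXs, ?_⟩
  calc ∑ v ∈ Finset.univ.filter (fun v => v ∈ B L), ω v ≤ ∑ v ∈ Q.biUnion id, ω v := by
        apply Finset.sum_le_sum_of_subset
        intro v hv
        obtain ⟨A, hA, hvA⟩ := hcov v (Finset.mem_filter.1 hv).2
        exact Finset.mem_biUnion.2 ⟨A, hA, hvA⟩
    _ ≤ ∑ A ∈ Q, ∑ v ∈ A, ω v := by
        rw [Finset.sum_biUnion (fun A hA B hB => (P τ).disjoint (hQ hA) (hQ hB))]
        simp
    _ ≤ ∑ A ∈ Q, 2 * s := Finset.sum_le_sum fun A hA => hall A (hQ hA)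
    _ = Q.card * (2 * s) := by simp
    _ ≤ m * (2 * s) := Nat.mul_le_mul_right _ hQm

/-! ## Counting -/

/-- No `k` columns of the matrix are shattered by the rows. -/
def NSm (k : ℕ) {t : ℕ} (h : Fin t → Fin t → Bool) : Prop :=
  ¬ ∃ (v : Fin k → Fin t) (u : (Fin k → Bool) → Fin t), ∀ S j, h (u S) (v j) = true ↔ S j = true

/-- Matrices that are combinations of few matrices of bounded VC-dimension. -/
def InFam (k M : ℕ) {t : ℕ} (h : Fin t → Fin t → Bool) : Prop :=
  ∃ (a : Fin t → Fin t → Bool) (bb : Fin M → Fin t → Fin t → Bool) (A : Fin t → Fin M → Bool),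
    NSm k a ∧ (∀ κ, NSm k (bb κ)) ∧
    ∀ i j, h i j = true ↔ (a i j = true ∨ ∃ κ, A i κ = true ∧ bb κ i j = true)

open Classical in
lemma ns_card (k q b K t : ℕ) (ht : q * b = t) (hK : (b + 1) ^ k ≤ K) :
    Fintype.card {h : Fin t → Fin t → Bool // NSm k h} ≤ (K ^ t * (2 ^ b) ^ K) ^ q := by
  subst ht
  have key : ∀ h : {h : Fin (q * b) → Fin (q * b) → Bool // NSm k h}, ∀ β : Fin q,
      ∃ x : (Fin (q * b) → Fin K) × (Fin K → Fin b → Bool),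
        ∀ i γ, h.1 i (finProdFinEquiv (β, γ)) = x.2 (x.1 i) γ := by
    rintro ⟨h, hh⟩ β
    obtain ⟨f, hf, e⟩ := sauer b k (fun i γ => h i (finProdFinEquiv (β, γ)) = true) (by
      rintro ⟨v, u, H⟩
      exact hh ⟨fun j => finProdFinEquiv (β, v j), u, H⟩)
    refine ⟨(fun i => ⟨f i, lt_of_lt_of_le (hf i) hK⟩, fun κ γ =>
      if hx : ∃ i, f i = κ.val then h hx.choose (finProdFinEquiv (β, γ)) else false), ?_⟩
    intro i γ
    have hx : ∃ i', f i' = f i := ⟨i, rfl⟩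
    simp only [hx, dif_pos]
    have := e _ _ hx.choose_spec γ
    rw [Bool.eq_iff_iff]
    exact this.symm
  choose F hF using key
  have hinj : Function.Injective F := by
    intro h h' hhh
    apply Subtype.ext
    funext i j
    obtain ⟨⟨β, γ⟩, rfl⟩ := finProdFinEquiv.surjective j
    rw [hF h β i γ, hF h' β i γ, hhh]
  refine (Fintype.card_le_of_injective F hinj).trans (le_of_eq ?_)
  simp [Fintype.card_prod]

open Classical in
lemma fam_card (k M t : ℕ) :
    (Finset.univ.filter (fun h : Fin t × Fin t → Bool => InFam k M (fun i j => h (i, j)))).card ≤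
      Fintype.card {h : Fin t → Fin t → Bool // NSm k h} ^ (M + 1) * 2 ^ (t * M) := by
  let T := {h : Fin t → Fin t → Bool // NSm k h} × (Fin M → {h : Fin t → Fin t → Bool // NSm k h}) ×
    (Fin t → Fin M → Bool)
  have hc : Fintype.card T = Fintype.card {h : Fin t → Fin t → Bool // NSm k h} ^ (M + 1) *
      2 ^ (t * M) := by
    simp only [T, Fintype.card_prod, Fintype.card_fun, Fintype.card_fin, Fintype.card_bool]
    rw [← pow_mul, pow_succ, Nat.mul_comm M t]
    ring
  rw [← hc, ← Finset.card_univ]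
  refine Finset.card_le_card_of_surjOn (fun x : T => fun ij : Fin t × Fin t =>
    decide (x.1.1 ij.1 ij.2 = true ∨ ∃ κ, x.2.2 ij.1 κ = true ∧ (x.2.1 κ).1 ij.1 ij.2 = true)) ?_
  intro h hh
  simp only [Finset.coe_filter, Finset.mem_univ, true_and] at hh
  obtain ⟨a, bb, A, ha, hb, H⟩ := hh
  refine ⟨(⟨a, ha⟩, fun κ => ⟨bb κ, hb κ⟩, A), by simp, ?_⟩
  funext ⟨i, j⟩
  rw [Bool.eq_iff_iff, H i j]
  simp

open Classical in
lemma cover_card {ι τ : Type} [Fintype ι] [Fintype τ] [DecidableEq ι] [DecidableEq τ]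
    (e : τ → ι)
    (he : Function.Injective e) (F : Finset (τ → Bool)) :
    (Finset.univ.filter (fun H : ι → Bool => H ∘ e ∈ F)).card * 2 ^ Fintype.card τ ≤
      F.card * 2 ^ Fintype.card ι := by
  have h1 : 2 ^ Fintype.card τ = (Finset.univ : Finset (τ → Bool)).card := by simp
  have h2 : 2 ^ Fintype.card ι = (Finset.univ : Finset (ι → Bool)).card := by simp
  rw [h1, h2, ← Finset.card_product, ← Finset.card_product]
  refine Finset.card_le_card_of_injOn
    (fun x => (x.1 ∘ e, Function.extend e x.2 x.1)) ?_ ?_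
  · intro x hx
    simp at hx
    simpa using hx
  · rintro ⟨H, g⟩ _ ⟨H', g'⟩ _ hxy
    simp only [Prod.mk.injEq] at hxy
    obtain ⟨q1, q2⟩ := hxy
    have hg : g = g' := by
      funext x
      have := congrFun q2 (e x)
      rwa [he.extend_apply, he.extend_apply] at this
    have hH : H = H' := by
      funext x
      by_cases hx : ∃ y, e y = x
      · obtain ⟨y, rfl⟩ := hx
        exact congrFun q1 y
      · have := congrFun q2 x
        rwa [Function.extend_apply' _ _ _ hx, Function.extend_apply' _ _ _ hx] at this
    rw [hg, hH]

open Classical in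
lemma cover_bound (n t : ℕ) (F : Finset (Fin t × Fin t → Bool))
    (h : ∀ H : Fin n × Fin n → Bool, ∃ I J : Fin t → Fin n, Function.Injective I ∧
      Function.Injective J ∧ ((fun ab : Fin t × Fin t => H (I ab.1, J ab.2)) ∈ F ∨
        (fun ab : Fin t × Fin t => H (J ab.2, I ab.1)) ∈ F)) :
    2 ^ (t * t) ≤ n ^ t * n ^ t * 2 * F.card := by
  let E := {x : ((Fin t → Fin n) × (Fin t → Fin n)) × Bool //
    Function.Injective x.1.1 ∧ Function.Injective x.1.2}
  let e : E → (Fin t × Fin t → Fin n × Fin n) := fun x ab =>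
    if x.1.2 then (x.1.1.1 ab.1, x.1.1.2 ab.2) else (x.1.1.2 ab.2, x.1.1.1 ab.1)
  have he : ∀ x, Function.Injective (e x) := by
    rintro ⟨⟨⟨I, J⟩, s⟩, hI, hJ⟩ ⟨a, b⟩ ⟨a', b'⟩ hab
    cases s
    · simp only [e, Bool.false_eq_true, if_false, Prod.mk.injEq] at hab
      rw [hI hab.2, hJ hab.1]
    · simp only [e, if_true, Prod.mk.injEq] at hab
      rw [hI hab.1, hJ hab.2]
  have hE : Fintype.card E ≤ n ^ t * n ^ t * 2 := by
    refine (Fintype.card_subtype_le _).trans ?_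
    simp [Fintype.card_prod]
  have hcov : (Finset.univ : Finset (Fin n × Fin n → Bool)) ⊆
      Finset.univ.biUnion (fun x : E => Finset.univ.filter (fun H => H ∘ e x ∈ F)) := by
    intro H _
    obtain ⟨I, J, hI, hJ, hor⟩ := h H
    simp only [Finset.mem_biUnion, Finset.mem_univ, true_and, Finset.mem_filter]
    rcases hor with hor | hor
    · refine ⟨⟨((I, J), true), hI, hJ⟩, ?_⟩
      convert hor using 1
      funext ab; simp [e]
    · refine ⟨⟨((I, J), false), hI, hJ⟩, ?_⟩
      convert hor using 1
      funext ab; simp [e]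
  have h1 := (Finset.card_le_card hcov).trans Finset.card_biUnion_le
  have h2 : (Finset.univ : Finset (Fin n × Fin n → Bool)).card * 2 ^ (t * t) ≤
      ∑ x : E, F.card * 2 ^ (n * n) := by
    refine (Nat.mul_le_mul_right _ h1).trans ?_
    rw [Finset.sum_mul]
    refine Finset.sum_le_sum fun x _ => ?_
    have := cover_card (e x) (he x) F
    simp only [Fintype.card_prod, Fintype.card_fin] at this
    exact this
  simp only [Finset.card_univ, Fintype.card_fun, Fintype.card_bool, Fintype.card_prod,
    Fintype.card_fin, Finset.sum_const, smul_eq_mul] at h2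
  have h3 : 2 ^ (n * n) * 2 ^ (t * t) ≤ 2 ^ (n * n) * (Fintype.card E * F.card) := by
    calc _ ≤ _ := h2
      _ = _ := by ring
  have h4 := Nat.le_of_mul_le_mul_left h3 (by positivity)
  exact h4.trans (Nat.mul_le_mul_right _ hE)

lemma counting (k c : ℕ) : ∃ e₁ : ℕ, ∀ e : ℕ, ∃ m₀ : ℕ, ∀ m ≥ m₀,
    ¬ ∀ h : Fin (m ^ e) → Fin (m ^ e) → Bool, ∃ I J : Fin (m ^ e₁) → Fin (m ^ e),
      Function.Injective I ∧ Function.Injective J ∧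
      (InFam k (m ^ c) (fun a b => h (I a) (J b)) ∨
        InFam k (m ^ c) (fun a b => h (J b) (I a))) := by
  classical
  set a := (c + 4) * k with ha
  refine ⟨a + (c + 3), fun e => ⟨2 * e + 2 * a + 6, fun m hm H => ?_⟩⟩
  set t := m ^ (a + (c + 3)) with ht
  have hb := cover_bound (m ^ e) t
    (Finset.univ.filter (fun h : Fin t × Fin t → Bool => InFam k (m ^ c) (fun i j => h (i, j)))) (by
      intro h
      obtain ⟨I, J, hI, hJ, hor⟩ := H (fun x y => h (x, y))
      refine ⟨I, J, hI, hJ, ?_⟩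
      simpa using hor)
  have hns := ns_card k (m ^ a) (m ^ (c + 3)) (m ^ a) t (by rw [ht, pow_add m a]) (by
    rw [ha, pow_mul]
    refine Nat.pow_le_pow_left ?_ _
    have : 1 ≤ m ^ (c + 3) := Nat.one_le_pow _ _ (by omega)
    rw [pow_succ m (c + 3)]
    nlinarith)
  have hfc := fam_card k (m ^ c) t
  have hlog : ∀ x, m ^ x ≤ 2 ^ (m * x) := fun x => by
    rw [pow_mul]; exact Nat.pow_le_pow_left Nat.lt_two_pow_self.le _
  have hns2 : Fintype.card {h : Fin t → Fin t → Bool // NSm k h} ≤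
      2 ^ (t * (m * a * m ^ a + m ^ a)) := by
    refine hns.trans ?_
    calc ((m ^ a) ^ t * (2 ^ m ^ (c + 3)) ^ m ^ a) ^ m ^ a
        ≤ ((2 ^ (m * a)) ^ t * (2 ^ m ^ (c + 3)) ^ m ^ a) ^ m ^ a := by
          exact Nat.pow_le_pow_left (Nat.mul_le_mul_right _ (Nat.pow_le_pow_left (hlog a) _)) _
      _ = 2 ^ (t * (m * a * m ^ a + m ^ a)) := by
          rw [← pow_mul, ← pow_mul, ← pow_add, ← pow_mul, ht, pow_add]
          congr 1
          ring
  set Q := m * a * m ^ a + m ^ a with hQ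
  have hfin : 2 ^ (t * t) ≤ 2 ^ (t * (2 * (m * e)) + 1 + (t * Q * (m ^ c + 1) + t * m ^ c)) := by
    refine hb.trans ?_
    calc (m ^ e) ^ t * (m ^ e) ^ t * 2 * _
        ≤ (2 ^ (m * e)) ^ t * (2 ^ (m * e)) ^ t * 2 *
          ((2 ^ (t * Q)) ^ (m ^ c + 1) * 2 ^ (t * m ^ c)) := by
          have g1 := Nat.pow_le_pow_left (hlog e) t
          have g2 := hfc.trans (Nat.mul_le_mul_right (2 ^ (t * m ^ c))
            (Nat.pow_le_pow_left hns2 (m ^ c + 1)))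
          exact Nat.mul_le_mul (Nat.mul_le_mul_right _ (Nat.mul_le_mul g1 g1)) g2
      _ = _ := by
          rw [← pow_mul, ← pow_mul, ← pow_add, ← pow_add, ← pow_succ, ← pow_add]
          congr 1
          ring
  have hle := (Nat.pow_le_pow_iff_right (a := 2) (by norm_num)).1 hfin
  have ht1 : 1 ≤ t := Nat.one_le_pow _ _ (by omega)
  have hle2 : t * t ≤ t * (2 * (m * e) + 1 + (Q * (m ^ c + 1) + m ^ c)) := by nlinarith
  have hle3 := Nat.le_of_mul_le_mul_left hle2 ht1
  have htP : t = m ^ (a + c) * m ^ 3 := by rw [ht, ← pow_add]; congr 1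
  have hPc : m ^ c ≤ m ^ (a + c) := Nat.pow_le_pow_right (by omega) (by omega)
  have hPa : m ^ a ≤ m ^ (a + c) := Nat.pow_le_pow_right (by omega) (by omega)
  have hP1 : 1 ≤ m ^ (a + c) := Nat.one_le_pow _ _ (by omega)
  have hQe : Q * (m ^ c + 1) = (m * a + 1) * m ^ (a + c) + (m * a + 1) * m ^ a := by
    rw [hQ, pow_add]; ring
  rw [hQe, htP] at hle3
  set P := m ^ (a + c)
  have s1 : (m * a + 1) * m ^ a ≤ (m * a + 1) * P := Nat.mul_le_mul_left _ hPa
  have s2 : 2 * (m * e) + 1 ≤ (2 * (m * e) + 1) * P := Nat.le_mul_of_pos_right _ hP1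
  have s3 : P * m ^ 3 ≤ P * (2 * (m * e) + 2 * (m * a) + 4) := by nlinarith
  have s4 := Nat.le_of_mul_le_mul_left s3 hP1
  have s5 : m ^ 3 = m * m * m := by ring
  have s6 : m * (2 * e + 2 * a + 6) ≤ m * m := Nat.mul_le_mul_left _ hm
  have s7 : m * m * 1 ≤ m * m * m := Nat.mul_le_mul_left _ (by omega)
  nlinarith

/-! ## Extraction of structured submatrices -/

lemma gp_pos (φ : Fm) : 1 ≤ gp φ := by
  induction φ with
  | fls => simp [gp]
  | eq => simp [gp]
  | col => simp [gp]
  | adj => simp [gp]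
  | imp φ ψ h1 h2 => simp only [gp]; exact h1.trans (le_max_left _ _)
  | ex x φ h => simp only [gp]; omega

lemma noShatter_mono {C : GraphClass} {φ : Fm} {U V : Finset ℕ} {k k' : ℕ} (hk : k ≤ k')
    (h : NoShatter C φ U V k) : NoShatter C φ U V k' := by
  classical
  intro N G hG col D p v u H
  apply h N G hG col D p (fun j => v (Fin.castLE hk j))
    (fun S => u (fun j => if hj : j.val < k then S ⟨j, hj⟩ else false))
  intro S j
  rw [H]
  simp

lemma nsm_of_noShatter {C : GraphClass} {φ : Fm} {U V : Finset ℕ} {k : ℕ}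
    (h : NoShatter C φ U V k) {N : ℕ} {G : SimpleGraph (Fin N)} (hG : C N G)
    (col : ℕ → Fin N → Prop) (D : List Bool → Set (Fin N)) (p : ℕ → Fin N) {t : ℕ}
    (u v : Fin t → ℕ → Fin N) (a : Fin t → Fin t → Bool)
    (ha : ∀ i j, a i j = true ↔ Sat G col φ D (mix U V (u i) (v j) p)) : NSm k a := by
  rintro ⟨v', u', H⟩
  apply h N G hG col D p (fun j => v (v' j)) (fun S => u (u' S))
  intro S j
  rw [← ha, H]

lemma exists_gap {V : Type} (U : Finset ℕ) (w : ℕ → V) (B : ℕ → Set V) (hB : Monotone B)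
    (q g : ℕ) (hq : U.card ≤ q) :
    ∃ ℓ ≤ q, ∀ x ∈ U, w x ∈ B ((ℓ + 1) * g) → w x ∈ B (ℓ * g) := by
  classical
  by_contra hc
  push Not at hc
  have hc' : ∀ ℓ, ∃ x, ℓ ≤ q → x ∈ U ∧ w x ∈ B ((ℓ + 1) * g) ∧ w x ∉ B (ℓ * g) := by
    intro ℓ
    by_cases hℓ : ℓ ≤ q
    · obtain ⟨x, h1, h2, h3⟩ := hc ℓ hℓ
      exact ⟨x, fun _ => ⟨h1, h2, h3⟩⟩
    · exact ⟨0, fun h => absurd h hℓ⟩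
  choose X hX using hc'
  obtain ⟨a, ha, b, hb, hab, he⟩ := Finset.exists_ne_map_eq_of_card_lt_of_maps_to
    (s := Finset.range (q + 1)) (t := U) (f := X) (by simp; omega)
    (fun ℓ hℓ => (hX ℓ (by simp at hℓ; omega)).1)
  have key : ∀ a b, a < b → a ≤ q → b ≤ q → X a = X b → False := by
    intro a b hab ha hb he
    have h1 := (hX a ha).2.1
    have h2 := (hX b hb).2.2
    rw [he] at h1
    exact h2 (hB (Nat.mul_le_mul_right g hab) h1)
  simp only [Finset.mem_range] at ha hb
  rcases lt_or_gt_of_ne hab with h | h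
  · exact key a b h (by omega) (by omega) he
  · exact key b a h (by omega) (by omega) he.symm

lemma exists_inj {n t : ℕ} (S : Finset (Fin n)) (h : t ≤ S.card) :
    ∃ I : Fin t → Fin n, Function.Injective I ∧ ∀ a, I a ∈ S := by
  refine ⟨fun a => (S.equivFin.symm (Fin.castLE h a) : Fin n), ?_, fun a => Subtype.prop _⟩
  intro a b hab
  have := S.equivFin.symm.injective (Subtype.ext hab)
  simpa [Fin.ext_iff] using this

/-- The situation in which a matrix is realized by a formula. -/
lemma row_case {C : GraphClass} {φ σ : Fm} {y : ℕ} {R U V : Finset ℕ} {c k : ℕ}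
    (hU : U ⊆ R) (hV : V ⊆ R) (hd : Disjoint U V)
    (hIH : ∀ U' V' : Finset ℕ, U' ⊆ R → V' ⊆ R → Disjoint U' V' →
      U'.card + V'.card < U.card + V.card → NoShatter C φ U' V' k)
    (hσ : ∀ U' V' : Finset ℕ, U' ⊆ R → V' ⊆ R → Disjoint U' V' → NoShatter C σ U' V' k)
    (hloc : ∀ S F : Finset ℕ, S ⊆ R → F ⊆ R → Disjoint S F →
    ∀ (N : ℕ) (G : SimpleGraph (Fin N)), C N G → ∀ (col : ℕ → Fin N → Prop)
    (D : List Bool → Set (Fin N)) (m L : ℕ) (B : ℕ → Set (Fin N)) (cl : Fin N → ℕ),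
    Zone G m L B cl → 2 ≤ m → ∀ i j, i + gp φ ≤ j → j ≤ L → ∀ p : ℕ → Fin N,
    ∃ (f : (ℕ → Fin N) → ℕ) (D₁ D₂ : List Bool → Set (Fin N)) (A : (ℕ → Fin N) → ℕ → Prop)
      (W : ℕ → ℕ → Fin N), (∀ w, f w < m ^ c) ∧
      ∀ w w', (∀ x ∈ S, w x ∈ B i) → (∀ x ∈ S, w' x ∈ B i) → f w = f w' →
        ∀ r, (∀ x ∈ F, r x ∉ B j) →
          (Sat G col φ D (mix S F w r p) ↔ (Sat G col φ D₁ (mix S F w' r p) ∨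
            ∃ κ < m ^ c, A w κ ∧ Sat G col σ D₂ (mix (insert y S) (F.erase y) (W κ) r p))))
    {N : ℕ} {G : SimpleGraph (Fin N)} (hG : C N G) {col : ℕ → Fin N → Prop}
    {D : List Bool → Set (Fin N)} {p : ℕ → Fin N} {n : ℕ} {u v : Fin n → ℕ → Fin N}
    {h : Fin n → Fin n → Bool}
    (hh : ∀ i j, Sat G col φ D (mix U V (u i) (v j) p) ↔ h i j = true)
    {m L : ℕ} {B : ℕ → Set (Fin N)} {cl : Fin N → ℕ} (hz : Zone G m L B cl) (hm : 2 ≤ m)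
    {q : ℕ} (hq : U.card ≤ q) (hL : (q + 1) * gp φ ≤ L) {t : ℕ} (ht : 1 ≤ t)
    (I0 J0 : Finset (Fin n)) (x : ℕ) (hx : x ∈ U) (hI0 : ∀ i ∈ I0, u i x ∈ B 0)
    (hI0c : (q + 1) * 2 ^ q * (m ^ c * t) ≤ I0.card)
    (hJ0 : ∀ j ∈ J0, ∀ y ∈ V, v j y ∉ B L) (hJ0c : t ≤ J0.card) :
    ∃ I J : Fin t → Fin n, Function.Injective I ∧ Function.Injective J ∧
      InFam k (m ^ c) (fun a b => h (I a) (J b)) := by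
  classical
  set g := gp φ with hg
  have hgap := fun i => exists_gap U (u i) B hz.mono q g hq
  choose ℓ hℓ hℓ2 using hgap
  let SS : Fin n → Finset ℕ := fun i => U.filter (fun x => u i x ∈ B (ℓ i * g))
  -- first pigeonhole
  obtain ⟨⟨ℓ0, S⟩, hmem, hfib⟩ := Finset.exists_le_card_fiber_of_mul_le_card_of_maps_to
    (s := I0) (t := Finset.range (q + 1) ×ˢ U.powerset) (f := fun i => (ℓ i, SS i))
    (n := m ^ c * t) (fun i _ => by
      simp only [Finset.mem_product, Finset.mem_range, Finset.mem_powerset]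
      exact ⟨by have := hℓ i; omega, Finset.filter_subset _ _⟩)
    ⟨(0, ∅), by simp⟩ (by
      rw [Finset.card_product, Finset.card_range, Finset.card_powerset]
      refine le_trans (Nat.mul_le_mul_right _ (Nat.mul_le_mul_left _ ?_)) hI0c
      exact Nat.pow_le_pow_right (by norm_num) hq)
  set I1 := I0.filter (fun i => (ℓ i, SS i) = (ℓ0, S)) with hI1
  have hI1p : ∀ i ∈ I1, i ∈ I0 ∧ ℓ i = ℓ0 ∧ SS i = S := by
    intro i hi
    have := Finset.mem_filter.1 hi
    simp only [Prod.mk.injEq] at this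
    exact this
  have hmem2 := Finset.mem_product.1 hmem
  have hℓ0 : ℓ0 ≤ q := by have := Finset.mem_range.1 hmem2.1; simp at this; omega
  have hSU : S ⊆ U := Finset.mem_powerset.1 hmem2.2
  set F := (U \ S) ∪ V with hF
  have hSF : Disjoint S F := by
    rw [Finset.disjoint_left] at hd ⊢
    intro a ha hb
    simp only [hF, Finset.mem_union, Finset.mem_sdiff] at hb
    rcases hb with hb | hb
    · exact hb.2 ha
    · exact hd (hSU ha) hb
  obtain ⟨f, D₁, D₂, A, W, hf, H⟩ := hloc S F (hSU.trans hU)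
    (by
      intro a ha
      simp only [hF, Finset.mem_union, Finset.mem_sdiff] at ha
      rcases ha with ha | ha
      · exact hU ha.1
      · exact hV ha) hSF N G hG col D m L B cl hz hm (ℓ0 * g) ((ℓ0 + 1) * g)
    (by rw [Nat.add_mul, Nat.one_mul])
    ((Nat.mul_le_mul_right g (by omega)).trans hL) p
  obtain ⟨κ0, hκ0, hfib2⟩ := Finset.exists_le_card_fiber_of_mul_le_card_of_maps_to
    (s := I1) (t := Finset.range (m ^ c)) (f := fun i => f (u i))
    (n := t) (fun i _ => Finset.mem_range.2 (hf _))
    ⟨0, Finset.mem_range.2 (by positivity)⟩ (by rw [Finset.card_range]; exact hfib)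
  set I2 := I1.filter (fun i => f (u i) = κ0) with hI2
  obtain ⟨I, hI, hIm⟩ := exists_inj I2 hfib2
  obtain ⟨J, hJ, hJm⟩ := exists_inj J0 hJ0c
  set i0 : Fin n := I ⟨0, ht⟩ with hi0
  have hI2p : ∀ i ∈ I2, (∀ x ∈ S, u i x ∈ B (ℓ0 * g)) ∧ (∀ x ∈ U \ S, u i x ∉ B ((ℓ0 + 1) * g)) ∧
      f (u i) = κ0 := by
    intro i hi
    obtain ⟨h1, h2⟩ := Finset.mem_filter.1 hi
    obtain ⟨_, h3, h4⟩ := hI1p i h1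
    refine ⟨fun x hxS => ?_, fun x hxS hxB => ?_, h2⟩
    · rw [← h4] at hxS
      have := (Finset.mem_filter.1 hxS).2
      rwa [h3] at this
    · rw [Finset.mem_sdiff] at hxS
      apply hxS.2
      rw [← h4]
      refine Finset.mem_filter.2 ⟨hxS.1, hℓ2 i x hxS.1 ?_⟩
      rwa [h3]
  have hxS : x ∈ S := by
    obtain ⟨h1, h2⟩ := Finset.mem_filter.1 (hIm ⟨0, ht⟩)
    obtain ⟨h5, h3, h4⟩ := hI1p _ h1
    rw [← h4]
    exact Finset.mem_filter.2 ⟨hx, hz.mono (Nat.zero_le _) (hI0 _ h5)⟩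
  let p1 : ℕ → Fin N := fun x => if x ∈ S then u i0 x else p x
  let p2 : ℕ → ℕ → Fin N := fun κ x => if x ∈ insert y S then W κ x else p x
  have hSV : ∀ a ∈ S, a ∉ V := fun a ha hb => Finset.disjoint_left.1 hd (hSU ha) hb
  have main : ∀ a b, h (I a) (J b) = true ↔
      (Sat G col φ D₁ (mix (U \ S) V (u (I a)) (v (J b)) p1) ∨
        ∃ κ < m ^ c, A (u (I a)) κ ∧
          Sat G col σ D₂ (mix ((U \ S).erase y) (V.erase y) (u (I a)) (v (J b)) (p2 κ))) := by
    intro a b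
    rw [← hh]
    have e1 : mix U V (u (I a)) (v (J b)) p =
        mix S F (u (I a)) (mix U V (u (I a)) (v (J b)) p) p := by
      funext z
      by_cases hzS : z ∈ S
      · simp [mix, hzS, hSU hzS]
      · by_cases hzU : z ∈ U
        · simp [mix, hzS, hzU, hF]
        · by_cases hzV : z ∈ V <;> simp [mix, hzS, hzU, hzV, hF]
    rw [e1]
    obtain ⟨a1, a2, a3⟩ := hI2p _ (hIm a)
    obtain ⟨b1, b2, b3⟩ := hI2p _ (hIm ⟨0, ht⟩)
    rw [H (u (I a)) (u i0) a1 b1 (a3.trans b3.symm) (mix U V (u (I a)) (v (J b)) p) ?_]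
    · have e2 : mix S F (u i0) (mix U V (u (I a)) (v (J b)) p) p =
          mix (U \ S) V (u (I a)) (v (J b)) p1 := by
        funext z
        by_cases hzS : z ∈ S
        · simp [mix, hzS, hSV z hzS, p1]
        · by_cases hzU : z ∈ U
          · simp [mix, hzS, hzU, hF]
          · by_cases hzV : z ∈ V <;> simp [mix, hzS, hzU, hzV, hF, p1]
      have e3 : ∀ κ, mix (insert y S) (F.erase y) (W κ) (mix U V (u (I a)) (v (J b)) p) p =
          mix ((U \ S).erase y) (V.erase y) (u (I a)) (v (J b)) (p2 κ) := by
        intro κ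
        funext z
        by_cases hzy : z = y
        · simp [mix, hzy, p2]
        by_cases hzS : z ∈ S
        · simp [mix, hzS, hzy, hSV z hzS, p2]
        · by_cases hzU : z ∈ U
          · simp [mix, hzS, hzU, hF, hzy]
          · by_cases hzV : z ∈ V <;> simp [mix, hzS, hzU, hzV, hF, hzy, p2]
      rw [e2]
      simp only [e3]
    · intro z hzF
      simp only [hF, Finset.mem_union] at hzF
      rcases hzF with hzF | hzF
      · have hzU : z ∈ U := (Finset.mem_sdiff.1 hzF).1
        simp only [mix, hzU, if_true]
        exact a2 z hzF
      · have hzU : z ∉ U := fun hzU => Finset.disjoint_left.1 hd hzU hzF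
        simp only [mix, hzU, hzF, if_true, if_false]
        intro hzB
        exact hJ0 _ (hJm b) z hzF (hz.mono ((Nat.mul_le_mul_right g (by omega)).trans hL) hzB)
  refine ⟨I, J, hI, hJ, fun a b => decide (Sat G col φ D₁ (mix (U \ S) V (u (I a)) (v (J b)) p1)),
    fun κ a b => decide (Sat G col σ D₂
      (mix ((U \ S).erase y) (V.erase y) (u (I a)) (v (J b)) (p2 κ))),
    fun a κ => decide (A (u (I a)) κ), ?_, ?_, ?_⟩
  · refine nsm_of_noShatter (hIH (U \ S) V (Finset.sdiff_subset.trans hU) hV ?_ ?_) hG col D₁ p1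
      (fun a => u (I a)) (fun b => v (J b)) _ (fun i j => by simp)
    · exact Finset.disjoint_of_subset_left Finset.sdiff_subset hd
    · have : (U \ S).card < U.card := Finset.card_lt_card (by
        refine Finset.ssubset_iff_subset_ne.2 ⟨Finset.sdiff_subset, fun he => ?_⟩
        rw [← he] at hx
        exact (Finset.mem_sdiff.1 hx).2 hxS)
      omega
  · intro κ
    refine nsm_of_noShatter (hσ ((U \ S).erase y) (V.erase y) ?_ ?_ ?_) hG col D₂ (p2 κ)
      (fun a => u (I a)) (fun b => v (J b)) _ (fun i j => by simp)
    · exact (Finset.erase_subset _ _).trans (Finset.sdiff_subset.trans hU)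
    · exact (Finset.erase_subset _ _).trans hV
    · exact Finset.disjoint_of_subset_left ((Finset.erase_subset _ _).trans Finset.sdiff_subset)
        (Finset.disjoint_of_subset_right (Finset.erase_subset _ _) hd)
  · intro a b
    rw [main a b]
    simp only [decide_eq_true_eq]
    constructor
    · rintro (h1 | ⟨κ, h1, h2⟩)
      · exact Or.inl h1
      · exact Or.inr ⟨⟨κ, h1⟩, h2⟩
    · rintro (h1 | ⟨κ, h2⟩)
      · exact Or.inl h1
      · exact Or.inr ⟨κ, κ.2, h2⟩

/-- The local representation with explicit constants. -/
def LocAt (C : GraphClass) (φ σ : Fm) (y : ℕ) (R : Finset ℕ) (c : ℕ) : Prop :=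
  ∀ S F : Finset ℕ, S ⊆ R → F ⊆ R → Disjoint S F →
    ∀ (N : ℕ) (G : SimpleGraph (Fin N)), C N G → ∀ (col : ℕ → Fin N → Prop)
    (D : List Bool → Set (Fin N)) (m L : ℕ) (B : ℕ → Set (Fin N)) (cl : Fin N → ℕ),
    Zone G m L B cl → 2 ≤ m → ∀ i j, i + gp φ ≤ j → j ≤ L → ∀ p : ℕ → Fin N,
    ∃ (f : (ℕ → Fin N) → ℕ) (D₁ D₂ : List Bool → Set (Fin N)) (A : (ℕ → Fin N) → ℕ → Prop)
      (W : ℕ → ℕ → Fin N), (∀ w, f w < m ^ c) ∧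
      ∀ w w', (∀ x ∈ S, w x ∈ B i) → (∀ x ∈ S, w' x ∈ B i) → f w = f w' →
        ∀ r, (∀ x ∈ F, r x ∉ B j) →
          (Sat G col φ D (mix S F w r p) ↔ (Sat G col φ D₁ (mix S F w' r p) ∨
            ∃ κ < m ^ c, A w κ ∧ Sat G col σ D₂ (mix (insert y S) (F.erase y) (W κ) r p)))

lemma const_case {C : GraphClass} {φ : Fm} {R U V : Finset ℕ} {k : ℕ}
    (hU : U ⊆ R) (hV : V ⊆ R) (hd : Disjoint U V)
    (hIH : ∀ U' V' : Finset ℕ, U' ⊆ R → V' ⊆ R → Disjoint U' V' →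
      U'.card + V'.card < U.card + V.card → NoShatter C φ U' V' k)
    {N : ℕ} {G : SimpleGraph (Fin N)} (hG : C N G) {col : ℕ → Fin N → Prop}
    {D : List Bool → Set (Fin N)} {p : ℕ → Fin N} {n : ℕ} {u v : Fin n → ℕ → Fin N}
    {h : Fin n → Fin n → Bool}
    (hh : ∀ i j, Sat G col φ D (mix U V (u i) (v j) p) ↔ h i j = true)
    (M : ℕ) {t : ℕ} (x : ℕ) (hx : x ∈ U) (z : Fin N) (I0 : Finset (Fin n))
    (hI0 : ∀ i ∈ I0, u i x = z) (hI0c : t ≤ I0.card) (htn : t ≤ n) :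
    ∃ I J : Fin t → Fin n, Function.Injective I ∧ Function.Injective J ∧
      InFam k M (fun a b => h (I a) (J b)) := by
  classical
  obtain ⟨I, hI, hIm⟩ := exists_inj I0 hI0c
  have hn : NSm k (fun a b => h (I a) (Fin.castLE htn b)) := by
    refine nsm_of_noShatter (hIH (U.erase x) V ((Finset.erase_subset _ _).trans hU) hV
      (Finset.disjoint_of_subset_left (Finset.erase_subset _ _) hd) ?_) hG col D
      (Function.update p x z) (fun a => u (I a)) (fun b => v (Fin.castLE htn b)) _ (fun i j => ?_)
    · have := Finset.card_erase_lt_of_mem hx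
      omega
    · rw [← hh]
      have : mix U V (u (I i)) (v (Fin.castLE htn j)) p =
          mix (U.erase x) V (u (I i)) (v (Fin.castLE htn j)) (Function.update p x z) := by
        funext a
        by_cases hax : a = x
        · subst hax
          have : a ∉ V := fun hb => Finset.disjoint_left.1 hd hx hb
          simp [mix, hx, this, hI0 _ (hIm i)]
        · simp [mix, hax]
      rw [this]
  exact ⟨I, Fin.castLE htn, hI, Fin.castLE_injective htn, _, fun _ => _, fun _ _ => false, hn,
    fun _ => hn, fun i j => by simp⟩

lemma fib_card {α β : Type} [Fintype α] [DecidableEq β] (w : α → β) (X : Finset β) :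
    (Finset.univ.filter (fun i => w i ∈ X)).card =
      ∑ z ∈ X, (Finset.univ.filter (fun i => w i = z)).card := by
  classical
  rw [Finset.card_eq_sum_card_fiberwise (f := w) (t := X) (fun i hi => by simpa using hi)]
  refine Finset.sum_congr rfl fun z hz => ?_
  congr 1
  ext i
  simp only [Finset.mem_filter, Finset.mem_univ, true_and]
  constructor
  · exact fun h => h.2
  · exact fun h => ⟨h ▸ hz, h⟩

lemma far_card {n N t m s q : ℕ} (V : Finset ℕ) (v : Fin n → ℕ → Fin N) (B : Finset (Fin N))
    (h : ∑ y ∈ V, (Finset.univ.filter (fun i => v i y ∈ B)).card ≤ 2 * m * s * q)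
    (hn : 2 * m * s * q + t ≤ n) :
    t ≤ (Finset.univ.filter (fun j => ∀ y ∈ V, v j y ∉ B)).card := by
  classical
  have h1 : (Finset.univ : Finset (Fin n)) ⊆ (Finset.univ.filter (fun j => ∀ y ∈ V, v j y ∉ B)) ∪
      V.biUnion (fun y => Finset.univ.filter (fun i => v i y ∈ B)) := by
    intro j _
    by_cases hj : ∀ y ∈ V, v j y ∉ B
    · exact Finset.mem_union_left _ (by simpa using hj)
    · push Not at hj
      obtain ⟨y, hy, hyB⟩ := hj
      exact Finset.mem_union_right _ (Finset.mem_biUnion.2 ⟨y, hy, by simpa using hyB⟩)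
  have h2 := (Finset.card_le_card h1).trans (Finset.card_union_le _ _)
  have h3 := Finset.card_biUnion_le (s := V) (t := fun y => Finset.univ.filter (fun i => v i y ∈ B))
  simp only [Finset.card_univ, Fintype.card_fin] at h2
  omega

lemma step {C : GraphClass} {φ σ : Fm} {y : ℕ} {R U V : Finset ℕ} {c k : ℕ}
    (hU : U ⊆ R) (hV : V ⊆ R) (hd : Disjoint U V)
    (hIH : ∀ U' V' : Finset ℕ, U' ⊆ R → V' ⊆ R → Disjoint U' V' →
      U'.card + V'.card < U.card + V.card → NoShatter C φ U' V' k)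
    (hσ : ∀ U' V' : Finset ℕ, U' ⊆ R → V' ⊆ R → Disjoint U' V' → NoShatter C σ U' V' k)
    (hloc : LocAt C φ σ y R c)
    {N : ℕ} {G : SimpleGraph (Fin N)} (hG : C N G) {col : ℕ → Fin N → Prop}
    {D : List Bool → Set (Fin N)} {p : ℕ → Fin N} {n : ℕ} {u v : Fin n → ℕ → Fin N}
    {h : Fin n → Fin n → Bool}
    (hh : ∀ i j, Sat G col φ D (mix U V (u i) (v j) p) ↔ h i j = true)
    {q : ℕ} (hq : U.card + V.card = q) (hq1 : 1 ≤ q) {m d t s : ℕ} (hm : 2 ≤ m) (ht : 1 ≤ t)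
    (hG2 : TwwLE G d) (hdm : (d + 1) ^ ((q + 1) * gp φ) ≤ m)
    (hs : s = (q + 1) * 2 ^ q * (m ^ c * t)) (hn : 2 * m * s * q + t + s ≤ n) :
    ∃ I J : Fin t → Fin n, Function.Injective I ∧ Function.Injective J ∧
      (InFam k (m ^ c) (fun a b => h (I a) (J b)) ∨
        InFam k (m ^ c) (fun a b => h (J b) (I a))) := by
  classical
  have hts : t ≤ s := by
    rw [hs]
    have h1 : 1 ≤ (q + 1) * 2 ^ q * m ^ c := Nat.one_le_iff_ne_zero.2 (by positivity)
    calc t = 1 * t := by ring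
      _ ≤ ((q + 1) * 2 ^ q * m ^ c) * t := Nat.mul_le_mul_right _ h1
      _ = _ := by ring
  have hh' : ∀ j i, Sat G col φ D (mix V U (v j) (u i) p) ↔ h i j = true := by
    intro j i
    rw [← hh, mix_swap hd]
  have hIH' : ∀ U' V' : Finset ℕ, U' ⊆ R → V' ⊆ R → Disjoint U' V' →
      U'.card + V'.card < V.card + U.card → NoShatter C φ U' V' k := by
    intro U' V' h1 h2 h3 h4
    exact hIH U' V' h1 h2 h3 (by omega)
  by_cases hc1 : ∃ x ∈ U, ∃ z, s ≤ (Finset.univ.filter (fun i => u i x = z)).card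
  · obtain ⟨x, hx, z, hz⟩ := hc1
    obtain ⟨I, J, hI, hJ, hF⟩ := const_case hU hV hd hIH hG hh (m ^ c) x hx z
      (Finset.univ.filter (fun i => u i x = z)) (by simp) (hts.trans hz) (t := t) (by omega)
    exact ⟨I, J, hI, hJ, Or.inl hF⟩
  by_cases hc2 : ∃ x ∈ V, ∃ z, s ≤ (Finset.univ.filter (fun i => v i x = z)).card
  · obtain ⟨x, hx, z, hz⟩ := hc2
    obtain ⟨I, J, hI, hJ, hF⟩ := const_case (h := fun j i => h i j) hV hU hd.symm hIH' hG hh'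
      (m ^ c) x hx z
      (Finset.univ.filter (fun i => v i x = z)) (by simp) (hts.trans hz) (t := t) (by omega)
    exact ⟨I, J, hI, hJ, Or.inr hF⟩
  push Not at hc1 hc2
  let ω : Fin N → ℕ := fun z => ∑ x ∈ U, (Finset.univ.filter (fun i => u i x = z)).card +
    ∑ x ∈ V, (Finset.univ.filter (fun i => v i x = z)).card
  have hωX : ∀ X : Finset (Fin N), ∑ z ∈ X, ω z =
      ∑ x ∈ U, (Finset.univ.filter (fun i => u i x ∈ X)).card +
      ∑ x ∈ V, (Finset.univ.filter (fun i => v i x ∈ X)).card := by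
    intro X
    simp only [ω, Finset.sum_add_distrib]
    rw [Finset.sum_comm, Finset.sum_comm (s := X) (t := V)]
    congr 1 <;> exact Finset.sum_congr rfl fun x _ => (fib_card _ X).symm
  have hspos : 0 < s := by omega
  have hωlt : ∀ z, ω z < s * q := by
    intro z
    have a1 : ∑ x ∈ U, (Finset.univ.filter (fun i => u i x = z)).card ≤ ∑ x ∈ U, (s - 1) :=
      Finset.sum_le_sum fun x hx => by have := hc1 x hx z; omega
    have a2 : ∑ x ∈ V, (Finset.univ.filter (fun i => v i x = z)).card ≤ ∑ x ∈ V, (s - 1) :=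
      Finset.sum_le_sum fun x hx => by have := hc2 x hx z; omega
    have a3 : ω z ≤ (U.card + V.card) * (s - 1) := by
      simp only [Finset.sum_const, smul_eq_mul] at a1 a2
      rw [Nat.add_mul]
      exact Nat.add_le_add a1 a2
    rw [hq] at a3
    have a4 : q * (s - 1) < q * s := Nat.mul_lt_mul_of_pos_left (by omega) (by omega)
    rw [Nat.mul_comm s q]
    omega
  have hωtot : s * q ≤ ∑ z, ω z := by
    rw [hωX]
    simp only [Finset.mem_univ, Finset.filter_true, Finset.card_univ, Fintype.card_fin,
      Finset.sum_const, smul_eq_mul]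
    rw [← Nat.add_mul, hq, Nat.mul_comm s q]
    exact Nat.mul_le_mul_left _ (by omega)
  obtain ⟨X, B, cl, hz, hXB, hXs, hBL⟩ := zone_lemma G d m ((q + 1) * gp φ) hG2 hdm ω (s * q)
    (Nat.mul_pos hspos hq1) hωlt hωtot
  rw [hωX] at hXs hBL
  have hbound : m * (2 * (s * q)) = 2 * m * s * q := by ring
  rw [hbound] at hBL
  have hsel : (∃ x ∈ U, s ≤ (Finset.univ.filter (fun i => u i x ∈ X)).card) ∨
      (∃ x ∈ V, s ≤ (Finset.univ.filter (fun i => v i x ∈ X)).card) := by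
    by_contra hc
    push Not at hc
    obtain ⟨c1, c2⟩ := hc
    have a1 : ∑ x ∈ U, (Finset.univ.filter (fun i => u i x ∈ X)).card ≤ ∑ x ∈ U, (s - 1) :=
      Finset.sum_le_sum fun x hx => by have := c1 x hx; omega
    have a2 : ∑ x ∈ V, (Finset.univ.filter (fun i => v i x ∈ X)).card ≤ ∑ x ∈ V, (s - 1) :=
      Finset.sum_le_sum fun x hx => by have := c2 x hx; omega
    simp only [Finset.sum_const, smul_eq_mul] at a1 a2
    have a3 : s * q ≤ (U.card + V.card) * (s - 1) := by
      rw [Nat.add_mul]; omega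
    rw [hq] at a3
    have a4 : q * (s - 1) < q * s := Nat.mul_lt_mul_of_pos_left (by omega) (by omega)
    rw [Nat.mul_comm s q] at a3
    omega
  have hUq : U.card ≤ q := by omega
  have hVq : V.card ≤ q := by omega
  have hnt : 2 * m * s * q + t ≤ n := by omega
  obtain ⟨BL, hBLm⟩ : ∃ BL : Finset (Fin N), BL = Finset.univ.filter
    (fun z => z ∈ B ((q + 1) * gp φ)) := ⟨_, rfl⟩
  rw [← hBLm] at hBL
  have hBm : ∀ z, z ∉ BL → z ∉ B ((q + 1) * gp φ) := by
    intro z hz1 hz2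
    apply hz1
    rw [hBLm]
    exact Finset.mem_filter.2 ⟨Finset.mem_univ _, hz2⟩
  have fV := far_card (m := m) (s := s) (q := q) V v BL ((Nat.le_add_left _ _).trans hBL) hnt
  have fU := far_card (m := m) (s := s) (q := q) U u BL ((Nat.le_add_right _ _).trans hBL) hnt
  rw [hs] at hsel
  rcases hsel with ⟨x, hx, hsx⟩ | ⟨x, hx, hsx⟩
  · obtain ⟨I, J, hI, hJ, hF⟩ := row_case hU hV hd hIH hσ hloc hG hh hz hm hUq
      le_rfl ht (Finset.univ.filter (fun i => u i x ∈ X))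
      (Finset.univ.filter (fun j => ∀ y ∈ V, v j y ∉ BL)) x hx
      (fun i hi => hXB _ (Finset.mem_filter.1 hi).2) hsx
      (fun j hj y hy => hBm _ ((Finset.mem_filter.1 hj).2 y hy)) fV
    exact ⟨I, J, hI, hJ, Or.inl hF⟩
  · obtain ⟨I, J, hI, hJ, hF⟩ := row_case (h := fun j i => h i j) hV hU hd.symm hIH' hσ hloc hG hh'
      hz hm hVq
      le_rfl ht (Finset.univ.filter (fun i => v i x ∈ X))
      (Finset.univ.filter (fun j => ∀ y ∈ U, u j y ∉ BL)) x hx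
      (fun i hi => hXB _ (Finset.mem_filter.1 hi).2) hsx
      (fun j hj y hy => hBm _ ((Finset.mem_filter.1 hj).2 y hy)) fU
    exact ⟨I, J, hI, hJ, Or.inr hF⟩

/-! ## Tameness of all formulas -/

/-- Almost bounded twin-width. -/
def ABT (C : GraphClass) : Prop :=
  ∀ ε : ℝ, 0 < ε → ∃ c : ℝ, ∀ (n : ℕ) (G : SimpleGraph (Fin n)), C n G →
    ∃ d : ℕ, TwwLE G d ∧ (d : ℝ) ≤ c * (n : ℝ) ^ ε

lemma abt_nat {C : GraphClass} (h : ABT C) (w : ℕ) (hw : 1 ≤ w) : ∃ a : ℕ, ∀ ν : ℕ,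
    ∀ (n : ℕ) (G : SimpleGraph (Fin n)), C n G → n ≤ ν ^ w → ∃ d : ℕ, TwwLE G d ∧ d ≤ a * ν := by
  obtain ⟨c, hc⟩ := h (1 / (w : ℝ)) (by positivity)
  refine ⟨⌈|c|⌉₊, fun ν n G hG hn => ?_⟩
  obtain ⟨d, h1, h2⟩ := hc n G hG
  refine ⟨d, h1, ?_⟩
  have h3 : (n : ℝ) ^ (1 / (w : ℝ)) ≤ ν := by
    calc (n : ℝ) ^ (1 / (w : ℝ)) ≤ ((ν : ℝ) ^ w) ^ (1 / (w : ℝ)) := by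
          apply Real.rpow_le_rpow (by positivity) (by exact_mod_cast hn) (by positivity)
      _ = ν := by
          rw [one_div, Real.pow_rpow_inv_natCast (by positivity) (by omega)]
  have h4 : (d : ℝ) ≤ (⌈|c|⌉₊ : ℝ) * ν := by
    calc (d : ℝ) ≤ c * (n : ℝ) ^ (1 / (w : ℝ)) := h2
      _ ≤ |c| * (n : ℝ) ^ (1 / (w : ℝ)) := by
          apply mul_le_mul_of_nonneg_right (le_abs_self c) (by positivity)
      _ ≤ |c| * ν := by gcongr
      _ ≤ _ := by gcongr; exact Nat.le_ceil _
  exact_mod_cast h4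

lemma tame_step {C : GraphClass} (hH : Hereditary C) (hA : ABT C) {φ σ : Fm} {y : ℕ}
    {R U V : Finset ℕ} {c k : ℕ} (hU : U ⊆ R) (hV : V ⊆ R) (hd : Disjoint U V)
    (hIH : ∀ U' V' : Finset ℕ, U' ⊆ R → V' ⊆ R → Disjoint U' V' →
      U'.card + V'.card < U.card + V.card → NoShatter C φ U' V' k)
    (hσ : ∀ U' V' : Finset ℕ, U' ⊆ R → V' ⊆ R → Disjoint U' V' → NoShatter C σ U' V' k)
    (hloc : LocAt C φ σ y R c) (hq1 : 1 ≤ U.card + V.card) : ∃ k', NoShatter C φ U V k' := by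
  classical
  by_contra hcon
  push Not at hcon
  obtain ⟨q, hq⟩ : ∃ q, U.card + V.card = q := ⟨_, rfl⟩
  rw [hq] at hq1
  obtain ⟨e₁, he₁⟩ := counting k c
  obtain ⟨m₀, hm₀⟩ := he₁ (c + e₁ + 4)
  obtain ⟨E, hE⟩ := small_realization hH φ U V
  set L := (q + 1) * gp φ with hL
  have hL1 : 1 ≤ L := Nat.mul_pos (by omega) (gp_pos φ)
  obtain ⟨a, ha⟩ := abt_nat hA (2 * L * (c + e₁ + 4) * E + 1) (by omega)
  set ν := m₀ + (q + 1) * 2 ^ q + 2 * q + a + 2 with hν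
  set m := ν ^ (2 * L) with hm
  have hνm : ν ≤ m := Nat.le_self_pow (by omega) ν
  have hmm := hm₀ m (by omega)
  have hm2 : 2 ≤ m := by omega
  set n := m ^ (c + e₁ + 4) with hn
  refine hmm fun h => ?_
  have hn2 : 2 ≤ n := hm2.trans (Nat.le_self_pow (by omega) m)
  have := hcon n
  unfold NoShatter at this
  push Not at this
  obtain ⟨N, G, hG, col, D, p, v, u, hr⟩ := this
  obtain ⟨N', G', hG', hN', col', D', p', u', v', hr'⟩ :=
    hE n hn2 N G hG col D p (fun i => u (h i)) v
  have hN2 : N' ≤ ν ^ (2 * L * (c + e₁ + 4) * E + 1) := by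
    refine hN'.trans ?_
    rw [hn, hm, ← pow_mul, ← pow_mul]
    exact Nat.pow_le_pow_right (by omega) ((le_of_eq (by ring)).trans (Nat.le_succ _))
  obtain ⟨d, hd1, hd2⟩ := ha ν N' G' hG' hN2
  have hdm : (d + 1) ^ ((q + 1) * gp φ) ≤ m := by
    rw [← hL, hm, pow_mul ν 2 L]
    refine Nat.pow_le_pow_left ?_ _
    have : (a + 1) * ν ≤ ν * ν := Nat.mul_le_mul_right _ (by omega)
    have h1 : 1 ≤ ν := by omega
    rw [sq]
    calc d + 1 ≤ a * ν + ν := Nat.add_le_add hd2 h1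
      _ = (a + 1) * ν := by ring
      _ ≤ _ := this
  refine step hU hV hd hIH hσ hloc hG' (h := h) (u := u') (v := v') (p := p') (col := col')
    (D := D') (t := m ^ e₁) (fun i j => ?_) hq hq1 hm2 (Nat.one_le_pow e₁ m (by omega)) hd1 hdm rfl ?_
  · rw [hr', hr]
  · set Y := m ^ (1 + c + e₁) with hY
    have hs : (q + 1) * 2 ^ q * (m ^ c * m ^ e₁) ≤ Y := by
      rw [hY, Nat.add_assoc, pow_add, pow_one, pow_add]
      exact Nat.mul_le_mul_right _ (by omega)
    have ht : m ^ e₁ ≤ Y := Nat.pow_le_pow_right (by omega) (by omega)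
    have hnY : n = m * m * m * Y := by
      rw [hn, hY, show c + e₁ + 4 = (1 + c + e₁) + 3 by ring, pow_add]; ring
    have hY1 : 1 ≤ Y := Nat.one_le_pow _ _ (by omega)
    generalize (q + 1) * 2 ^ q * (m ^ c * m ^ e₁) = s at hs
    rw [hnY]
    have h1 : 2 * m * s * q ≤ m * m * Y := by
      calc 2 * m * s * q = m * (2 * q) * s := by ring
        _ ≤ m * m * Y := Nat.mul_le_mul (Nat.mul_le_mul_left _ (by omega)) hs
    have h2 : m * m * Y + 2 * Y ≤ m * m * m * Y := by
      have : m * m + 2 ≤ m * m * m := by nlinarith [Nat.mul_le_mul hm2 hm2]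
      nlinarith
    omega

lemma tame_of_loc {C : GraphClass} (hH : Hereditary C) (hA : ABT C) {φ : Fm} (h : Loc C φ) :
    Tame C φ := by
  classical
  intro R
  obtain ⟨σ, y, hσ, hl⟩ := h
  obtain ⟨c, hc⟩ := hl R
  obtain ⟨kσ, hkσ⟩ := hσ R
  have main : ∀ q : ℕ, ∃ k, ∀ U V : Finset ℕ, U ⊆ R → V ⊆ R → Disjoint U V →
      U.card + V.card ≤ q → NoShatter C φ U V k := by
    intro q
    induction q with
    | zero =>
      refine ⟨1, fun U V _ _ _ hq N G hG col D p v u H => ?_⟩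
      have hU : U = ∅ := Finset.card_eq_zero.1 (by omega)
      have hV : V = ∅ := Finset.card_eq_zero.1 (by omega)
      subst hU hV
      have h1 := (H (fun _ => true) 0).2 rfl
      have h2 := (H (fun _ => false) 0).1 h1
      simp at h2
    | succ q ih =>
      obtain ⟨k1, hk1⟩ := ih
      have hex : ∀ X : Finset ℕ × Finset ℕ, ∃ k, X.1 ⊆ R → X.2 ⊆ R → Disjoint X.1 X.2 →
          X.1.card + X.2.card ≤ q + 1 → NoShatter C φ X.1 X.2 k := by
        rintro ⟨U, V⟩
        by_cases hX : U ⊆ R ∧ V ⊆ R ∧ Disjoint U V ∧ U.card + V.card ≤ q + 1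
        · obtain ⟨h1, h2, h3, h4⟩ := hX
          by_cases h5 : 1 ≤ U.card + V.card
          · obtain ⟨k', hk'⟩ := tame_step hH hA (k := max k1 kσ) h1 h2 h3
              (fun U' V' g1 g2 g3 g4 => noShatter_mono (le_max_left _ _)
                (hk1 U' V' g1 g2 g3 (by omega)))
              (fun U' V' g1 g2 g3 => noShatter_mono (le_max_right _ _) (hkσ U' V' g1 g2 g3)) hc h5
            exact ⟨k', fun _ _ _ _ => hk'⟩
          · exact ⟨k1, fun _ _ _ _ => hk1 U V h1 h2 h3 (by omega)⟩
        · exact ⟨0, fun h1 h2 h3 h4 => absurd ⟨h1, h2, h3, h4⟩ hX⟩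
      choose K hK using hex
      refine ⟨(R.powerset ×ˢ R.powerset).sup K, fun U V h1 h2 h3 h4 => ?_⟩
      exact noShatter_mono (Finset.le_sup (f := K) (b := (U, V)) (by simp [h1, h2]))
        (hK (U, V) h1 h2 h3 h4)
  obtain ⟨k, hk⟩ := main (R.card + R.card)
  exact ⟨k, fun U V h1 h2 h3 => hk U V h1 h2 h3
    (Nat.add_le_add (Finset.card_le_card h1) (Finset.card_le_card h2))⟩

lemma tame_all {C : GraphClass} (hH : Hereditary C) (hA : ABT C) (φ : Fm) :
    Tame C φ ∧ Cnt C φ := by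
  induction φ with
  | fls => exact ⟨tame_fls C, cnt_fls C⟩
  | eq x y => exact ⟨tame_of_loc hH hA (loc_of_cnt (cnt_eq C x y)), cnt_eq C x y⟩
  | col c x => exact ⟨tame_of_loc hH hA (loc_of_cnt (cnt_col C c x)), cnt_col C c x⟩
  | adj x y => exact ⟨tame_of_loc hH hA (loc_of_cnt (cnt_adj C x y)), cnt_adj C x y⟩
  | imp φ ψ h1 h2 => exact ⟨tame_imp h1.1 h2.1, cnt_imp h1.2 h2.2⟩
  | ex x φ h =>
    have ht := tame_of_loc hH hA (loc_ex x h.2 h.1)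
    exact ⟨ht, cnt_ex x h.2 h.1 ht⟩

/-! ## Translation from Mathlib formulas -/

/-- The vertex variable denoted by a term of the relational language. -/
def tvar {k n : ℕ} : (colLang k).Term (Fin 2 ⊕ Fin n) → ℕ
  | .var (Sum.inl i) => i.val
  | .var (Sum.inr j) => 2 + j.val
  | .func f _ => Empty.elim f

lemma tvar_spec {k n : ℕ} {V : Type} (G : SimpleGraph V) (c : V → Fin k) (a : ℕ → V)
    (t : (colLang k).Term (Fin 2 ⊕ Fin n)) :
    (letI := colStruct G c
     t.realize (Sum.elim (fun i : Fin 2 => a i.val) (fun j : Fin n => a (2 + j.val)))) =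
      a (tvar t) := by
  cases t with
  | var x => cases x <;> rfl
  | func f _ => exact Empty.elim f

lemma fmTranslate {k n : ℕ} (φ : (colLang k).BoundedFormula (Fin 2) n) :
    ∃ ψ : Fm, ∀ (V : Type) (G : SimpleGraph V) (c : V → Fin k) (a : ℕ → V),
      Sat G (fun i v => (c v).val = i) ψ (fun _ => Set.univ) a ↔
        (letI := colStruct G c
         φ.Realize (fun i : Fin 2 => a i.val) (fun j : Fin n => a (2 + j.val))) := by
  induction φ with
  | falsum => exact ⟨.fls, fun V G c a => Iff.rfl⟩
  | equal t₁ t₂ =>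
    refine ⟨.eq (tvar t₁) (tvar t₂), fun V G c a => ?_⟩
    have h := tvar_spec G c a t₁
    have h' := tvar_spec G c a t₂
    change a (tvar t₁) = a (tvar t₂) ↔ _
    rw [← h, ← h']
    exact Iff.rfl
  | @rel n l R ts =>
    match l, R, ts with
    | 0, R, _ => exact Empty.elim R
    | 1, R, ts =>
      refine ⟨.col (Fin.val (n := k) R) (tvar (ts 0)), fun V G c a => ?_⟩
      have h := tvar_spec G c a (ts 0)
      refine (Fin.val_inj (n := k) (a := c (a (tvar (ts 0)))) (b := R)).trans ?_
      rw [← h]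
      exact Iff.rfl
    | 2, R, ts =>
      refine ⟨.adj (tvar (ts 0)) (tvar (ts 1)), fun V G c a => ?_⟩
      have h := tvar_spec G c a (ts 0)
      have h' := tvar_spec G c a (ts 1)
      change (G.Adj (a (tvar (ts 0))) (a (tvar (ts 1)))) ↔ (G.Adj _ _)
      rw [← h, ← h']
    | _ + 3, R, _ => exact Empty.elim R
  | imp φ₁ φ₂ h₁ h₂ =>
    obtain ⟨ψ₁, h₁⟩ := h₁
    obtain ⟨ψ₂, h₂⟩ := h₂
    exact ⟨.imp ψ₁ ψ₂, fun V G c a => imp_congr (h₁ V G c a) (h₂ V G c a)⟩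
  | @all n φ h =>
    obtain ⟨ψ, h⟩ := h
    refine ⟨.imp (.ex (2 + n) (.imp ψ .fls)) .fls, fun V G c a => ?_⟩
    letI := colStruct G c
    have key : ∀ z : V, Sat G (fun i v => (c v).val = i) ψ (fun _ => Set.univ)
        (Function.update a (2 + n) z) ↔ φ.Realize (fun i : Fin 2 => a i.val)
          (Fin.snoc (fun j : Fin n => a (2 + j.val)) z) := by
      intro z
      rw [h]
      have e1 : (fun i : Fin 2 => Function.update a (2 + n) z i.val) = fun i => a i.val := by
        funext i
        exact Function.update_of_ne (by omega) _ _
      have e2 : (fun j : Fin (n + 1) => Function.update a (2 + n) z (2 + j.val)) =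
          (Fin.snoc (fun j : Fin n => a (2 + j.val)) z : Fin (n + 1) → V) := by
        funext j
        refine Fin.lastCases ?_ (fun j => ?_) j
        · simp
        · rw [Fin.snoc_castSucc]
          exact Function.update_of_ne (by simp; omega) _ _
      rw [e1, e2]
    rw [FirstOrder.Language.BoundedFormula.realize_all]
    constructor
    · intro H z
      by_contra hz
      exact H ⟨z, trivial, fun hs => hz ((key z).1 hs)⟩
    · rintro H ⟨z, -, hz⟩
      exact hz ((key z).2 (H z))

lemma fmTranslate2 {k : ℕ} (φ : (colLang k).Formula (Fin 2)) :
    ∃ ψ : Fm, ∀ (V : Type) (G : SimpleGraph V) (c : V → Fin k) (a : ℕ → V),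
      Sat G (fun i v => (c v).val = i) ψ (fun _ => Set.univ) a ↔
        colSat G c φ (a 0) (a 1) ∨ colSat G c φ (a 1) (a 0) := by
  obtain ⟨ψ₁, h₁⟩ := fmTranslate φ
  obtain ⟨ψ₂, h₂⟩ := fmTranslate (FirstOrder.Language.BoundedFormula.relabel
    (n := 0) (fun i : Fin 2 => (Sum.inl (![1, 0] i) : Fin 2 ⊕ Fin 0)) φ)
  refine ⟨.imp (.imp ψ₁ .fls) ψ₂, fun V G c a => ?_⟩
  letI := colStruct G c
  have e1 : Sat G (fun i v => (c v).val = i) ψ₁ (fun _ => Set.univ) a ↔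
      colSat G c φ (a 0) (a 1) := by
    rw [h₁]
    unfold colSat FirstOrder.Language.Formula.Realize
    have : (fun i : Fin 2 => a i.val) = ![a 0, a 1] := by
      funext i; fin_cases i <;> rfl
    rw [this]
    exact iff_of_eq (congrArg _ (Subsingleton.elim _ _))
  have e2 : Sat G (fun i v => (c v).val = i) ψ₂ (fun _ => Set.univ) a ↔
      colSat G c φ (a 1) (a 0) := by
    rw [h₂]
    unfold colSat FirstOrder.Language.Formula.Realize
    rw [FirstOrder.Language.BoundedFormula.realize_relabel]
    have : (Sum.elim (fun i : Fin 2 => a i.val)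
        ((fun j : Fin (0 + 0) => a (2 + j.val)) ∘ Fin.castAdd 0) ∘
        (fun i : Fin 2 => (Sum.inl (![1, 0] i) : Fin 2 ⊕ Fin 0))) = ![a 1, a 0] := by
      funext i; fin_cases i <;> rfl
    rw [this]
    exact iff_of_eq (congrArg _ (Subsingleton.elim _ _))
  rw [← e1, ← e2]
  change ((_ → False) → _) ↔ _
  tauto

lemma final_contra {C : GraphClass} (hT : ∀ φ, Tame C φ) : MonadicallyDependent C := by
  classical
  rintro ⟨k, φ, H⟩
  obtain ⟨ψ, hψ⟩ := fmTranslate2 φ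
  obtain ⟨K, hK⟩ := hT ψ {0, 1}
  have hK := hK {0} {1} (by simp) (by simp) (by simp)
  let E := Fintype.equivFin (Fin K ⊕ (Fin K → Bool))
  let B : SimpleGraph (Fin K ⊕ (Fin K → Bool)) :=
    SimpleGraph.fromRel fun x y => ∃ j S, x = Sum.inl j ∧ y = Sum.inr S ∧ S j = true
  obtain ⟨N, G, hG, c, e, he, h⟩ := H _ (B.comap E.symm)
  refine hK N G hG (fun i v => (c v).val = i) (fun _ => Set.univ)
    (fun _ => e (E (Sum.inr fun _ => false))) (fun j _ => e (E (Sum.inl j)))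
    (fun S _ => e (E (Sum.inr S))) fun S j => ?_
  rw [hψ]
  have h1 := h (E (Sum.inr S)) (E (Sum.inl j))
  have hne : e (E (Sum.inr S)) ≠ e (E (Sum.inl j)) := fun hh => by
    have := E.injective (he hh)
    simp at this
  have h2 : (B.comap E.symm).Adj (E (Sum.inr S)) (E (Sum.inl j)) ↔ S j = true := by
    simp [B, SimpleGraph.fromRel_adj]
  rw [h2] at h1
  rw [h1]
  simp [mix, hne]

/-- Let `C` be a hereditary class of finite graphs of almost bounded
twin-width: for every real `ε > 0` there is a constant `c` such that every `n`-vertex graph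
in `C` has twin-width at most `c · n^ε`.  Then `C` is monadically dependent. -/
theorem almostBoundedTwinWidth_monadicallyDependent (C : GraphClass)
    (hHer : Hereditary C)
    (habt : ∀ ε : ℝ, 0 < ε → ∃ c : ℝ,
      ∀ (n : ℕ) (G : SimpleGraph (Fin n)), C n G →
        ∃ d : ℕ, TwwLE G d ∧ (d : ℝ) ≤ c * (n : ℝ) ^ ε) :
    MonadicallyDependent C := by
  exact final_contra fun φ => (tame_all hHer habt φ).1
end

section
/- Let C be a hereditary class of finite graphs, closed under isomorphism, that is small: there is a constant c such that for every n ∈ ℕ, the number of graphs in C with vertex set {1,…,n} is at most n!·c^n. Then C is monadically dependent. -/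
set_option autoImplicit false

open FirstOrder

def levSetoid {V : Type} (G : SimpleGraph V) (U : Ultrafilter V) (Lk : V → Set V) : Setoid V where
  r v w := ∀ᶠ a in (U : Filter V), ∀ x ∈ Lk a, (G.Adj v x ↔ G.Adj w x)
  iseqv :=
    { refl := fun v => Filter.Eventually.of_forall (fun a x _ => Iff.rfl)
      symm := fun h => h.mono (fun a ha x hx => (ha x hx).symm)
      trans := fun h h' => by
        filter_upwards [h, h'] with a ha ha' x hx
        exact (ha x hx).trans (ha' x hx) }

noncomputable def repOf {V : Type} (G : SimpleGraph V) (U : Ultrafilter V) (Lk : V → Set V)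
    (v : V) : V := (Quotient.mk (levSetoid G U Lk) v).out

noncomputable def Lev {V : Type} (G : SimpleGraph V) (U : Ultrafilter V) : ℕ → V → Set V
  | 0 => fun a => {a}
  | k + 1 => fun a => Lev G U k a ∪
      {v | ∃ x ∈ Lev G U k a, ¬ (G.Adj v x ↔ G.Adj (repOf G U (Lev G U k) v) x)}

noncomputable def rep {V : Type} (G : SimpleGraph V) (U : Ultrafilter V) (k : ℕ) (v : V) : V :=
  repOf G U (Lev G U k) v

theorem rep_spec {V : Type} (G : SimpleGraph V) (U : Ultrafilter V) (k : ℕ) (v : V) :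
    ∀ᶠ a in (U : Filter V), ∀ x ∈ Lev G U k a, (G.Adj v x ↔ G.Adj (rep G U k v) x) := by
  have h : (levSetoid G U (Lev G U k)).r (rep G U k v) v :=
    @Quotient.mk_out _ (levSetoid G U (Lev G U k)) v
  exact (levSetoid G U (Lev G U k)).iseqv.symm h

theorem mem_Lev_succ {V : Type} (G : SimpleGraph V) (U : Ultrafilter V) (k : ℕ) (a v : V) :
    v ∈ Lev G U (k+1) a ↔ v ∈ Lev G U k a ∨
      ∃ x ∈ Lev G U k a, ¬ (G.Adj v x ↔ G.Adj (rep G U k v) x) := Iff.rfl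

theorem Lev_avoid {V : Type} (G : SimpleGraph V) (U : Ultrafilter V)
    (hU : ∀ x, ∀ᶠ a in (U : Filter V), a ≠ x) (k : ℕ) (v : V) :
    ∀ᶠ a in (U : Filter V), v ∉ Lev G U k a := by
  induction k with
  | zero =>
    filter_upwards [hU v] with a ha h
    exact ha (Set.mem_singleton_iff.1 h).symm
  | succ k ih =>
    filter_upwards [ih, rep_spec G U k v] with a h1 h2 h
    rcases (mem_Lev_succ G U k a v).1 h with h | ⟨x, hx, h⟩
    · exact h1 h
    · exact h (h2 x hx)

theorem Lev_path {V : Type} (G : SimpleGraph V) (U : Ultrafilter V) (k : ℕ) (a x : V)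
    (hx : x ∈ Lev G U k a) : ∃ y : ℕ → V, y 0 = a ∧ y k = x ∧
      (∀ j ≤ k, y j ∈ Lev G U j a) ∧
      ∀ j < k, y (j+1) = y j ∨ ¬ (G.Adj (y (j+1)) (y j) ↔ G.Adj (rep G U j (y (j+1))) (y j)) := by
  induction k generalizing x with
  | zero =>
    exact ⟨fun _ => a, rfl, (Set.mem_singleton_iff.1 hx).symm,
      fun j hj => by obtain rfl : j = 0 := by omega
                     exact rfl, fun j hj => by omega⟩
  | succ k ih =>
    have key : ∀ x' ∈ Lev G U k a, (x = x' ∨ ¬ (G.Adj x x' ↔ G.Adj (rep G U k x) x')) →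
      ∃ y : ℕ → V, y 0 = a ∧ y (k+1) = x ∧
      (∀ j ≤ k+1, y j ∈ Lev G U j a) ∧
      ∀ j < k+1, y (j+1) = y j ∨
        ¬ (G.Adj (y (j+1)) (y j) ↔ G.Adj (rep G U j (y (j+1))) (y j)) := by
      intro x' hx' h
      obtain ⟨y, h0, hk, hm, hs⟩ := ih x' hx'
      refine ⟨fun j => if j ≤ k then y j else x, by simp [h0], by simp, ?_, ?_⟩
      · intro j hj
        by_cases h1 : j ≤ k
        · simpa [h1] using hm j h1
        · obtain rfl : j = k+1 := by omega
          simpa using hx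
      · intro j hj
        by_cases h1 : j < k
        · have e1 : j ≤ k := by omega
          have e2 : j + 1 ≤ k := by omega
          simpa [e1, e2] using hs j h1
        · obtain rfl : j = k := by omega
          simpa [hk] using h
    rcases (mem_Lev_succ G U k a x).1 hx with h | ⟨x', hx', h⟩
    · exact key x h (Or.inl rfl)
    · exact key x' hx' (Or.inr h)

theorem tri_sep {V : Type} (R : V → V → Prop) (X : Set V) (p : ℕ) : ∀ (S : Finset V),
    2 ^ p ≤ S.card → (∀ u ∈ S, ∀ v ∈ S, u ≠ v → ∃ x ∈ X, ¬ (R u x ↔ R v x)) →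
    ∃ w : Fin (p+1) → V, (∀ i, w i ∈ S) ∧ ∃ x : Fin p → V, (∀ i, x i ∈ X) ∧
      ∀ (i : Fin p) (j : Fin (p+1)), i.castSucc < j → (R (w j) (x i) ↔ ¬ R (w i.castSucc) (x i)) := by
  classical
  induction p with
  | zero =>
    intro S hS _
    obtain ⟨u, hu⟩ : S.Nonempty := Finset.card_pos.1 (by simpa using hS)
    exact ⟨fun _ => u, fun _ => hu, Fin.elim0, fun i => i.elim0, fun i => i.elim0⟩
  | succ p ih =>
    intro S hS hsep
    have h2 : 1 < S.card := by
      have : 2 ≤ 2 ^ (p+1) := by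
        rw [pow_succ]; have := Nat.one_le_two_pow (n := p); omega
      omega
    obtain ⟨u, hu, v, hv, huv⟩ := Finset.one_lt_card.1 h2
    obtain ⟨x, hx, hxs⟩ := hsep u hu v hv huv
    have main : ∀ (b : Prop) , 2 ^ p ≤ (S.filter (fun z => (R z x ↔ b))).card →
        ∃ w : Fin (p+1+1) → V, (∀ i, w i ∈ S) ∧ ∃ x : Fin (p+1) → V, (∀ i, x i ∈ X) ∧
      ∀ (i : Fin (p+1)) (j : Fin (p+1+1)), i.castSucc < j →
        (R (w j) (x i) ↔ ¬ R (w i.castSucc) (x i)) := by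
      intro b hb
      obtain ⟨w, hw, xx, hxx, hr⟩ := ih _ hb (fun u hu v hv => hsep u (Finset.mem_filter.1 hu).1 v
        (Finset.mem_filter.1 hv).1)
      obtain ⟨z, hz, hzb⟩ : ∃ z ∈ S, ¬ (R z x ↔ b) := by
        by_contra hcon
        push Not at hcon
        exact hxs ((hcon u hu).trans (hcon v hv).symm)
      refine ⟨Fin.cons z w, ?_, Fin.cons x xx, ?_, ?_⟩
      · intro i
        refine Fin.cases ?_ (fun i => ?_) i
        · simpa using hz
        · simpa using (Finset.mem_filter.1 (hw i)).1
      · intro i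
        refine Fin.cases ?_ (fun i => ?_) i
        · simpa using hx
        · simpa using hxx i
      · intro i j hij
        obtain ⟨j, rfl⟩ : ∃ j', j = Fin.succ j' :=
          ⟨j.pred (Fin.ne_zero_of_lt hij), by simp⟩
        revert hij
        refine Fin.cases ?_ (fun i => ?_) i
        · intro _
          have := (Finset.mem_filter.1 (hw j)).2
          simp only [Fin.cons_succ, Fin.cons_zero, Fin.castSucc_zero]
          tauto
        · intro hij
          have := hr i j (by simpa [Fin.lt_def] using hij)
          simpa [← Fin.succ_castSucc] using this
    have hsum := Finset.card_filter_add_card_filter_not (s := S) (fun z => R z x)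
    by_cases hb : 2 ^ p ≤ (S.filter (fun z => R z x)).card
    · exact main True (by simpa using hb)
    · refine main False ?_
      have : 2 ^ (p+1) = 2 * 2 ^ p := by ring
      simp only [iff_false]
      omega

theorem tri_traces {V : Type} (R : V → V → Prop) (p : ℕ) (w : Fin (p+1) → V) (x : Fin p → V)
    (h : ∀ (i : Fin p) (j : Fin (p+1)), i.castSucc < j →
      (R (w j) (x i) ↔ ¬ R (w i.castSucc) (x i))) :
    ∀ i i' : Fin p, (∀ l, (R (w l) (x i) ↔ R (w l) (x i'))) → i = i' := by
  have key : ∀ i i' : Fin p, i < i' → ¬ (∀ l, (R (w l) (x i) ↔ R (w l) (x i'))) := by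
    intro i i' hii hl
    have h1 := h i i'.castSucc (by simpa using hii)
    have h2 := h i (Fin.last p) (Fin.castSucc_lt_last _)
    have h3 := h i' (Fin.last p) (Fin.castSucc_lt_last _)
    have h4 := hl i'.castSucc
    have h5 := hl (Fin.last p)
    tauto
  intro i i' hl
  rcases lt_trichotomy i i' with h1 | h1 | h1
  · exact absurd hl (key i i' h1)
  · exact h1
  · exact absurd (fun l => (hl l).symm) (key i' i h1)

theorem extract {V : Type} (G : SimpleGraph V) (U : Ultrafilter V)
    (hU : ∀ x, ∀ᶠ a in (U : Filter V), a ≠ x) (k : ℕ)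
    (hinf : (Set.range (rep G U k)).Infinite) (n : ℕ) :
    ∃ (w : Fin (n+1) → V) (a : ℕ → V) (y : ℕ → Fin n → ℕ → V),
      (∀ c t, y c t 0 = a c) ∧
      (∀ c t j, j ≤ k → y c t j ∈ Lev G U j (a c)) ∧
      (∀ c t j, j < k → y c t (j+1) = y c t j ∨
        ¬ (G.Adj (y c t (j+1)) (y c t j) ↔ G.Adj (rep G U j (y c t (j+1))) (y c t j))) ∧
      (∀ c t t', (∀ l, (G.Adj (w l) (y c t k) ↔ G.Adj (w l) (y c t' k))) → t = t') ∧
      (∀ c c', c < c' → ∀ t j, j ≤ k → y c t j ∉ Lev G U j (a c')) := by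
  classical
  obtain ⟨S, hS, hcard⟩ := hinf.exists_subset_card_eq (2 ^ n)
  have hsep : ∀ u ∈ S, ∀ v ∈ S, ∀ᶠ a in (U : Filter V), u ≠ v →
      ∃ x ∈ Lev G U k a, ¬ (G.Adj u x ↔ G.Adj v x) := by
    intro u hu v hv
    by_cases huv : u = v
    · exact Filter.Eventually.of_forall (fun a h => absurd huv h)
    obtain ⟨u', rfl⟩ := hS hu
    obtain ⟨v', rfl⟩ := hS hv
    have : ¬ ∀ᶠ a in (U : Filter V), ∀ x ∈ Lev G U k a,
        (G.Adj (rep G U k u') x ↔ G.Adj (rep G U k v') x) := by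
      intro h
      apply huv
      have h2 : (Quotient.mk (levSetoid G U (Lev G U k)) u') =
          (Quotient.mk (levSetoid G U (Lev G U k)) v') :=
        (@Quotient.out_equiv_out _ (levSetoid G U (Lev G U k)) _ _).1 h
      unfold rep repOf
      rw [h2]
    rw [← Ultrafilter.eventually_not] at this
    filter_upwards [this] with a ha _
    push Not at ha
    obtain ⟨x, hx, h⟩ := ha
    exact ⟨x, hx, by tauto⟩
  have hsep2 : ∀ᶠ a in (U : Filter V), ∀ u ∈ S, ∀ v ∈ S, u ≠ v →
      ∃ x ∈ Lev G U k a, ¬ (G.Adj u x ↔ G.Adj v x) := by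
    rw [Filter.eventually_all_finset]
    intro u hu
    rw [Filter.eventually_all_finset]
    exact fun v hv => hsep u hu v hv
  have hex : ∃ w : Fin (n+1) → S, ∀ᶠ a in (U : Filter V), ∃ x : Fin n → V,
      (∀ i, x i ∈ Lev G U k a) ∧
      ∀ t t', (∀ l, (G.Adj (w l) (x t) ↔ G.Adj (w l) (x t'))) → t = t' := by
    by_contra hcon
    have h1 : ∀ w : Fin (n+1) → S, ∀ᶠ a in (U : Filter V), ¬ ∃ x : Fin n → V,
      (∀ i, x i ∈ Lev G U k a) ∧
      ∀ t t', (∀ l, (G.Adj (w l) (x t) ↔ G.Adj (w l) (x t'))) → t = t' := by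
      intro w
      rw [Ultrafilter.eventually_not]
      exact fun h => hcon ⟨w, h⟩
    rw [← Filter.eventually_all] at h1
    obtain ⟨a, ha1, ha2⟩ := (h1.and hsep2).exists
    obtain ⟨w, hw, x, hx, h⟩ := tri_sep G.Adj (Lev G U k a) n S hcard.ge ha2
    exact ha1 (fun i => ⟨w i, hw i⟩) ⟨x, hx, tri_traces G.Adj n w x h⟩
  obtain ⟨w, hw⟩ := hex
  let P : V × (Fin n → ℕ → V) → Prop := fun q =>
      (∀ t, q.2 t 0 = q.1) ∧
      (∀ t j, j ≤ k → q.2 t j ∈ Lev G U j q.1) ∧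
      (∀ t j, j < k → q.2 t (j+1) = q.2 t j ∨
        ¬ (G.Adj (q.2 t (j+1)) (q.2 t j) ↔ G.Adj (rep G U j (q.2 t (j+1))) (q.2 t j))) ∧
      (∀ t t', (∀ l, (G.Adj (w l) (q.2 t k) ↔ G.Adj (w l) (q.2 t' k))) → t = t')
  obtain ⟨f, hf1, hf2⟩ := exists_seq_of_forall_finset_exists P
    (fun q q' => ∀ t j, j ≤ k → q.2 t j ∉ Lev G U j q'.1) (by
      intro s _
      have h1 : ∀ᶠ a in (U : Filter V), ∀ q ∈ s, ∀ t, ∀ j : Fin (k+1), q.2 t j ∉ Lev G U j a := by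
        rw [Filter.eventually_all_finset]
        intro q _
        rw [Filter.eventually_all]
        intro t
        rw [Filter.eventually_all]
        intro j
        exact Lev_avoid G U hU j _
      obtain ⟨a, ha1, x, hx, htr⟩ := (h1.and hw).exists
      choose y hy0 hyk hym hys using fun t => Lev_path G U k a (x t) (hx t)
      refine ⟨(a, y), ⟨hy0, hym, hys, ?_⟩, ?_⟩
      · intro t t' h
        simp only [hyk] at h
        exact htr t t' h
      · intro q hq t j hj
        exact ha1 q hq t ⟨j, by omega⟩)
  exact ⟨fun l => w l, fun c => (f c).1, fun c => (f c).2, fun c => (hf1 c).1,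
    fun c => (hf1 c).2.1, fun c => (hf1 c).2.2.1, fun c => (hf1 c).2.2.2,
    fun c c' h => hf2 c c' h⟩

structure ArrData {V : Type} (G : SimpleGraph V) (k n : ℕ) where
  S : Finset V
  rho : ℕ → V → V
  L : ℕ → V → Set V
  w : Fin (n+1) → V
  a : Fin n → V
  y : Fin n → Fin n → ℕ → V
  rho_mem : ∀ j < k, ∀ v, rho j v ∈ S
  L_zero : ∀ b, L 0 b = {b}
  L_succ : ∀ j b v, v ∈ L (j+1) b ↔ v ∈ L j b ∨
      ∃ x ∈ L j b, ¬ (G.Adj v x ↔ G.Adj (rho j v) x)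
  y_zero : ∀ c t, y c t 0 = a c
  y_step : ∀ c t j, j < k → y c t (j+1) = y c t j ∨
        ¬ (G.Adj (y c t (j+1)) (y c t j) ↔ G.Adj (rho j (y c t (j+1))) (y c t j))
  y_trace : ∀ c t t', (∀ l, (G.Adj (w l) (y c t k) ↔ G.Adj (w l) (y c t' k))) → t = t'
  y_avoid : ∀ c c', c < c' → ∀ t j, j ≤ k → y c t j ∉ L j (a c')

namespace ArrData

/-- vertex set for a choice function -/
noncomputable def VV {V : Type} {G : SimpleGraph V} {k n : ℕ} (D : ArrData G k n)
    (f : Fin n × Fin 3 → Fin n) : Finset V := by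
  classical
  exact (Finset.univ.image D.w ∪ Finset.univ.image D.a) ∪ (D.S ∪
    Finset.univ.image (fun q : (Fin n × Fin 3) × Fin (k+1) => D.y q.1.1 (f q.1) q.2))

theorem mem_VV {V : Type} {G : SimpleGraph V} {k n : ℕ} (D : ArrData G k n)
    (f : Fin n × Fin 3 → Fin n) (v : V) : v ∈ D.VV f ↔ ((∃ l, D.w l = v) ∨ (∃ c, D.a c = v)) ∨
      (v ∈ D.S ∨ ∃ q : (Fin n × Fin 3) × Fin (k+1), D.y q.1.1 (f q.1) q.2 = v) := by
  classical
  simp only [VV, Finset.mem_union, Finset.mem_image, Finset.mem_univ, true_and]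

theorem card_VV {V : Type} {G : SimpleGraph V} {k n : ℕ} (D : ArrData G k n)
    (f : Fin n × Fin 3 → Fin n) :
    (D.VV f).card ≤ ((n+1) + n) + (D.S.card + n * 3 * (k+1)) := by
  classical
  unfold VV
  refine (Finset.card_union_le _ _).trans (add_le_add ?_ ?_)
  · refine (Finset.card_union_le _ _).trans (add_le_add ?_ ?_)
    · exact Finset.card_image_le.trans (by simp)
    · exact Finset.card_image_le.trans (by simp)
  · refine (Finset.card_union_le _ _).trans (add_le_add le_rfl ?_)
    exact Finset.card_image_le.trans (by simp)

abbrev Col {V : Type} {G : SimpleGraph V} {k n : ℕ} (D : ArrData G k n) : Type :=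
  (Fin k → D.S) × (Fin 3 × Fin (k+1) → Bool)

abbrev Lam {V : Type} {G : SimpleGraph V} {k n : ℕ} (D : ArrData G k n) : Type :=
  (Fin (n+1) ⊕ Fin n) ⊕ D.S

structure Enc {V : Type} {G : SimpleGraph V} {k n : ℕ} (D : ArrData G k n) {N : ℕ}
    (f : Fin n × Fin 3 → Fin n) (g : Fin N → V) (H : SimpleGraph (Fin N))
    (col : Fin N → D.Col) (lam : D.Lam → Fin N) : Prop where
  inj : Function.Injective g
  surj : ∀ v, v ∈ D.VV f ↔ ∃ z, g z = v
  adj : ∀ z z', H.Adj z z' ↔ G.Adj (g z) (g z')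
  col1 : ∀ z j, ((col z).1 j : V) = D.rho j (g z)
  col2 : ∀ z d j, (col z).2 (d, j) = true ↔ ∃ c, g z = D.y c (f (c, d)) j
  lamw : ∀ l, g (lam (Sum.inl (Sum.inl l))) = D.w l
  lama : ∀ l, g (lam (Sum.inl (Sum.inr l))) = D.a l
  lams : ∀ s : D.S, g (lam (Sum.inr s)) = s

def LH {W : Type} (H : SimpleGraph W) (r : ℕ → W → W) : ℕ → W → Set W
  | 0 => fun b => {b}
  | j + 1 => fun b => LH H r j b ∪ {z | ∃ x ∈ LH H r j b, ¬ (H.Adj z x ↔ H.Adj (r j z) x)}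

def rr {V : Type} {G : SimpleGraph V} {k n : ℕ} (D : ArrData G k n) {N : ℕ}
    (col : Fin N → D.Col) (lam : D.Lam → Fin N) (j : ℕ) (z : Fin N) : Fin N :=
  if h : j < k then lam (Sum.inr ((col z).1 ⟨j, h⟩)) else z

theorem g_rr {V : Type} {G : SimpleGraph V} {k n : ℕ} {D : ArrData G k n} {N : ℕ}
    {f : Fin n × Fin 3 → Fin n} {g : Fin N → V} {H : SimpleGraph (Fin N)}
    {col : Fin N → D.Col} {lam : D.Lam → Fin N} (E : D.Enc f g H col lam)
    (j : ℕ) (hj : j < k) (z : Fin N) : g (D.rr col lam j z) = D.rho j (g z) := by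
  unfold rr
  rw [dif_pos hj, E.lams, E.col1]

theorem sound {V : Type} {G : SimpleGraph V} {k n : ℕ} {D : ArrData G k n} {N : ℕ}
    {f : Fin n × Fin 3 → Fin n} {g : Fin N → V} {H : SimpleGraph (Fin N)}
    {col : Fin N → D.Col} {lam : D.Lam → Fin N} (E : D.Enc f g H col lam)
    (c : Fin n) (j : ℕ) (hj : j ≤ k) (z : Fin N)
    (hz : z ∈ LH H (D.rr col lam) j (lam (Sum.inl (Sum.inr c)))) : g z ∈ D.L j (D.a c) := by
  induction j generalizing z with
  | zero =>
    obtain rfl : z = _ := hz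
    rw [D.L_zero, E.lama]; rfl
  | succ j ih =>
    rw [D.L_succ]
    rcases hz with hz | ⟨x, hx, h⟩
    · exact Or.inl (ih (by omega) z hz)
    · refine Or.inr ⟨g x, ih (by omega) x hx, ?_⟩
      rw [E.adj, E.adj, g_rr E j (by omega)] at h
      exact h

theorem complete {V : Type} {G : SimpleGraph V} {k n : ℕ} {D : ArrData G k n} {N : ℕ}
    {f : Fin n × Fin 3 → Fin n} {g : Fin N → V} {H : SimpleGraph (Fin N)}
    {col : Fin N → D.Col} {lam : D.Lam → Fin N} (E : D.Enc f g H col lam)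
    (c : Fin n) (d : Fin 3) (j : ℕ) (hj : j ≤ k) (z : Fin N)
    (hz : g z = D.y c (f (c, d)) j) : z ∈ LH H (D.rr col lam) j (lam (Sum.inl (Sum.inr c))) := by
  induction j generalizing z with
  | zero =>
    rw [D.y_zero, ← E.lama] at hz
    exact E.inj hz
  | succ j ih =>
    rcases D.y_step c (f (c, d)) j (by omega) with h | h
    · exact Or.inl (ih (by omega) z (hz.trans h))
    · obtain ⟨x, hx⟩ := (E.surj (D.y c (f (c, d)) j)).1
        ((D.mem_VV f _).2 (Or.inr (Or.inr ⟨((c, d), ⟨j, by omega⟩), rfl⟩)))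
      refine Or.inr ⟨x, ih (by omega) x hx, ?_⟩
      rw [E.adj, E.adj, g_rr E j (by omega), hx, hz]
      exact h

theorem ident {V : Type} {G : SimpleGraph V} {k n : ℕ} {D : ArrData G k n} {N : ℕ}
    {f : Fin n × Fin 3 → Fin n} {g : Fin N → V} {H : SimpleGraph (Fin N)}
    {col : Fin N → D.Col} {lam : D.Lam → Fin N} (E : D.Enc f g H col lam)
    (c : Fin n) (d : Fin 3) (j : Fin (k+1)) (z : Fin N) :
    g z = D.y c (f (c, d)) j ↔ ((col z).2 (d, j) = true ∧
      z ∈ LH H (D.rr col lam) j (lam (Sum.inl (Sum.inr c))) ∧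
      ∀ c', c < c' → z ∉ LH H (D.rr col lam) j (lam (Sum.inl (Sum.inr c')))) := by
  have hj : (j : ℕ) ≤ k := by omega
  have h1 : ∀ c, g z = D.y c (f (c, d)) j →
      ∀ c', c < c' → z ∉ LH H (D.rr col lam) j (lam (Sum.inl (Sum.inr c'))) := by
    intro c h c' hc hz
    have := sound E c' j hj z hz
    rw [h] at this
    exact D.y_avoid c c' hc _ j hj this
  constructor
  · intro h
    exact ⟨(E.col2 z d j).2 ⟨c, h⟩, complete E c d j hj z h, h1 c h⟩
  · rintro ⟨h, h2, h3⟩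
    obtain ⟨c0, h0⟩ := (E.col2 z d j).1 h
    have h4 := complete E c0 d j hj z h0
    have h5 := h1 c0 h0
    rcases lt_trichotomy c c0 with hc | hc | hc
    · exact absurd h4 (h3 c0 hc)
    · rw [hc]; exact h0
    · exact absurd h2 (h5 c hc)

theorem Enc_inj {V : Type} {G : SimpleGraph V} {k n : ℕ} {D : ArrData G k n} {N : ℕ}
    {f f' : Fin n × Fin 3 → Fin n} {g g' : Fin N → V} {H : SimpleGraph (Fin N)}
    {col : Fin N → D.Col} {lam : D.Lam → Fin N} (E : D.Enc f g H col lam)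
    (E' : D.Enc f' g' H col lam) : f = f' ∧ g = g' := by
  have hf : f = f' := by
    funext ⟨c, d⟩
    obtain ⟨z, hz⟩ := (E.surj (D.y c (f (c, d)) k)).1
        ((D.mem_VV f _).2 (Or.inr (Or.inr ⟨((c, d), ⟨k, by omega⟩), rfl⟩)))
    have hz' : g' z = D.y c (f' (c, d)) k :=
      (ident E' c d ⟨k, by omega⟩ z).2 ((ident E c d ⟨k, by omega⟩ z).1 hz)
    apply D.y_trace c
    intro l
    rw [← hz, ← hz', ← E.lamw, ← E.adj, E.lamw, ← E'.lamw, ← E'.adj]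
  refine ⟨hf, ?_⟩
  subst hf
  funext z
  rcases (D.mem_VV f _).1 ((E.surj (g z)).2 ⟨z, rfl⟩) with (⟨l, h⟩ | ⟨c, h⟩) | (h | ⟨⟨⟨c, d⟩, j⟩, h⟩)
  · have : z = _ := E.inj (h.symm.trans (E.lamw l).symm)
    rw [← h, this, E'.lamw]
  · have : z = _ := E.inj (h.symm.trans (E.lama c).symm)
    rw [← h, this, E'.lama]
  · have : z = _ := E.inj (E.lams ⟨g z, h⟩).symm
    have h2 := E'.lams ⟨g z, h⟩
    rw [← this] at h2
    exact h2.symm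
  · rw [← h]
    exact ((ident E' c d j z).2 ((ident E c d j z).1 h.symm)).symm

theorem Enc_exists {V : Type} {G : SimpleGraph V} {k n : ℕ} (D : ArrData G k n) {N : ℕ}
    (f : Fin n × Fin 3 → Fin n) (g : Fin N → V) (hg : Function.Injective g)
    (hs : ∀ v, v ∈ D.VV f ↔ ∃ z, g z = v) : ∃ col lam, D.Enc f g (G.comap g) col lam := by
  classical
  have hw : ∀ l, ∃ z, g z = D.w l := fun l => (hs _).1 ((D.mem_VV f _).2 (Or.inl (Or.inl ⟨l, rfl⟩)))
  have ha : ∀ l, ∃ z, g z = D.a l := fun l => (hs _).1 ((D.mem_VV f _).2 (Or.inl (Or.inr ⟨l, rfl⟩)))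
  have hss : ∀ s : D.S, ∃ z, g z = s := fun s => (hs _).1 ((D.mem_VV f _).2 (Or.inr (Or.inl s.2)))
  choose lw hlw using hw
  choose la hla using ha
  choose ls hls using hss
  exact ⟨fun z => (fun j => ⟨D.rho j (g z), D.rho_mem j j.2 _⟩,
    fun q => decide (∃ c, g z = D.y c (f (c, q.1)) q.2)), Sum.elim (Sum.elim lw la) ls,
    { inj := hg
      surj := hs
      adj := fun z z' => Iff.rfl
      col1 := fun z j => rfl
      col2 := fun z d j => by simp
      lamw := hlw
      lama := hla
      lams := hls }⟩

theorem count_aux {V : Type} {G : SimpleGraph V} {k n : ℕ} (D : ArrData G k n) (N : ℕ) :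
    ∃ g : {f // (D.VV f).card = N} × Equiv.Perm (Fin N) → Fin N → V,
      (∀ q, Function.Injective (g q)) ∧ (∀ q v, v ∈ D.VV q.1.1 ↔ ∃ z, g q z = v) ∧
      (∀ f p p', g (f, p) = g (f, p') → p = p') := by
  classical
  have he : ∀ f : {f // (D.VV f).card = N}, Nonempty (Fin N ≃ D.VV f.1) := fun f =>
    ⟨((D.VV f.1).equivFinOfCardEq f.2).symm⟩
  let e : ∀ f : {f // (D.VV f).card = N}, (Fin N ≃ D.VV f.1) := fun f => (he f).some
  let g : {f // (D.VV f).card = N} × Equiv.Perm (Fin N) → Fin N → V := fun q z => (e q.1 (q.2 z) : V)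
  have hg : ∀ q, Function.Injective (g q) := fun q z z' h =>
    q.2.injective ((e q.1).injective (Subtype.ext h))
  have hs : ∀ q v, v ∈ D.VV q.1.1 ↔ ∃ z, g q z = v := by
    intro q v
    constructor
    · intro hv
      exact ⟨q.2.symm ((e q.1).symm ⟨v, hv⟩), by simp [g]⟩
    · rintro ⟨z, rfl⟩
      exact (e q.1 (q.2 z)).2
  refine ⟨g, hg, hs, fun f p p' h => ?_⟩
  ext1 z
  exact (e f).injective (Subtype.ext (congrFun h z))

/-- counting for a fixed number of vertices -/
theorem count_fixed {V : Type} {G : SimpleGraph V} {k n : ℕ} (D : ArrData G k n)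
    (C : ∀ n : ℕ, SimpleGraph (Fin n) → Prop)
    (hAge : ∀ (N : ℕ) (g : Fin N → V), Function.Injective g → C N (G.comap g))
    (c : ℕ) (hc : ∀ n : ℕ, Set.ncard {G : SimpleGraph (Fin n) | C n G} ≤ Nat.factorial n * c ^ n)
    (N : ℕ) : Nat.card {f // (D.VV f).card = N} ≤
      c ^ N * (Nat.card D.Col) ^ N * N ^ (((n+1) + n) + D.S.card) := by
  classical
  obtain ⟨g, hg, hs, hpi⟩ : ∃ g : {f // (D.VV f).card = N} × Equiv.Perm (Fin N) → Fin N → V,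
      (∀ q, Function.Injective (g q)) ∧ (∀ q v, v ∈ D.VV q.1.1 ↔ ∃ z, g q z = v) ∧
      (∀ f p p', g (f, p) = g (f, p') → p = p') := by
    exact count_aux D N
  have hE : ∀ q, ∃ col lam, D.Enc q.1.1 (g q) (G.comap (g q)) col lam :=
    fun q => D.Enc_exists q.1.1 (g q) (hg q) (hs q)
  choose col lam E using hE
  let F : {f // (D.VV f).card = N} × Equiv.Perm (Fin N) →
      ({H : SimpleGraph (Fin N) | C N H}) × (Fin N → D.Col) × (D.Lam → Fin N) :=
    fun q => (⟨G.comap (g q), hAge N _ (hg q)⟩, col q, lam q)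
  have hF : Function.Injective F := by
    intro q q' h
    have h1 : G.comap (g q) = G.comap (g q') := congrArg (fun t => (t.1 : SimpleGraph (Fin N))) h
    have h2 : col q = col q' := congrArg (fun t => t.2.1) h
    have h3 : lam q = lam q' := congrArg (fun t => t.2.2) h
    have E1 := E q
    have E2 := E q'
    rw [h1, h2, h3] at E1
    obtain ⟨hf, hgg⟩ := Enc_inj E1 E2
    obtain ⟨f, p⟩ := q
    obtain ⟨f', p'⟩ := q'
    obtain rfl : f = f' := Subtype.ext hf
    have : p = p' := hpi f p p' hgg
    rw [this]
  have hcard := Nat.card_le_card_of_injective F hF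
  rw [Nat.card_prod, Nat.card_prod, Nat.card_prod, Nat.card_perm, Nat.card_fun, Nat.card_fun,
    Nat.card_fin] at hcard
  have hL : Nat.card D.Lam = ((n+1) + n) + D.S.card := by simp [Lam]
  rw [hL] at hcard
  have h2 : Nat.card ({H : SimpleGraph (Fin N) | C N H}) ≤ Nat.factorial N * c ^ N := hc N
  have h3 := hcard.trans (Nat.mul_le_mul_right _ h2)
  clear hcard h2 hL hF
  clear F E
  clear hs hg hpi
  generalize Nat.card {f // (D.VV f).card = N} = X at *
  generalize Nat.card D.Col ^ N = X2 at *
  generalize N ^ (((n+1) + n) + D.S.card) = X3 at *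
  generalize c ^ N = X4 at *
  refine le_of_mul_le_mul_left (a := Nat.factorial N) ?_ (Nat.factorial_pos N)
  have e1 : Nat.factorial N * (X4 * X2 * X3) = Nat.factorial N * X4 * (X2 * X3) := by ring
  rw [e1, mul_comm]
  exact h3

theorem count_total {V : Type} {G : SimpleGraph V} {k n : ℕ} (D : ArrData G k n)
    (C : ∀ n : ℕ, SimpleGraph (Fin n) → Prop)
    (hAge : ∀ (N : ℕ) (g : Fin N → V), Function.Injective g → C N (G.comap g))
    (c : ℕ) (hc : ∀ n : ℕ, Set.ncard {G : SimpleGraph (Fin n) | C n G} ≤ Nat.factorial n * c ^ n)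
    (Q B : ℕ) (hQ : c * Nat.card D.Col ≤ Q) (hQ1 : 1 ≤ Q)
    (hB : ((n+1) + n) + (D.S.card + n * 3 * (k+1)) ≤ B) :
    n ^ (n * 3) ≤ (B + 1) * (Q ^ B * B ^ (((n+1) + n) + D.S.card)) := by
  classical
  have h1 : (Finset.univ : Finset (Fin n × Fin 3 → Fin n)).card = n ^ (n * 3) := by
    simp
  rw [← h1, Finset.card_eq_sum_card_fiberwise (f := fun f => (D.VV f).card)
    (t := Finset.range (B+1)) (by
      intro f _
      simp only [Finset.coe_range, Set.mem_Iio]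
      have := D.card_VV f
      omega)]
  have h2 : ∀ N ∈ Finset.range (B+1), (Finset.univ.filter (fun f => (D.VV f).card = N)).card ≤
      Q ^ B * B ^ (((n+1) + n) + D.S.card) := by
    intro N hN
    have hN : N ≤ B := by simp at hN; omega
    have h3 := D.count_fixed C hAge c hc N
    rw [Nat.card_eq_fintype_card, Fintype.card_subtype] at h3
    refine h3.trans ?_
    rw [← mul_pow]
    gcongr
  calc _ ≤ _ := Finset.sum_le_card_nsmul _ _ _ h2
    _ = _ := by simp

end ArrData

theorem arith_aux (s Q b Z M n B : ℕ) (hQ : 1 ≤ Q) (hb1 : 1 ≤ b) (hZ : Z = Q ^ b * b ^ (4 + s))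
    (hM1 : 1 ≤ M) (hMZ : Z < M) (hMs : 2 * (2 + s) ≤ M) (hn : n = M * M) (hB : B + 1 ≤ b * n)
    (h : n ^ (n * 3) ≤ (B + 1) * (Q ^ B * B ^ (((n+1) + n) + s))) : False := by
  have hn1 : 1 ≤ n := by rw [hn]; exact Nat.mul_pos hM1 hM1
  have h3 : n ^ (n * 3) ≤ (b * n) * (Q ^ (b * n) * (b * n) ^ (((n+1) + n) + s)) := by
    refine h.trans ?_
    have hBb : B ≤ b * n := by omega
    refine Nat.mul_le_mul hB (Nat.mul_le_mul (Nat.pow_le_pow_right hQ hBb)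
      (Nat.pow_le_pow_left hBb _))
  have h4 : (b * n) * (Q ^ (b * n) * (b * n) ^ (((n+1) + n) + s)) =
      (Q ^ (b * n) * b ^ (2 * n + 2 + s)) * (n ^ (2 * n) * n ^ (2 + s)) := by
    rw [mul_pow]
    have e1 : b * b ^ (((n+1) + n) + s) = b ^ (2 * n + 2 + s) := by
      rw [← pow_succ']; congr 1; omega
    have e2 : n * n ^ (((n+1) + n) + s) = n ^ (2 * n) * n ^ (2 + s) := by
      rw [← pow_succ', ← pow_add]; congr 1; omega
    rw [← e1, ← e2]
    generalize Q ^ (b * n) = q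
    generalize b ^ (((n+1) + n) + s) = q2
    generalize n ^ (((n+1) + n) + s) = q3
    ring
  have h5 : Q ^ (b * n) * b ^ (2 * n + 2 + s) ≤ Z ^ n := by
    rw [hZ, mul_pow, ← pow_mul, ← pow_mul]
    refine Nat.mul_le_mul le_rfl (Nat.pow_le_pow_right hb1 ?_)
    nlinarith
  have h6 : n ^ (2 + s) ≤ M ^ n := by
    have : n ^ (2 + s) = M ^ (2 * (2 + s)) := by rw [hn, ← sq, ← pow_mul]
    rw [this]
    apply Nat.pow_le_pow_right hM1
    nlinarith
  have h7 : Z ^ n < M ^ n := Nat.pow_lt_pow_left hMZ (by omega)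
  have h8 : n ^ (n * 3) = n ^ (2 * n) * (M ^ n * M ^ n) := by
    have : M ^ n * M ^ n = n ^ n := by rw [← mul_pow, ← hn]
    rw [this, ← pow_add]; congr 1; omega
  have hp : 0 < n ^ (2 * n) := Nat.pow_pos hn1
  have hpM : 0 < M ^ n := Nat.pow_pos hM1
  rw [h4, h8] at h3
  clear h h4 h8
  generalize n ^ (2 * n) = A at *
  generalize M ^ n = A2 at *
  generalize Z ^ n = A3 at *
  generalize n ^ (2 + s) = A4 at *
  generalize Q ^ (b * n) * b ^ (2 * n + 2 + s) = A5 at *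
  have h9 : A5 * (A * A4) ≤ A3 * (A * A2) := Nat.mul_le_mul h5 (Nat.mul_le_mul le_rfl h6)
  have h10 : A3 * (A * A2) < A2 * (A * A2) := Nat.mul_lt_mul_of_pos_right h7 (Nat.mul_pos hp hpM)
  have h11 : A2 * (A * A2) = A * (A2 * A2) := by ring
  omega

theorem arith_contra (k s Q : ℕ) (hQ : 1 ≤ Q) : ∃ n : ℕ,
    ¬ (∀ B, ((n+1) + n) + (s + n * 3 * (k+1)) ≤ B →
      n ^ (n * 3) ≤ (B + 1) * (Q ^ B * B ^ (((n+1) + n) + s))) := by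
  obtain ⟨b, hb⟩ : ∃ b, b = 2 + 1 + s + 3 * (k+1) + 1 := ⟨_, rfl⟩
  obtain ⟨Z, hZ⟩ : ∃ Z, Z = Q ^ b * b ^ (4 + s) := ⟨_, rfl⟩
  obtain ⟨M, hM⟩ : ∃ M, M = Z + 5 + 2 * s := ⟨_, rfl⟩
  obtain ⟨n, hn⟩ : ∃ n, n = M * M := ⟨_, rfl⟩
  have hM1 : 1 ≤ M := by omega
  have hn1 : 1 ≤ n := by rw [hn]; exact Nat.mul_pos hM1 hM1
  refine ⟨n, fun h => ?_⟩
  refine arith_aux s Q b Z M n _ hQ (by omega) hZ hM1 (by omega) (by omega) hn ?_ (h _ le_rfl)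
  have h1 : s ≤ s * n := Nat.le_mul_of_pos_right _ hn1
  have e : b * n = 2 * n + n + s * n + n * 3 * (k+1) + n := by rw [hb]; ring
  rw [e]
  generalize n * 3 * (k+1) = t
  omega

theorem rep_finite {V : Type} (G : SimpleGraph V) (U : Ultrafilter V)
    (hU : ∀ x, ∀ᶠ a in (U : Filter V), a ≠ x)
    (C : ∀ n : ℕ, SimpleGraph (Fin n) → Prop)
    (hAge : ∀ (N : ℕ) (g : Fin N → V), Function.Injective g → C N (G.comap g))
    (c : ℕ) (hc : ∀ n : ℕ, Set.ncard {G : SimpleGraph (Fin n) | C n G} ≤ Nat.factorial n * c ^ n)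
    (k : ℕ) : (Set.range (rep G U k)).Finite := by
  classical
  induction k using Nat.strong_induction_on with
  | _ k ih =>
  by_contra hinf
  let S : Finset V := Finset.univ.biUnion (fun j : Fin k => (ih j j.2).toFinset)
  set K := Nat.card ((Fin k → S) × (Fin 3 × Fin (k+1) → Bool)) with hK
  obtain ⟨n, hn⟩ := arith_contra k S.card (c * K + 1) (by omega)
  apply hn
  intro B hB
  obtain ⟨w, a, y, h0, hm, hs, ht, ha⟩ := extract G U hU k hinf n
  let D : ArrData G k n :=
    { S := S
      rho := rep G U
      L := Lev G U
      w := w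
      a := fun i => a i
      y := fun i => y i
      rho_mem := by
        intro j hj v
        simp only [S, Finset.mem_biUnion, Finset.mem_univ, true_and, Set.Finite.mem_toFinset]
        exact ⟨⟨j, hj⟩, v, rfl⟩
      L_zero := fun b => rfl
      L_succ := fun j b v => mem_Lev_succ G U j b v
      y_zero := fun c t => h0 c t
      y_step := fun c t => hs c t
      y_trace := fun c t => ht c t
      y_avoid := fun c c' h => ha c c' h }
  exact D.count_total C hAge c hc (c * K + 1) B (Nat.le_succ _) (by omega) hB

/-- Filtrations of the vertex set compatible with the representatives. -/
def GoodFil {V : Type} (G : SimpleGraph V) (rp : ℕ → V → V) (L : ℕ → Set V) : Prop :=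
  Monotone L ∧ ∀ p u v, u ∈ L p → v ∉ L (p+1) → (G.Adj u v ↔ G.Adj u (rp p v))

/-- Separated evaluation of a predicate. -/
def FVP {V : Type} (G : SimpleGraph V) (rp : ℕ → V → V) {ι : Type} (P : (ι → V) → Prop)
    (r p : ℕ) (sd : ι → Bool) : Prop :=
  ∃ A B : Type, Finite A ∧ Finite B ∧ ∀ L, GoodFil G rp L →
    ∃ (f : (ι → V) → A) (g : (ι → V) → B) (T : A → B → Prop),
      (∀ s s', (∀ i, sd i = true → s i = s' i) → f s = f s') ∧
      (∀ s s', (∀ i, sd i = false → s i = s' i) → g s = g s') ∧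
      ∀ s, (∀ i, sd i = true → s i ∈ L p) → (∀ i, sd i = false → s i ∉ L (p + r)) →
        (P s ↔ T (f s) (g s))

theorem FVP.mono {V : Type} {G : SimpleGraph V} {rp : ℕ → V → V} {ι : Type} {P : (ι → V) → Prop}
    {r r' p : ℕ} {sd : ι → Bool} (h : FVP G rp P r p sd) (hr : r ≤ r') : FVP G rp P r' p sd := by
  obtain ⟨A, B, hA, hB, h⟩ := h
  refine ⟨A, B, hA, hB, fun L hL => ?_⟩
  obtain ⟨f, g, T, hf, hg, hT⟩ := h L hL
  exact ⟨f, g, T, hf, hg, fun s h1 h2 => hT s h1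
    (fun i hi hmem => h2 i hi (hL.1 (by omega) hmem))⟩

theorem FVP.of_left {V : Type} {G : SimpleGraph V} {rp : ℕ → V → V} {ι : Type} {P : (ι → V) → Prop}
    {r p : ℕ} {sd : ι → Bool} (h : ∀ s s', (∀ i, sd i = true → s i = s' i) → (P s ↔ P s')) :
    FVP G rp P r p sd :=
  ⟨Prop, Unit, inferInstance, inferInstance, fun _ _ => ⟨P, fun _ => (), fun a _ => a,
    fun s s' hs => propext (h s s' hs), fun _ _ _ => rfl, fun _ _ _ => Iff.rfl⟩⟩

theorem FVP.of_right {V : Type} {G : SimpleGraph V} {rp : ℕ → V → V} {ι : Type}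
    {P : (ι → V) → Prop}
    {r p : ℕ} {sd : ι → Bool} (h : ∀ s s', (∀ i, sd i = false → s i = s' i) → (P s ↔ P s')) :
    FVP G rp P r p sd :=
  ⟨Unit, Prop, inferInstance, inferInstance, fun _ _ => ⟨fun _ => (), P, fun _ a => a,
    fun _ _ _ => rfl, fun s s' hs => propext (h s s' hs), fun _ _ _ => Iff.rfl⟩⟩

theorem FVP.of_one {V : Type} {G : SimpleGraph V} {rp : ℕ → V → V} {ι : Type}
    {P : (ι → V) → Prop} {r p : ℕ} {sd : ι → Bool} (x : ι)
    (h : ∀ s s', s x = s' x → (P s ↔ P s')) : FVP G rp P r p sd := by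
  cases hx : sd x
  · exact FVP.of_right (fun s s' hs => h s s' (hs x hx))
  · exact FVP.of_left (fun s s' hs => h s s' (hs x hx))

theorem FVP.imp {V : Type} {G : SimpleGraph V} {rp : ℕ → V → V} {ι : Type}
    {P P' : (ι → V) → Prop} {r p : ℕ} {sd : ι → Bool} (h : FVP G rp P r p sd)
    (h' : FVP G rp P' r p sd) : FVP G rp (fun s => P s → P' s) r p sd := by
  obtain ⟨A, B, hA, hB, h⟩ := h
  obtain ⟨A', B', hA', hB', h'⟩ := h'
  refine ⟨A × A', B × B', inferInstance, inferInstance, fun L hL => ?_⟩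
  obtain ⟨f, g, T, hf, hg, hT⟩ := h L hL
  obtain ⟨f', g', T', hf', hg', hT'⟩ := h' L hL
  refine ⟨fun s => (f s, f' s), fun s => (g s, g' s), fun a b => T a.1 b.1 → T' a.2 b.2, ?_, ?_, ?_⟩
  · intro s s' hs
    exact Prod.ext (hf s s' hs) (hf' s s' hs)
  · intro s s' hs
    exact Prod.ext (hg s s' hs) (hg' s s' hs)
  · intro s h1 h2
    exact imp_congr (hT s h1 h2) (hT' s h1 h2)

def extA {X α : Type} {n : ℕ} (s : α ⊕ Fin n → X) (w : X) : α ⊕ Fin (n+1) → X :=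
  Sum.elim (s ∘ Sum.inl) (Fin.snoc (α := fun _ => X) (s ∘ Sum.inr) w)

theorem extA_forall {X Y α : Type} {n : ℕ} (Q : X → Y → Prop) (s : α ⊕ Fin n → X) (w : X)
    (s' : α ⊕ Fin n → Y) (w' : Y) (h : ∀ i, Q (s i) (s' i)) (hw : Q w w') :
    ∀ i, Q (extA s w i) (extA s' w' i) := by
  rintro (i | i)
  · exact h (Sum.inl i)
  · refine Fin.lastCases ?_ (fun i => ?_) i
    · simpa [extA] using hw
    · simpa [extA] using h (Sum.inr i)

theorem extA_agree {X α : Type} {n : ℕ} (sd : α ⊕ Fin n → Bool) (b e : Bool)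
    (s s' : α ⊕ Fin n → X) (w : X) (h : ∀ i, sd i = b → s i = s' i) :
    ∀ i, extA sd e i = b → extA s w i = extA s' w i := by
  rintro (i | i)
  · exact h (Sum.inl i)
  · refine Fin.lastCases ?_ (fun i => ?_) i
    · simp [extA]
    · simpa [extA] using h (Sum.inr i)

theorem FVP.all {V : Type} [Nonempty V] {G : SimpleGraph V} {rp : ℕ → V → V} {α : Type} {n : ℕ}
    {P : (α ⊕ Fin (n+1) → V) → Prop} {r p : ℕ} {sd : α ⊕ Fin n → Bool}
    (h : ∀ p sd, FVP G rp P r p sd) :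
    FVP G rp (fun s => ∀ w, P (extA s w)) (r + r) p sd := by
  obtain ⟨A, B, hA, hB, h1⟩ := h (p + r) (extA sd true)
  obtain ⟨A', B', hA', hB', h2⟩ := h p (extA sd false)
  refine ⟨Set A × A', B × Set B', inferInstance, inferInstance, fun L hL => ?_⟩
  obtain ⟨f, g, T, hf, hg, hT⟩ := h1 L hL
  obtain ⟨f', g', T', hf', hg', hT'⟩ := h2 L hL
  let d : V := Classical.arbitrary V
  refine ⟨fun s => ((fun w => f (extA s w)) '' L (p+r), f' (extA s d)),
    fun s => (g (extA s d), (fun w => g' (extA s w)) '' (L (p+r))ᶜ),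
    fun a b => (∀ x ∈ a.1, T x b.1) ∧ (∀ y ∈ b.2, T' a.2 y), ?_, ?_, ?_⟩
  · intro s s' hs
    have e1 : ∀ w, f (extA s w) = f (extA s' w) := fun w =>
      hf _ _ (extA_agree sd true true s s' w hs)
    have e2 : ∀ w, f' (extA s w) = f' (extA s' w) := fun w =>
      hf' _ _ (extA_agree sd true false s s' w hs)
    simp only [e1, e2]
  · intro s s' hs
    have e1 : ∀ w, g (extA s w) = g (extA s' w) := fun w =>
      hg _ _ (extA_agree sd false true s s' w hs)
    have e2 : ∀ w, g' (extA s w) = g' (extA s' w) := fun w =>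
      hg' _ _ (extA_agree sd false false s s' w hs)
    simp only [e1, e2]
  · intro s hs1 hs2
    have e1 : ∀ w ∈ L (p+r), (P (extA s w) ↔ T (f (extA s w)) (g (extA s d))) := by
      intro w hw
      rw [hT]
      · have : g (extA s w) = g (extA s d) := by
          apply hg
          rintro (i | i)
          · simp [extA]
          · refine Fin.lastCases ?_ (fun i => ?_) i
            · simp [extA]
            · simp [extA]
        rw [this]
      · exact extA_forall (fun (b : Bool) x => b = true → x ∈ L (p+r)) sd true s w
          (fun i hi => hL.1 (by omega) (hs1 i hi)) (fun _ => hw)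
      · exact extA_forall (fun (b : Bool) x => b = false → x ∉ L (p+r+r)) sd true s w
          (fun i hi => by rw [add_assoc]; exact hs2 i hi) (fun h => by simp at h)
    have e2 : ∀ w ∉ L (p+r), (P (extA s w) ↔ T' (f' (extA s d)) (g' (extA s w))) := by
      intro w hw
      rw [hT']
      · have : f' (extA s w) = f' (extA s d) := by
          apply hf'
          rintro (i | i)
          · simp [extA]
          · refine Fin.lastCases ?_ (fun i => ?_) i
            · simp [extA]
            · simp [extA]
        rw [this]
      · exact extA_forall (fun (b : Bool) x => b = true → x ∈ L p) sd false s w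
          (fun i hi => (hs1 i hi)) (fun h => by simp at h)
      · exact extA_forall (fun (b : Bool) x => b = false → x ∉ L (p+r)) sd false s w
          (fun i hi hm => hs2 i hi (hL.1 (by omega) hm)) (fun _ => hw)
    constructor
    · intro h
      refine ⟨?_, ?_⟩
      · rintro _ ⟨w, hw, rfl⟩
        exact (e1 w hw).1 (h w)
      · rintro _ ⟨w, hw, rfl⟩
        exact (e2 w hw).1 (h w)
    · rintro ⟨h1, h2⟩ w
      by_cases hw : w ∈ L (p+r)
      · exact (e1 w hw).2 (h1 _ ⟨w, hw, rfl⟩)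
      · exact (e2 w hw).2 (h2 _ ⟨w, hw, rfl⟩)

theorem FVP.eq {V : Type} {G : SimpleGraph V} {rp : ℕ → V → V} {ι : Type} (x y : ι)
    {p : ℕ} {sd : ι → Bool} : FVP G rp (fun s => s x = s y) 1 p sd := by
  have mixed : sd x ≠ sd y → FVP G rp (fun s => s x = s y) 1 p sd := by
    intro hne
    refine ⟨Unit, Unit, inferInstance, inferInstance, fun L hL => ⟨fun _ => (), fun _ => (),
      fun _ _ => False, fun _ _ _ => rfl, fun _ _ _ => rfl, fun s h1 h2 => ?_⟩⟩
    simp only [iff_false]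
    intro he
    cases hx : sd x
    · have hy : sd y = true := by cases h : sd y <;> simp_all
      exact h2 x hx (he ▸ hL.1 (by omega) (h1 y hy))
    · have hy : sd y = false := by cases h : sd y <;> simp_all
      exact h2 y hy (he ▸ hL.1 (by omega) (h1 x hx))
  by_cases hne : sd x = sd y
  · cases hx : sd x
    · exact FVP.of_right (fun s s' h => by
        show s x = s y ↔ s' x = s' y
        rw [h x hx, h y (hne ▸ hx)])
    · exact FVP.of_left (fun s s' h => by
        show s x = s y ↔ s' x = s' y
        rw [h x hx, h y (hne ▸ hx)])
  · exact mixed hne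

theorem FVP.adj {V : Type} {G : SimpleGraph V} {rp : ℕ → V → V} {ι : Type} (x y : ι)
    (hrp : ∀ p, (Set.range (rp p)).Finite)
    {p : ℕ} {sd : ι → Bool} : FVP G rp (fun s => G.Adj (s x) (s y)) 1 p sd := by
  have mixed : ∀ x y, sd x = true → sd y = false →
      FVP G rp (fun s => G.Adj (s x) (s y)) 1 p sd := by
    intro x y hx hy
    have := (hrp p).to_subtype
    refine ⟨Set.range (rp p) → Prop, Set.range (rp p), inferInstance, inferInstance,
      fun L hL => ⟨fun s t => G.Adj (s x) t, fun s => ⟨rp p (s y), s y, rfl⟩,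
      fun a b => a b, ?_, ?_, ?_⟩⟩
    · intro s s' h
      simp only [h x hx]
    · intro s s' h
      simp only [h y hy]
    · intro s h1 h2
      exact hL.2 p _ _ (h1 x hx) (h2 y hy)
  cases hx : sd x <;> cases hy : sd y
  · exact FVP.of_right (fun s s' h => by
        show G.Adj (s x) (s y) ↔ G.Adj (s' x) (s' y)
        rw [h x hx, h y hy])
  · have := mixed y x hy hx
    simpa only [G.adj_comm] using this
  · exact mixed x y hx hy
  · exact FVP.of_left (fun s s' h => by
        show G.Adj (s x) (s y) ↔ G.Adj (s' x) (s' y)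
        rw [h x hx, h y hy])

theorem term_var {K : ℕ} {β : Type} (t : (colLang K).Term β) : ∃ x, t = Language.Term.var x := by
  cases t with
  | var x => exact ⟨x, rfl⟩
  | func f ts => exact Empty.elim f

/-- The adjacency symbol. -/
def adjSym (K : ℕ) : (colLang K).Relations 2 := ()

theorem FV_main {V : Type} [Nonempty V] {K : ℕ} (inst : (colLang K).Structure V)
    (G : SimpleGraph V)
    (hadj : ∀ x : Fin 2 → V, inst.RelMap (adjSym K) x ↔ G.Adj (x 0) (x 1))
    (rp : ℕ → V → V) (hrp : ∀ p, (Set.range (rp p)).Finite) {α : Type} {n : ℕ}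
    (φ : (colLang K).BoundedFormula α n) :
    ∃ r, ∀ p sd, FVP G rp (fun s : α ⊕ Fin n → V => φ.Realize (s ∘ Sum.inl) (s ∘ Sum.inr)) r p sd := by
  induction φ with
  | falsum => exact ⟨0, fun p sd => FVP.of_left (fun s s' h => Iff.rfl)⟩
  | equal t1 t2 =>
    obtain ⟨x, rfl⟩ := term_var t1
    obtain ⟨y, rfl⟩ := term_var t2
    refine ⟨1, fun p sd => ?_⟩
    have := FVP.eq (G := G) (rp := rp) x y (p := p) (sd := sd)
    simpa [Language.BoundedFormula.Realize, Sum.elim_comp_inl_inr] using this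
  | @rel n l R ts =>
    refine ⟨1, fun p sd => ?_⟩
    simp only [Language.BoundedFormula.Realize, Sum.elim_comp_inl_inr]
    match l, R, ts with
    | 0, R, ts => exact Empty.elim R
    | 1, R, ts =>
      obtain ⟨x, hx⟩ := term_var (ts 0)
      refine FVP.of_one x (fun s s' h => ?_)
      have : (fun i => (ts i).realize s) = (fun i => (ts i).realize s') := by
        funext i
        obtain rfl : i = 0 := Subsingleton.elim _ _
        rw [hx]
        exact h
      rw [this]
    | 2, R, ts =>
      obtain ⟨x, hx⟩ := term_var (ts 0)
      obtain ⟨y, hy⟩ := term_var (ts 1)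
      have := FVP.adj (G := G) (rp := rp) x y hrp (p := p) (sd := sd)
      have e : ∀ s, Language.Structure.RelMap R (fun i => (ts i).realize s) ↔ G.Adj (s x) (s y) := by
        intro s
        refine (hadj _).trans ?_
        rw [hx, hy]
        rfl
      simpa only [e] using this
    | l + 3, R, ts => exact Empty.elim R
  | imp φ ψ ih1 ih2 =>
    obtain ⟨r1, h1⟩ := ih1
    obtain ⟨r2, h2⟩ := ih2
    exact ⟨max r1 r2, fun p sd => FVP.imp ((h1 p sd).mono (le_max_left _ _))
      ((h2 p sd).mono (le_max_right _ _))⟩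
  | all φ ih =>
    obtain ⟨r, h⟩ := ih
    exact ⟨r + r, fun p sd => FVP.all h⟩

/-- The symmetrised interpretation. -/
def PhiS {V : Type} {K : ℕ} (inst : (colLang K).Structure V) (φ : (colLang K).Formula (Fin 2))
    (u v : V) : Prop :=
  u ≠ v ∧ ((@Language.Formula.Realize (colLang K) V inst (Fin 2) φ ![u, v]) ∨
    (@Language.Formula.Realize (colLang K) V inst (Fin 2) φ ![v, u]))

theorem PhiS_comm {V : Type} {K : ℕ} (inst : (colLang K).Structure V)
    (φ : (colLang K).Formula (Fin 2)) (u v : V) : PhiS inst φ u v ↔ PhiS inst φ v u := by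
  unfold PhiS
  rw [or_comm, ne_comm]

theorem FV_pair {V : Type} [Nonempty V] {G : SimpleGraph V} {rp : ℕ → V → V}
    {P : (Fin 2 ⊕ Fin 0 → V) → Prop} {r p : ℕ}
    (h : ∀ sd, FVP G rp P r p sd) :
    ∃ A : Type, Finite A ∧ ∀ L, GoodFil G rp L → ∃ (B : Type) (f : V → A) (g : V → B)
      (T : A → B → Prop), ∀ u ∈ L p, ∀ v ∉ L (p + (r + 1)),
        ((u ≠ v ∧ (P (Sum.elim ![u, v] Fin.elim0) ∨ P (Sum.elim ![v, u] Fin.elim0))) ↔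
          T (f u) (g v)) := by
  obtain ⟨A, B, hA, hB, h1⟩ := h (Sum.elim ![true, false] Fin.elim0)
  obtain ⟨A', B', hA', hB', h2⟩ := h (Sum.elim ![false, true] Fin.elim0)
  refine ⟨A × A', inferInstance, fun L hL => ?_⟩
  obtain ⟨f, g, T, hf, hg, hT⟩ := h1 L hL
  obtain ⟨f', g', T', hf', hg', hT'⟩ := h2 L hL
  let d : V := Classical.arbitrary V
  refine ⟨B × B', fun u => (f (Sum.elim ![u, d] Fin.elim0), f' (Sum.elim ![d, u] Fin.elim0)),
    fun v => (g (Sum.elim ![d, v] Fin.elim0), g' (Sum.elim ![v, d] Fin.elim0)),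
    fun a b => T a.1 b.1 ∨ T' a.2 b.2, ?_⟩
  intro u hu v hv
  have hne : u ≠ v := by
    rintro rfl
    exact hv (hL.1 (by omega) hu)
  have hv' : v ∉ L (p + r) := fun h => hv (hL.1 (by omega) h)
  have e1 := hT (Sum.elim ![u, v] Fin.elim0)
    (by
      rintro (i | i)
      · fin_cases i <;> simp [hu]
      · exact i.elim0)
    (by
      rintro (i | i)
      · fin_cases i <;> simp [hv']
      · exact i.elim0)
  have e2 := hT' (Sum.elim ![v, u] Fin.elim0)
    (by
      rintro (i | i)
      · fin_cases i <;> simp [hu]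
      · exact i.elim0)
    (by
      rintro (i | i)
      · fin_cases i <;> simp [hv']
      · exact i.elim0)
  have f1 := hf (Sum.elim ![u, v] Fin.elim0) (Sum.elim ![u, d] Fin.elim0) (by
      rintro (i | i)
      · fin_cases i <;> simp
      · exact i.elim0)
  have f2 := hf' (Sum.elim ![v, u] Fin.elim0) (Sum.elim ![d, u] Fin.elim0) (by
      rintro (i | i)
      · fin_cases i <;> simp
      · exact i.elim0)
  have g1 := hg (Sum.elim ![u, v] Fin.elim0) (Sum.elim ![d, v] Fin.elim0) (by
      rintro (i | i)
      · fin_cases i <;> simp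
      · exact i.elim0)
  have g2 := hg' (Sum.elim ![v, u] Fin.elim0) (Sum.elim ![v, d] Fin.elim0) (by
      rintro (i | i)
      · fin_cases i <;> simp
      · exact i.elim0)
  rw [e1, e2, f1, f2, g1, g2]
  simp [hne]

theorem pigeon {V ι : Type} {A B : Type} [Finite A] (Φ : V → V → Prop) (f : V → A) (g : V → B)
    (T : A → B → Prop) (I : Finset ι) (u v : ι → V)
    (h : ∀ t ∈ I, ∀ s ∈ I, (Φ (u t) (v s) ↔ T (f (u t)) (g (v s))))
    (h2 : ∀ t ∈ I, ∀ s ∈ I, (Φ (u t) (v s) ↔ t = s)) : I.card ≤ Nat.card A := by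
  classical
  have hinj : Function.Injective (fun t : I => f (u t)) := by
    intro t s hts
    have hts : f (u t) = f (u s) := hts
    have h3 := (h2 t t.2 t t.2).2 rfl
    rw [h t t.2 t t.2, hts, ← h s s.2 t t.2, h2 s s.2 t t.2] at h3
    exact Subtype.ext h3.symm
  have := Nat.card_le_card_of_injective _ hinj
  simpa using this

theorem final_contra_s17 {V : Type} [Nonempty V] {K : ℕ} (inst : (colLang K).Structure V)
    (G : SimpleGraph V)
    (hadj : ∀ x : Fin 2 → V, inst.RelMap (adjSym K) x ↔ G.Adj (x 0) (x 1))
    (C : ∀ n : ℕ, SimpleGraph (Fin n) → Prop)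
    (hAge : ∀ (N : ℕ) (g : Fin N → V), Function.Injective g → C N (G.comap g))
    (c : ℕ) (hc : ∀ n : ℕ, Set.ncard {G : SimpleGraph (Fin n) | C n G} ≤ Nat.factorial n * c ^ n)
    (φ : (colLang K).Formula (Fin 2)) (a b : ℕ → V) (cc : ℕ → ℕ → V)
    (h1 : ∀ i i' j, PhiS inst φ (a i) (cc i' j) ↔ i = i')
    (h2 : ∀ i j j', PhiS inst φ (b j) (cc i j') ↔ j = j') : False := by
  classical
  have ha : Function.Injective a := by
    intro i i' h
    have := (h1 i i 0).2 rfl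
    rw [h, h1] at this
    exact this.symm
  let U : Ultrafilter V := Ultrafilter.map a (Filter.hyperfilter ℕ)
  have hU : ∀ x, ∀ᶠ y in (U : Filter V), y ≠ x := by
    intro x
    have : ∀ᶠ i in (Filter.hyperfilter ℕ : Filter ℕ), a i ≠ x := by
      apply Filter.hyperfilter_le_cofinite
      exact ha.tendsto_cofinite (Set.finite_singleton x).compl_mem_cofinite
    exact this
  have hfin := rep_finite G U hU C hAge c hc
  obtain ⟨r, hr⟩ := FV_main inst G hadj (rep G U) hfin φ
  obtain ⟨A, hA, hFA⟩ := FV_pair (fun sd => hr 0 sd)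
  obtain ⟨A', hA', hFA'⟩ := FV_pair (fun sd => hr (0 + (r+1)) sd)
  have key : ∀ u v : V, (u ≠ v ∧ ((@Language.BoundedFormula.Realize (colLang K) V inst (Fin 2) 0 φ
      (Sum.elim ![u, v] Fin.elim0 ∘ Sum.inl) (Sum.elim ![u, v] Fin.elim0 ∘ Sum.inr)) ∨
      (@Language.BoundedFormula.Realize (colLang K) V inst (Fin 2) 0 φ
      (Sum.elim ![v, u] Fin.elim0 ∘ Sum.inl) (Sum.elim ![v, u] Fin.elim0 ∘ Sum.inr)))) ↔
      PhiS inst φ u v := by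
    intro u v
    unfold PhiS Language.Formula.Realize
    simp only [Sum.elim_comp_inl, Sum.elim_comp_inr]
    have e : (Fin.elim0 : Fin 0 → V) = default := Subsingleton.elim _ _
    rw [e]
  simp only [key] at hFA hFA'
  set m := Nat.card A + Nat.card A' + 1 with hm
  have hgood : ∀ᶠ i in (Filter.hyperfilter ℕ : Filter ℕ), ∀ s : Fin m,
      b s ∉ Lev G U (0 + (r+1) + (r+1)) (a i) := by
    rw [Filter.eventually_all]
    intro s
    exact Lev_avoid G U hU _ (b s)
  have hinf : {i | ∀ s : Fin m, b s ∉ Lev G U (0 + (r+1) + (r+1)) (a i)}.Infinite := by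
    intro hf
    exact Filter.notMem_hyperfilter_of_finite hf hgood
  let e := hinf.natEmbedding
  let i : Fin m → ℕ := fun t => (e t : ℕ)
  have hi : Function.Injective i := by
    intro t s h
    exact Fin.ext (e.injective (Subtype.ext h))
  have hib : ∀ t s : Fin m, b s ∉ Lev G U (0 + (r+1) + (r+1)) (a (i t)) := fun t s => (e t).2 s
  let L : ℕ → Set V := fun p => ⋃ t, Lev G U p (a (i t))
  have hL : GoodFil G (rep G U) L := by
    constructor
    · refine monotone_nat_of_le_succ (fun p => ?_)
      refine Set.iUnion_mono (fun t => ?_)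
      intro x hx
      exact (mem_Lev_succ G U p _ x).2 (Or.inl hx)
    · intro p u v hu hv
      obtain ⟨t, ht⟩ := Set.mem_iUnion.1 hu
      have hv' : v ∉ Lev G U (p+1) (a (i t)) := fun h => hv (Set.mem_iUnion.2 ⟨t, h⟩)
      rw [mem_Lev_succ] at hv'
      by_contra hcon
      apply hv'
      refine Or.inr ⟨u, ht, ?_⟩
      rwa [G.adj_comm v, G.adj_comm (rep G U p v)]
  obtain ⟨B, f, g, T, hT⟩ := hFA L hL
  obtain ⟨B', f', g', T', hT'⟩ := hFA' L hL
  let cv : Fin m → V := fun t => cc (i t) t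
  let I1 : Finset (Fin m) := Finset.univ.filter (fun t => cv t ∈ L (0 + (r+1)))
  let I2 : Finset (Fin m) := Finset.univ.filter (fun t => ¬ cv t ∈ L (0 + (r+1)))
  have hsum : I1.card + I2.card = m := by
    have := Finset.card_filter_add_card_filter_not (s := (Finset.univ : Finset (Fin m)))
      (fun t => cv t ∈ L (0 + (r+1)))
    rw [Finset.card_univ, Fintype.card_fin] at this
    exact this
  have c1 : I1.card ≤ Nat.card A' := by
    refine pigeon (PhiS inst φ) f' g' T' I1 cv (fun t => b t) ?_ ?_
    · intro t ht s _
      refine hT' _ (Finset.mem_filter.1 ht).2 _ ?_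
      intro h
      obtain ⟨t', ht'⟩ := Set.mem_iUnion.1 h
      exact hib t' s ht'
    · intro t _ s _
      rw [PhiS_comm, h2, eq_comm, Fin.ext_iff]
  have c2 : I2.card ≤ Nat.card A := by
    refine pigeon (PhiS inst φ) f g T I2 (fun t => a (i t)) cv ?_ ?_
    · intro t _ s hs
      refine hT _ ?_ _ (Finset.mem_filter.1 hs).2
      exact Set.mem_iUnion.2 ⟨t, rfl⟩
    · intro t _ s _
      rw [h1]
      exact hi.eq_iff
  omega

theorem ultra_contra (C : GraphClass) (hHer : Hereditary C)
    (c : ℕ) (hc : ∀ n : ℕ, Set.ncard {G : SimpleGraph (Fin n) | C n G} ≤ Nat.factorial n * c ^ n)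
    {K : ℕ} (φ : (colLang K).Formula (Fin 2)) (M : ℕ → ℕ) (hM : ∀ n, Nonempty (Fin (M n)))
    (Gs : ∀ n, SimpleGraph (Fin (M n))) (hGs : ∀ n, C (M n) (Gs n))
    (cs : ∀ n, Fin (M n) → Fin K)
    (a b : ℕ → ∀ n, Fin (M n)) (cc : ℕ → ℕ → ∀ n, Fin (M n))
    (h1 : ∀ i i' j, ∀ᶠ n in (Filter.hyperfilter ℕ : Filter ℕ),
      (PhiS (colStruct (Gs n) (cs n)) φ (a i n) (cc i' j n) ↔ i = i'))
    (h2 : ∀ i j j', ∀ᶠ n in (Filter.hyperfilter ℕ : Filter ℕ),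
      (PhiS (colStruct (Gs n) (cs n)) φ (b j n) (cc i j' n) ↔ j = j')) : False := by
  classical
  let _ : ∀ n, (colLang K).Structure (Fin (M n)) := fun n => colStruct (Gs n) (cs n)
  let u : Ultrafilter ℕ := Filter.hyperfilter ℕ
  let V : Type := (u : Filter ℕ).Product (fun n => Fin (M n))
  let q : (∀ n, Fin (M n)) → V := fun x => Quotient.mk _ x
  have hq : ∀ x y, q x = q y ↔ ∀ᶠ n in (u : Filter ℕ), x n = y n := by
    intro x y
    exact Quotient.eq''
  have hqs : ∀ v, ∃ x, q x = v := fun v => Quotient.exists_rep v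
  let inst : (colLang K).Structure V :=
    inferInstanceAs ((colLang K).Structure ((u : Filter ℕ).Product (fun n => Fin (M n))))
  have hne : Nonempty V := ⟨q (fun n => (hM n).some)⟩
  have hrel : ∀ x y, inst.RelMap (adjSym K) ![q x, q y] ↔
      ∀ᶠ n in (u : Filter ℕ), (Gs n).Adj (x n) (y n) := by
    intro x y
    have e : ![q x, q y] = fun i => q ((![x, y] : Fin 2 → ∀ n, Fin (M n)) i) := by
      funext i; fin_cases i <;> rfl
    rw [e]
    exact Language.relMap_quotient_mk' (s := (u : Filter ℕ).productSetoid (fun n => Fin (M n)))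
      (adjSym K) ![x, y]
  let G : SimpleGraph V :=
    { Adj := fun v w => inst.RelMap (adjSym K) ![v, w]
      symm := ⟨by
        intro v w h
        obtain ⟨x, rfl⟩ := hqs v
        obtain ⟨y, rfl⟩ := hqs w
        rw [hrel] at h ⊢
        exact h.mono (fun n hn => hn.symm)⟩
      loopless := ⟨by
        intro v h
        obtain ⟨x, rfl⟩ := hqs v
        rw [hrel] at h
        obtain ⟨n, hn⟩ := h.exists
        exact (Gs n).loopless.irrefl _ hn⟩ }
  have hGadj : ∀ x y, G.Adj (q x) (q y) ↔ ∀ᶠ n in (u : Filter ℕ), (Gs n).Adj (x n) (y n) := hrel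
  have hadj : ∀ x : Fin 2 → V, inst.RelMap (adjSym K) x ↔ G.Adj (x 0) (x 1) := by
    intro x
    have e : x = ![x 0, x 1] := by funext i; fin_cases i <;> rfl
    conv_lhs => rw [e]
  have hAge : ∀ (N : ℕ) (g : Fin N → V), Function.Injective g → C N (G.comap g) := by
    intro N g hg
    choose x hx using fun z => hqs (g z)
    have e1 : ∀ᶠ n in (u : Filter ℕ), ∀ z z',
        ((Gs n).Adj (x z n) (x z' n) ↔ G.Adj (g z) (g z')) := by
      rw [Filter.eventually_all]
      intro z
      rw [Filter.eventually_all]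
      intro z'
      rw [← hx, ← hx]
      by_cases h : G.Adj (q (x z)) (q (x z'))
      · have h' := (hGadj _ _).1 h
        filter_upwards [h'] with n hn
        exact ⟨fun _ => h, fun _ => hn⟩
      · have h' := h
        rw [hGadj, ← Ultrafilter.eventually_not] at h'
        filter_upwards [h'] with n hn
        exact ⟨fun h => absurd h hn, fun h3 => absurd h3 h⟩
    have e2 : ∀ᶠ n in (u : Filter ℕ), ∀ z z', z ≠ z' → x z n ≠ x z' n := by
      rw [Filter.eventually_all]
      intro z
      rw [Filter.eventually_all]
      intro z'
      by_cases hz : z = z'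
      · exact Filter.Eventually.of_forall (fun n h => absurd hz h)
      · have : ¬ q (x z) = q (x z') := by
          rw [hx, hx]
          exact fun h => hz (hg h)
        rw [hq, ← Ultrafilter.eventually_not] at this
        exact this.mono (fun n hn _ => hn)
    obtain ⟨n, hn1, hn2⟩ := (e1.and e2).exists
    have h3 := hHer (M n) (Gs n) N (fun z => x z n) (fun z z' h => by
      by_contra hcon
      exact hn2 z z' hcon h) (hGs n)
    have h4 : (Gs n).comap (fun z => x z n) = G.comap g := by
      ext z z'
      exact hn1 z z'
    rw [← h4]
    exact h3
  have hreal : ∀ x y : (∀ n, Fin (M n)),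
      (@Language.Formula.Realize (colLang K) V inst (Fin 2) φ ![q x, q y]) ↔
      ∀ᶠ n in (u : Filter ℕ),
        @Language.Formula.Realize (colLang K) _ (colStruct (Gs n) (cs n)) (Fin 2) φ ![x n, y n] := by
    intro x y
    have e : ![q x, q y] = fun i => q ((![x, y] : Fin 2 → ∀ n, Fin (M n)) i) := by
      funext i; fin_cases i <;> rfl
    have e2 : ∀ n, ![x n, y n] = fun i => (![x, y] : Fin 2 → ∀ n, Fin (M n)) i n := by
      intro n; funext i; fin_cases i <;> rfl
    rw [e]
    simp only [e2]
    exact Language.Ultraproduct.realize_formula_cast (u := u) φ ![x, y]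
  have hPhi : ∀ x y : (∀ n, Fin (M n)), PhiS inst φ (q x) (q y) ↔
      ∀ᶠ n in (u : Filter ℕ), PhiS (colStruct (Gs n) (cs n)) φ (x n) (y n) := by
    intro x y
    unfold PhiS
    rw [hreal, hreal, Ne, hq, ← Ultrafilter.eventually_not, ← Ultrafilter.eventually_or,
      ← Filter.eventually_and]
  have hiff : ∀ (P : ℕ → Prop) (Q : Prop), (∀ᶠ n in (u : Filter ℕ), (P n ↔ Q)) →
      ((∀ᶠ n in (u : Filter ℕ), P n) ↔ Q) := by
    intro P Q h
    rw [Filter.eventually_congr h]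
    simp
  exact final_contra_s17 inst G hadj C hAge c hc φ (fun i => q (a i)) (fun i => q (b i))
    (fun i j => q (cc i j)) (fun i i' j => (hPhi _ _).trans (hiff _ _ (h1 i i' j)))
    (fun i j j' => (hPhi _ _).trans (hiff _ _ (h2 i j j')))

def patRel (n : ℕ) : (Fin (n+1) ⊕ Fin (n+1)) ⊕ (Fin (n+1) × Fin (n+1)) →
    (Fin (n+1) ⊕ Fin (n+1)) ⊕ (Fin (n+1) × Fin (n+1)) → Prop
  | Sum.inl (Sum.inl i), Sum.inr q => i = q.1
  | Sum.inl (Sum.inr j), Sum.inr q => j = q.2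
  | _, _ => False

def clampF (n i : ℕ) : Fin (n+1) := ⟨min i n, by omega⟩

theorem clampF_eq (i i' : ℕ) : ∀ᶠ n in (Filter.hyperfilter ℕ : Filter ℕ),
    (clampF n i = clampF n i' ↔ i = i') := by
  apply Nat.hyperfilter_le_atTop
  filter_upwards [Filter.eventually_ge_atTop (max i i')] with n hn
  simp only [clampF, Fin.mk.injEq]
  omega

/-- Let `C` be a hereditary class of finite graphs, closed under
isomorphism, that is small: for some constant `c`, for every `n` the number of labeled
`n`-vertex graphs in `C` (graphs on the vertex set `Fin n`) is at most `n! · c^n`.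
Then `C` is monadically dependent. -/
theorem small_hereditary_monadicallyDependent (C : GraphClass)
    (hHer : Hereditary C)
    (hIso : ∀ (n : ℕ) (G G' : SimpleGraph (Fin n)), Nonempty (G ≃g G') → C n G → C n G')
    (hSmall : ∃ c : ℕ, ∀ n : ℕ,
      Set.ncard {G : SimpleGraph (Fin n) | C n G} ≤ Nat.factorial n * c ^ n) :
    MonadicallyDependent C := by
  classical
  rintro ⟨K, φ, hT⟩
  obtain ⟨c, hc⟩ := hSmall
  have hpat : ∀ n : ℕ, ∃ (N : ℕ) (G : SimpleGraph (Fin N)) (cs : Fin N → Fin K)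
      (e : (Fin (n+1) ⊕ Fin (n+1)) ⊕ (Fin (n+1) × Fin (n+1)) → Fin N), C N G ∧
      ∀ x y, (SimpleGraph.fromRel (patRel n)).Adj x y ↔
        PhiS (colStruct G cs) φ (e x) (e y) := by
    intro n
    let E := Fintype.equivFin ((Fin (n+1) ⊕ Fin (n+1)) ⊕ (Fin (n+1) × Fin (n+1)))
    obtain ⟨N, G, hG, cs, e, he, h⟩ := hT _ ((SimpleGraph.fromRel (patRel n)).comap E.symm)
    refine ⟨N, G, cs, e ∘ E, hG, fun x y => ?_⟩
    have := h (E x) (E y)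
    rw [SimpleGraph.comap_adj, E.symm_apply_apply, E.symm_apply_apply] at this
    exact this
  choose M Gs cs e hGs he using hpat
  refine ultra_contra C hHer c hc φ M (fun n => ⟨e n (Sum.inl (Sum.inl 0))⟩) Gs hGs cs
    (fun i n => e n (Sum.inl (Sum.inl (clampF n i))))
    (fun j n => e n (Sum.inl (Sum.inr (clampF n j))))
    (fun i j n => e n (Sum.inr (clampF n i, clampF n j))) ?_ ?_
  · intro i i' j
    filter_upwards [clampF_eq i i'] with n hn
    rw [← he, SimpleGraph.fromRel_adj]
    simp [patRel, hn]
  · intro i j j'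
    filter_upwards [clampF_eq j j'] with n hn
    rw [← he, SimpleGraph.fromRel_adj]
    simp [patRel, hn]
end

section
/- Let M, M' : I × J → V(G) be a regular pair of meshes of order n > 2 in a graph G. Then M and M' are either identical (M(i,j) = M'(i,j) for all i ∈ I, j ∈ J) or disjoint (their ranges V(M) and V(M') are disjoint). -/
set_option autoImplicit false

/-- Equality of the atomic types of the ordered pairs `(u, v)` and `(u', v')` in `G`:
the pairs agree on equality and on adjacency. -/
def atpEq {V : Type} (G : SimpleGraph V) (u v u' v' : V) : Prop :=
  ((u = v) ↔ (u' = v')) ∧ (G.Adj u v ↔ G.Adj u' v')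

/-- `(M, M')` is a regular pair of meshes (of order `n`, indexed by `Fin n × Fin n`) in `G`:
the atomic type of `(M (i,j), M' (a,b))` depends only on the order types of `(i, a)`
and of `(j, b)`. -/
def RegularPair {V : Type} {n : ℕ} (G : SimpleGraph V)
    (M M' : Fin n × Fin n → V) : Prop :=
  ∀ i j a b i' j' a' b' : Fin n,
    cmp i a = cmp i' a' → cmp j b = cmp j' b' →
    atpEq G (M (i, j)) (M' (a, b)) (M (i', j')) (M' (a', b'))

/-- Let `M, M'` be a regular pair of meshes of order `n > 2` in a graph
`G` (injective maps `Fin n × Fin n → V(G)`).  Then `M` and `M'` are either identical or have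
disjoint ranges. -/
theorem regularPair_identical_or_disjoint {V : Type} (G : SimpleGraph V) (n : ℕ)
    (hn : 2 < n) (M M' : Fin n × Fin n → V)
    (hM : Function.Injective M) (hM' : Function.Injective M')
    (hreg : RegularPair G M M') :
    (∀ p : Fin n × Fin n, M p = M' p) ∨ (∀ p q : Fin n × Fin n, M p ≠ M' q) := by
  by_cases h : ∀ p q : Fin n × Fin n, M p ≠ M' q
  · exact Or.inr h
  left
  push Not at h
  obtain ⟨⟨i, j⟩, ⟨a, b⟩, e⟩ := h
  have key : ∀ i' j' a' b' : Fin n, cmp i a = cmp i' a' → cmp j b = cmp j' b' →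
      M (i', j') = M' (a', b') := fun i' j' a' b' h1 h2 =>
    (hreg i j a b i' j' a' b' h1 h2).1.1 e
  have aux : ∀ x y : Fin n, x ≠ y →
      ∃ u v w : Fin n, v ≠ w ∧ cmp x y = cmp u v ∧ cmp x y = cmp u w := by
    intro x y hxy
    rcases lt_or_gt_of_ne hxy with h | h
    · refine ⟨⟨0, by omega⟩, ⟨1, by omega⟩, ⟨2, by omega⟩, by simp, ?_, ?_⟩ <;>
      · rw [(cmp_eq_lt_iff x y).2 h]
        exact ((cmp_eq_lt_iff _ _).2 (by simp [Fin.lt_def])).symm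
    · refine ⟨⟨2, by omega⟩, ⟨0, by omega⟩, ⟨1, by omega⟩, by simp, ?_, ?_⟩ <;>
      · rw [(cmp_eq_gt_iff x y).2 h]
        exact ((cmp_eq_gt_iff _ _).2 (by simp [Fin.lt_def])).symm
  have hi : i = a := by
    by_contra hne
    obtain ⟨u, v, w, hvw, h1, h2⟩ := aux i a hne
    have := hM' ((key u j v b h1 rfl).symm.trans (key u j w b h2 rfl))
    exact hvw (congrArg Prod.fst this)
  have hj : j = b := by
    by_contra hne
    obtain ⟨u, v, w, hvw, h1, h2⟩ := aux j b hne
    have := hM' ((key i u a v rfl h1).symm.trans (key i u a w rfl h2))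
    exact hvw (congrArg Prod.snd this)
  subst hi hj
  rintro ⟨p, q⟩
  exact key p q p q (by simp) (by simp)
end

section
/- Let G be a finite graph and M a regular mesh of order n in G which is a generalized grid. Then M is a {0,2}-mesh or a {1,3}-mesh, or G contains the comparability grid of order ⌊√n⌋ as an induced subgraph. -/
set_option autoImplicit false

/-- The comparability grid of order `n`: vertices `a_{i,j}` for `i, j ∈ [n]`, where distinct
`a_{i,j}` and `a_{i',j'}` are adjacent iff `i = i'`, or `j = j'`, or (`i < i' ⟺ j < j'`). -/
def compGrid (n : ℕ) : SimpleGraph (Fin n × Fin n) :=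
  SimpleGraph.fromRel fun u v =>
    u.1 = v.1 ∨ u.2 = v.2 ∨ (u.1 < v.1 ↔ u.2 < v.2)

/-- `M` is a `P`-mesh in `G`, for `P ⊆ {0, 1, 2, 3}`: for `(i,j) ≠ (i',j')` with `i ≤ i'`,
the vertices `M (i,j)` and `M (i',j')` are adjacent iff
(`i = i'` and `j ≠ j'` and `0 ∈ P`), or (`i < i'` and `j < j'` and `1 ∈ P`), or
(`i < i'` and `j = j'` and `2 ∈ P`), or (`i < i'` and `j > j'` and `3 ∈ P`). -/
def IsPMesh {V : Type} {n : ℕ} (G : SimpleGraph V) (M : Fin n × Fin n → V)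
    (P : Set (Fin 4)) : Prop :=
  ∀ i j i' j' : Fin n, (i, j) ≠ (i', j') → i ≤ i' →
    (G.Adj (M (i, j)) (M (i', j')) ↔
      ((i = i' ∧ j ≠ j' ∧ (0 : Fin 4) ∈ P) ∨
       (i < i' ∧ j < j' ∧ (1 : Fin 4) ∈ P) ∨
       (i < i' ∧ j = j' ∧ (2 : Fin 4) ∈ P) ∨
       (i < i' ∧ j' < j ∧ (3 : Fin 4) ∈ P)))

/-- `M` is a generalized grid in `G`: over distinct pairs, the adjacency of `M (i,j)` and
`M (i',j')` does not depend only on the order type of `(i, i')`, and also does not depend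
only on the order type of `(j, j')`. -/
def IsGenGrid {V : Type} {n : ℕ} (G : SimpleGraph V) (M : Fin n × Fin n → V) : Prop :=
  (¬ ∀ i j a b i' j' a' b' : Fin n,
      (i, j) ≠ (a, b) → (i', j') ≠ (a', b') → cmp i a = cmp i' a' →
      (G.Adj (M (i, j)) (M (a, b)) ↔ G.Adj (M (i', j')) (M (a', b')))) ∧
  (¬ ∀ i j a b i' j' a' b' : Fin n,
      (i, j) ≠ (a, b) → (i', j') ≠ (a', b') → cmp j b = cmp j' b' →
      (G.Adj (M (i, j)) (M (a, b)) ↔ G.Adj (M (i', j')) (M (a', b'))))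

theorem mesh_adj_form {V : Type} (G : SimpleGraph V) (n : ℕ) (hn : 2 ≤ n)
    (M : Fin n × Fin n → V) (hreg : RegularPair G M M) :
    ∃ p0 p1 p2 p3 : Prop, ∀ i j a b : Fin n, G.Adj (M (i, j)) (M (a, b)) ↔
      (i = a ∧ j ≠ b ∧ p0) ∨ (i ≠ a ∧ j = b ∧ p2) ∨
      (((i < a ∧ j < b) ∨ (a < i ∧ b < j)) ∧ p1) ∨
      (((i < a ∧ b < j) ∨ (a < i ∧ j < b)) ∧ p3) := by
  let z : Fin n := ⟨0, by omega⟩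
  let o : Fin n := ⟨1, by omega⟩
  have hzo : z < o := by simp [z, o, Fin.lt_def]
  have key : ∀ i j a b i' j' a' b' : Fin n, cmp i a = cmp i' a' → cmp j b = cmp j' b' →
      (G.Adj (M (i, j)) (M (a, b)) ↔ G.Adj (M (i', j')) (M (a', b'))) :=
    fun i j a b i' j' a' b' h1 h2 => (hreg i j a b i' j' a' b' h1 h2).2
  have clt : ∀ {x y : Fin n}, x < y → cmp x y = cmp z o := by
    intro x y h
    rw [cmp_eq_lt_iff _ _ |>.2 h, cmp_eq_lt_iff _ _ |>.2 hzo]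
  have cgt : ∀ {x y : Fin n}, y < x → cmp x y = cmp o z := by
    intro x y h
    rw [cmp_eq_gt_iff _ _ |>.2 h, cmp_eq_gt_iff _ _ |>.2 hzo]
  have ceq : ∀ {x : Fin n}, cmp x x = cmp z z := by
    intro x
    rw [cmp_self_eq_eq, cmp_self_eq_eq]
  refine ⟨G.Adj (M (z, z)) (M (z, o)), G.Adj (M (z, z)) (M (o, o)),
    G.Adj (M (z, z)) (M (o, z)), G.Adj (M (z, o)) (M (o, z)), ?_⟩
  intro i j a b
  rcases lt_trichotomy i a with h | h | h <;> rcases lt_trichotomy j b with h' | h' | h'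
  · rw [key _ _ _ _ _ _ _ _ (clt h) (clt h')]
    simp [h, h', h.ne, h'.ne, h.not_gt, h'.not_gt]
  · subst h'
    rw [key _ _ _ _ _ _ _ _ (clt h) ceq]
    simp [h.ne]
  · rw [key _ _ _ _ _ _ _ _ (clt h) (cgt h')]
    simp [h, h', h.ne, h'.ne', h.not_gt, h'.not_gt]
  · subst h
    rw [key _ _ _ _ _ _ _ _ ceq (clt h')]
    simp [h'.ne]
  · subst h h'
    simp
  · subst h
    rw [G.adj_comm, key _ _ _ _ _ _ _ _ ceq (clt h')]
    simp [h'.ne']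
  · rw [G.adj_comm, key _ _ _ _ _ _ _ _ (clt h) (cgt h')]
    simp [h, h', h.ne', h'.ne, h.not_gt, h'.not_gt]
  · subst h'
    rw [G.adj_comm, key _ _ _ _ _ _ _ _ (clt h) ceq]
    simp [h.ne']
  · rw [G.adj_comm, key _ _ _ _ _ _ _ _ (clt h) (clt h')]
    simp [h, h', h.ne', h'.ne', h.not_gt, h'.not_gt]

theorem lex_lt_iff {k x y x' y' : ℕ} (hy : y < k) (hy' : y' < k) :
    k * x + y < k * x' + y' ↔ x < x' ∨ (x = x' ∧ y < y') := by
  rcases lt_trichotomy x x' with h | h | h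
  · have : k * (x + 1) ≤ k * x' := Nat.mul_le_mul_left k h
    rw [mul_add] at this
    constructor
    · intro _; exact Or.inl h
    · intro _; omega
  · subst h; simp
  · have : k * (x' + 1) ≤ k * x := Nat.mul_le_mul_left k h
    rw [mul_add] at this
    constructor
    · intro _; omega
    · intro _; omega

theorem lex_lt_sq {n k x y : ℕ} (hk : k * k ≤ n) (hx : x < k) (hy : y < k) :
    k * x + y < n := by
  have : k * (x + 1) ≤ k * k := Nat.mul_le_mul_left k hx
  rw [mul_add] at this
  omega

theorem compGrid_adj_iff {k : ℕ} (u v : Fin k × Fin k) : (compGrid k).Adj u v ↔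
    u ≠ v ∧ ((u.1 ≤ v.1 ∧ u.2 ≤ v.2) ∨ (v.1 ≤ u.1 ∧ v.2 ≤ u.2)) := by
  obtain ⟨a, b⟩ := u
  obtain ⟨c, d⟩ := v
  simp only [compGrid, SimpleGraph.fromRel_adj]
  grind

/-- Let `G` be a finite graph and `M` a regular mesh of order `n` in `G`
which is a generalized grid.  Then `M` is a `{0,2}`-mesh or a `{1,3}`-mesh, or `G` contains
the comparability grid of order `⌊√n⌋` as an induced subgraph. -/
theorem generalizedGrid_classification {V : Type} [Fintype V] (G : SimpleGraph V)
    (n : ℕ) (M : Fin n × Fin n → V) (hinj : Function.Injective M)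
    (hreg : RegularPair G M M) (hgrid : IsGenGrid G M) :
    IsPMesh G M {0, 2} ∨ IsPMesh G M {1, 3} ∨
      Nonempty (compGrid (Nat.sqrt n) ↪g G) := by
  have hn : 2 ≤ n := by
    by_contra hlt
    have hs : Subsingleton (Fin n) := Fin.subsingleton_iff_le_one.2 (by omega)
    exact hgrid.1 fun i j a b _ _ _ _ h => absurd (Subsingleton.elim _ _) h
  obtain ⟨p0, p1, p2, p3, hA⟩ := mesh_adj_form G n hn M hreg
  have ceq : ∀ {x y x' y' : Fin n}, cmp x y = cmp x' y' → (x = y ↔ x' = y') := by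
    intro x y x' y' h
    rw [← cmp_eq_eq_iff, h, cmp_eq_eq_iff]
  have g1 : ¬ ((p1 ↔ p3) ∧ (p2 ↔ p1)) := by
    rintro ⟨h13, h21⟩
    have hB : ∀ i j a b : Fin n, (i, j) ≠ (a, b) →
        (G.Adj (M (i, j)) (M (a, b)) ↔ (i = a ∧ p0) ∨ (i ≠ a ∧ p1)) := by
      intro i j a b h
      rw [hA]
      grind
    refine hgrid.1 fun i j a b i' j' a' b' h h' hc => ?_
    rw [hB _ _ _ _ h, hB _ _ _ _ h', ne_eq, ne_eq, ceq hc]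
  have g2 : ¬ ((p1 ↔ p3) ∧ (p0 ↔ p1)) := by
    rintro ⟨h13, h21⟩
    have hB : ∀ i j a b : Fin n, (i, j) ≠ (a, b) →
        (G.Adj (M (i, j)) (M (a, b)) ↔ (j = b ∧ p2) ∨ (j ≠ b ∧ p1)) := by
      intro i j a b h
      rw [hA]
      grind
    refine hgrid.2 fun i j a b i' j' a' b' h h' hc => ?_
    rw [hB _ _ _ _ h, hB _ _ _ _ h', ne_eq, ne_eq, ceq hc]
  by_cases h13 : p1 ↔ p3
  · by_cases h1 : p1
    · right; left
      intro i j a b h hle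
      rw [hA]
      simp
      grind
    · left
      intro i j a b h hle
      rw [hA]
      simp
      grind
  right; right
  have hk : Nat.sqrt n * Nat.sqrt n ≤ n := Nat.sqrt_le n
  generalize Nat.sqrt n = k at hk
  let f : Fin k × Fin k → Fin n := fun u => ⟨k * u.1 + u.2, lex_lt_sq hk u.1.2 u.2.2⟩
  let g : Fin k × Fin k → Fin n := fun u => ⟨k * u.2 + u.1, lex_lt_sq hk u.2.2 u.1.2⟩
  have hf : ∀ u v, f u < f v ↔ u.1 < v.1 ∨ (u.1 = v.1 ∧ u.2 < v.2) := by
    intro u v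
    simp only [f, Fin.lt_def, Fin.ext_iff]
    exact lex_lt_iff u.2.2 v.2.2
  have hg : ∀ u v, g u < g v ↔ u.2 < v.2 ∨ (u.2 = v.2 ∧ u.1 < v.1) := by
    intro u v
    simp only [g, Fin.lt_def, Fin.ext_iff]
    exact lex_lt_iff u.1.2 v.1.2
  have hfi : ∀ u v, f u = f v → u = v := by
    intro u v h
    have h1 := hf u v
    have h2 := hf v u
    rw [h] at h1 h2
    simp only [lt_irrefl, false_iff] at h1 h2
    ext1 <;> grind
  have hgi : ∀ u v, g u = g v → u = v := by
    intro u v h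
    have h1 := hg u v
    have h2 := hg v u
    rw [h] at h1 h2
    simp only [lt_irrefl, false_iff] at h1 h2
    ext1 <;> grind
  have hcomp : ∀ u v, (compGrid k).Adj u v ↔
      ((f u < f v ∧ g u < g v) ∨ (f v < f u ∧ g v < g u)) := by
    intro u v
    rw [compGrid_adj_iff, hf, hf, hg, hg]
    obtain ⟨a, b⟩ := u
    obtain ⟨c, d⟩ := v
    grind
  by_cases h1 : p1
  · have h3 : ¬ p3 := fun h => h13 ⟨fun _ => h, fun _ => h1⟩
    refine ⟨⟨⟨fun u => M (f u, g u), ?_⟩, ?_⟩⟩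
    · intro u v h
      exact hfi _ _ (Prod.ext_iff.1 (hinj h)).1
    · intro u v
      change G.Adj (M (f u, g u)) (M (f v, g v)) ↔ _
      rw [hcomp, hA]
      have := hfi u v
      have := hgi u v
      grind
  · have h3 : p3 := by tauto
    refine ⟨⟨⟨fun u => M (f u, (g u).rev), ?_⟩, ?_⟩⟩
    · intro u v h
      exact hfi _ _ (Prod.ext_iff.1 (hinj h)).1
    · intro u v
      change G.Adj (M (f u, (g u).rev)) (M (f v, (g v).rev)) ↔ _
      rw [hcomp, hA]
      simp only [Fin.rev_lt_rev, ne_eq, Fin.rev_inj]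
      have := hfi u v
      have := hgi u v
      grind
end
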